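/- arXiv:2411.03674 — 4 statements merged into one kernel-verified Lean document; each statement's English description precedes it below -/
import Mathlib

section
/- Let k ≥ 3 and n ≥ 2k be positive integers. Let ℱ ⊆ ([n] choose k) and 𝒢 ⊆ ([n] choose k) be cross-intersecting families with |𝒢| ≥ |ℱ| ≥ 2. Then |ℱ| + |𝒢| ≤ C(n,k) − C(n−k,k) − C(n−k−1,k−1) + 2. Moreover, for n > 2k, equality holds if and only if, up to a permutation of [n], ℱ = {F₁, F₂} for some F₁, F₂ ∈ ([n] choose k) with |F₁ ∩ F₂| = k−1 and 𝒢 = {G ∈ ([n] choose k) : G ∩ F₁ ≠ ∅ and G ∩ F₂ ≠ ∅}, or k = 3 and either ℱ = {[2] ∪ {i} : i ∈ {3,…,n}} and 𝒢 = {G ∈ ([n] choose 3) : G ∩ [2] ≠ ∅}, or ℱ = 𝒢 = {G ∈ ([n] choose 3) : 1 ∈ G}. -/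
open Finset

section CrossIntersecting

variable {α : Type*} [DecidableEq α]

/-- The image of a set under the transposition of `i` and `j`. -/
def swapSet (i j : α) (A : Finset α) : Finset α := A.image (Equiv.swap i j)

/-- The image of a family of sets under the transposition of `i` and `j`. -/
def swapFam (i j : α) (F : Finset (Finset α)) : Finset (Finset α) := F.image (swapSet i j)

/-- Two cross-intersecting families of `k`-element subsets of `X`. -/
structure IsCrossPair (X : Finset α) (k : ℕ) (F G : Finset (Finset α)) : Prop where
  left_sub : F ⊆ powersetCard k X
  right_sub : G ⊆ powersetCard k X
  cross : ∀ A ∈ F, ∀ B ∈ G, (A ∩ B).Nonempty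

/-- Every cross-intersecting pair of families with at least two members each has total size
at most `s`. -/
def SumBound (X : Finset α) (k s : ℕ) : Prop :=
  ∀ F G, IsCrossPair X k F G → 2 ≤ #F → 2 ≤ #G → #F + #G ≤ s

/-- The largest total size of two cross-intersecting `k`-uniform families on `n` points with at
least two members each. -/
def maxSum (n k : ℕ) : ℤ :=
  (n.choose k : ℤ) - (n - k).choose k - (n - k - 1).choose (k - 1) + 2

/-- All sets obtained from `Y` by adding one point of `X`. -/
def book (X Y : Finset α) : Finset (Finset α) := (X \ Y).image (insert · Y)

theorem mem_swapSet {i j x : α} {A : Finset α} : x ∈ swapSet i j A ↔ Equiv.swap i j x ∈ A := by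
  simp only [swapSet, mem_image]
  constructor
  · rintro ⟨a, ha, rfl⟩
    simpa using ha
  · intro h
    exact ⟨_, h, by simp⟩

@[simp] theorem swapSet_swapSet (i j : α) (A : Finset α) : swapSet i j (swapSet i j A) = A := by
  ext x
  simp [mem_swapSet]

theorem mem_swapFam {i j : α} {A : Finset α} {F : Finset (Finset α)} :
    A ∈ swapFam i j F ↔ swapSet i j A ∈ F := by
  simp only [swapFam, mem_image]
  constructor
  · rintro ⟨a, ha, rfl⟩
    simpa using ha
  · intro h
    exact ⟨_, h, by simp⟩

@[simp] theorem card_swapSet (i j : α) (A : Finset α) : #(swapSet i j A) = #A :=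
  card_image_of_injective _ (Equiv.injective _)

@[simp] theorem card_swapFam (i j : α) (F : Finset (Finset α)) : #(swapFam i j F) = #F :=
  card_image_of_injective _ (Function.Involutive.injective (swapSet_swapSet i j))

theorem swapSet_eq_self {i j : α} {A : Finset α} (h : i ∈ A ↔ j ∈ A) : swapSet i j A = A := by
  ext x
  rw [mem_swapSet]
  by_cases hi : x = i
  · subst hi; simp [h]
  · by_cases hj : x = j
    · subst hj; simp [h]
    · rw [Equiv.swap_apply_of_ne_of_ne hi hj]

theorem swapSet_eq_insert {i j : α} {A : Finset α} (hi : i ∈ A) (hj : j ∉ A) :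
    swapSet i j A = insert j (A.erase i) := by
  ext x
  rw [mem_swapSet]
  by_cases hxi : x = i
  · subst hxi
    have : x ≠ j := by rintro rfl; exact hj hi
    simp [this, hj]
  · by_cases hxj : x = j
    · subst hxj; simp [hi]
    · rw [Equiv.swap_apply_of_ne_of_ne hxi hxj]; simp [hxi, hxj]

theorem swapSet_comm (i j : α) (A : Finset α) : swapSet i j A = swapSet j i A := by
  simp only [swapSet, Equiv.swap_comm]

theorem swapFam_comm (i j : α) (F : Finset (Finset α)) : swapFam i j F = swapFam j i F := by
  ext A
  rw [mem_swapFam, mem_swapFam, swapSet_comm]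

theorem swapSet_subset {i j : α} {A X : Finset α} (hA : A ⊆ X) (hi : i ∈ X) (hj : j ∈ X) :
    swapSet i j A ⊆ X := by
  intro x hx
  rw [mem_swapSet] at hx
  by_cases hxi : x = i
  · rwa [hxi]
  · by_cases hxj : x = j
    · rwa [hxj]
    · rw [Equiv.swap_apply_of_ne_of_ne hxi hxj] at hx
      exact hA hx

theorem swapFam_eq_self_iff {i j : α} {F : Finset (Finset α)} :
    swapFam i j F = F ↔ ∀ A ∈ F, swapSet i j A ∈ F := by
  constructor
  · intro h A hA
    rw [← h, mem_swapFam] at hA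
    exact hA
  · intro h
    ext A
    rw [mem_swapFam]
    refine ⟨fun hA => ?_, h A⟩
    simpa using h _ hA

theorem swapFam_trans {i j l : α} {F : Finset (Finset α)} (hij : swapFam i j F = F)
    (hjl : swapFam j l F = F) : swapFam i l F = F := by
  by_cases h : i = l
  · subst h
    rw [swapFam_eq_self_iff]
    intro A hA
    rwa [swapSet_eq_self Iff.rfl]
  by_cases h1 : i = j
  · rwa [h1]
  by_cases h2 : l = j
  · rwa [h2]
  rw [swapFam_eq_self_iff] at *
  intro A hA
  have := hij _ (hjl _ (hij _ hA))
  convert this using 1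
  ext x
  simp only [mem_swapSet]
  have e : Equiv.swap i j * Equiv.swap j l * Equiv.swap i j = Equiv.swap i l := by
    rw [Equiv.swap_comm i j, Equiv.swap_comm j l,
      Equiv.swap_mul_swap_mul_swap h2 (Ne.symm h)]
  rw [← e]
  rfl

/-- A family invariant under all transpositions inside `P` contains every set of the right size
that agrees with one of its members outside `P`. -/
theorem mem_of_swapFam_eq {P : Finset α} {F : Finset (Finset α)}
    (hP : ∀ i ∈ P, ∀ j ∈ P, swapFam i j F = F) {E E' : Finset α} (hE : E ∈ F)
    (hc : #E' = #E) (ho : E' \ P = E \ P) : E' ∈ F := by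
  induction hm : #(E' \ E) generalizing E with
  | zero =>
    have : E' ⊆ E := by rwa [card_eq_zero, sdiff_eq_empty_iff_subset] at hm
    rwa [eq_of_subset_of_card_le this hc.ge]
  | succ m ih =>
    have h1 : #(E \ E') = m + 1 := by
      rw [← hm]; exact (card_sdiff_comm hc).symm
    obtain ⟨p', hp'⟩ := card_pos.1 (by omega : 0 < #(E' \ E))
    obtain ⟨p, hp⟩ := card_pos.1 (by omega : 0 < #(E \ E'))
    rw [mem_sdiff] at hp hp'
    have hpP : p ∈ P := by
      by_contra h
      have : p ∈ E \ P := mem_sdiff.2 ⟨hp.1, h⟩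
      rw [← ho] at this
      exact hp.2 (mem_sdiff.1 this).1
    have hpP' : p' ∈ P := by
      by_contra h
      have : p' ∈ E' \ P := mem_sdiff.2 ⟨hp'.1, h⟩
      rw [ho] at this
      exact hp'.2 (mem_sdiff.1 this).1
    have hmem : swapSet p p' E ∈ F := swapFam_eq_self_iff.1 (hP p hpP p' hpP') E hE
    have heq := swapSet_eq_insert hp.1 hp'.2
    refine ih hmem (by simp [hc]) ?_ ?_
    · rw [ho, heq]
      ext x
      simp only [mem_sdiff, mem_insert, mem_erase]
      constructor
      · rintro ⟨h1, h2⟩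
        exact ⟨Or.inr ⟨fun h => h2 (h ▸ hpP), h1⟩, h2⟩
      · rintro ⟨h1 | h1, h2⟩
        · exact absurd (h1 ▸ hpP') h2
        · exact ⟨h1.2, h2⟩
    · have : E' \ swapSet p p' E = (E' \ E).erase p' := by
        rw [heq]
        ext x
        simp only [mem_sdiff, mem_insert, mem_erase]
        constructor
        · rintro ⟨h1, h2⟩
          exact ⟨fun h => h2 (Or.inl h), h1, fun h => h2 (Or.inr ⟨fun h3 => hp.2 (h3 ▸ h1), h⟩)⟩
        · rintro ⟨h1, h2, h3⟩
          exact ⟨h2, fun h => h.elim h1 (fun h => h3 h.2)⟩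
      rw [this, card_erase_of_mem (mem_sdiff.2 hp'), hm]
      rfl

namespace IsCrossPair

variable {X : Finset α} {k : ℕ} {F G : Finset (Finset α)}

theorem symm (h : IsCrossPair X k F G) : IsCrossPair X k G F :=
  ⟨h.right_sub, h.left_sub, fun A hA B hB => inter_comm B A ▸ h.cross B hB A hA⟩

theorem map_swap (h : IsCrossPair X k F G) {i j : α} (hi : i ∈ X) (hj : j ∈ X) :
    IsCrossPair X k (swapFam i j F) (swapFam i j G) := by
  have key : ∀ H ⊆ powersetCard k X, swapFam i j H ⊆ powersetCard k X := by
    intro H hH A hA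
    rw [mem_swapFam] at hA
    have := mem_powersetCard.1 (hH hA)
    rw [mem_powersetCard]
    refine ⟨?_, by simpa using this.2⟩
    simpa using swapSet_subset this.1 hi hj
  refine ⟨key _ h.left_sub, key _ h.right_sub, fun A hA B hB => ?_⟩
  rw [mem_swapFam] at hA hB
  obtain ⟨x, hx⟩ := h.cross _ hA _ hB
  rw [mem_inter, mem_swapSet, mem_swapSet] at hx
  exact ⟨_, mem_inter.2 hx⟩

theorem inter_union {F' G' : Finset (Finset α)} (h : IsCrossPair X k F G)
    (h' : IsCrossPair X k F' G') : IsCrossPair X k (F ∩ F') (G ∪ G') := by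
  refine ⟨inter_subset_left.trans h.left_sub, union_subset h.right_sub h'.right_sub, ?_⟩
  intro A hA B hB
  rw [mem_inter] at hA
  rcases mem_union.1 hB with hB | hB
  · exact h.cross A hA.1 B hB
  · exact h'.cross A hA.2 B hB

theorem insert_right (h : IsCrossPair X k F G) {D : Finset α} (hD : D ∈ powersetCard k X)
    (hc : ∀ A ∈ F, (A ∩ D).Nonempty) : IsCrossPair X k F (insert D G) := by
  refine ⟨h.left_sub, insert_subset hD h.right_sub, fun A hA B hB => ?_⟩
  rcases mem_insert.1 hB with rfl | hB
  · exact hc A hA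
  · exact h.cross A hA B hB

/-- In a pair of largest total size the second family contains every set meeting all members of
the first one. -/
theorem mem_right {s : ℕ} (hs : SumBound X k s) (h : IsCrossPair X k F G) (hF : 2 ≤ #F)
    (hG : 2 ≤ #G) (hsum : #F + #G = s) {D : Finset α} (hD : D ∈ powersetCard k X)
    (hc : ∀ A ∈ F, (A ∩ D).Nonempty) : D ∈ G := by
  by_contra hn
  have hcard := card_insert_of_notMem hn
  have := hs F (insert D G) (h.insert_right hD hc) hF (by omega)
  omega

/-- Uncrossing: intersecting an extremal pair with a transposed copy keeps it extremal. -/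
theorem uncross {s : ℕ} (hs : SumBound X k s) (h : IsCrossPair X k F G) (hle : #F ≤ #G)
    (hsum : #F + #G = s) {i j : α} (hi : i ∈ X) (hj : j ∈ X)
    (h2 : 2 ≤ #(F ∩ swapFam i j F)) :
    #(F ∩ swapFam i j F) + #(G ∪ swapFam i j G) = s := by
  have h' := h.map_swap hi hj
  have e1 := card_union_add_card_inter F (swapFam i j F)
  have e2 := card_union_add_card_inter G (swapFam i j G)
  rw [card_swapFam] at e1 e2
  have l1 : #(F ∩ swapFam i j F) ≤ #F := card_le_card inter_subset_left
  have l2 : #G ≤ #(G ∪ swapFam i j G) := card_le_card subset_union_left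
  have b1 := hs _ _ (h.inter_union h') h2 (by omega)
  have b2 := hs _ _ (h.symm.inter_union h'.symm) (by omega) (by omega)
  omega

end IsCrossPair

section Counting

variable {X : Finset α} {k : ℕ}

theorem filter_disjoint_powersetCard (A : Finset α) :
    {D ∈ powersetCard k X | Disjoint A D} = powersetCard k (X \ A) := by
  ext D
  simp only [mem_filter, mem_powersetCard, subset_sdiff, disjoint_comm (a := A)]
  tauto

theorem choose_mono_strict {m r k : ℕ} (hm : m < r) (hk : 1 ≤ k) (hr : k ≤ r) :
    m.choose k < r.choose k := by
  obtain ⟨r, rfl⟩ := Nat.exists_eq_succ_of_ne_zero (by omega : r ≠ 0)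
  obtain ⟨k, rfl⟩ := Nat.exists_eq_succ_of_ne_zero (by omega : k ≠ 0)
  have h1 := Nat.choose_le_choose (k + 1) (by omega : m ≤ r)
  have h2 := Nat.choose_pos (by omega : k ≤ r)
  rw [Nat.succ_eq_add_one, Nat.succ_eq_add_one, Nat.choose_succ_succ']
  omega

theorem maxSum_eq {n : ℕ} (hk : 1 ≤ k) (hn : 2 * k < n) :
    maxSum n k = (n.choose k : ℤ) - 2 * (n - k).choose k + (n - k - 1).choose k + 2 := by
  obtain ⟨k, rfl⟩ := Nat.exists_eq_succ_of_ne_zero (by omega : k ≠ 0)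
  obtain ⟨m, hm⟩ := Nat.exists_eq_succ_of_ne_zero (by omega : n - k.succ ≠ 0)
  rw [maxSum, hm]
  simp only [Nat.succ_eq_add_one, Nat.add_sub_cancel, Nat.choose_succ_succ' m k]
  push_cast
  ring

/-- The number of `k`-sets meeting both `A` and `B`. -/
theorem card_filter_meet_both {A B : Finset α} (hA : A ∈ powersetCard k X)
    (hB : B ∈ powersetCard k X) :
    (#{D ∈ powersetCard k X | (A ∩ D).Nonempty ∧ (B ∩ D).Nonempty} : ℤ) =
      ((#X).choose k : ℤ) - 2 * (#X - k).choose k + (#X - #(A ∪ B)).choose k := by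
  rw [mem_powersetCard] at hA hB
  have h1 := card_filter_add_card_filter_not (s := powersetCard k X)
    (fun D => (A ∩ D).Nonempty ∧ (B ∩ D).Nonempty)
  have h2 : {D ∈ powersetCard k X | ¬ ((A ∩ D).Nonempty ∧ (B ∩ D).Nonempty)} =
      powersetCard k (X \ A) ∪ powersetCard k (X \ B) := by
    rw [← filter_disjoint_powersetCard, ← filter_disjoint_powersetCard, ← filter_or]
    refine filter_congr fun D _ => ?_
    rw [not_and_or, not_nonempty_iff_eq_empty, not_nonempty_iff_eq_empty,
      disjoint_iff_inter_eq_empty, disjoint_iff_inter_eq_empty]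
  have h3 : powersetCard k (X \ A) ∩ powersetCard k (X \ B) = powersetCard k (X \ (A ∪ B)) := by
    ext D
    simp only [mem_inter, mem_powersetCard, subset_sdiff, disjoint_union_right]
    tauto
  have h4 := card_union_add_card_inter (powersetCard k (X \ A)) (powersetCard k (X \ B))
  rw [h2, card_powersetCard] at h1
  rw [h3, card_powersetCard, card_powersetCard, card_powersetCard, card_sdiff_of_subset hA.1,
    card_sdiff_of_subset hB.1, card_sdiff_of_subset (union_subset hA.1 hB.1), hA.2, hB.2] at h4
  omega

theorem card_union_of_mem {A B : Finset α} (hA : A ∈ powersetCard k X)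
    (hB : B ∈ powersetCard k X) : #(A ∪ B) + #(A ∩ B) = 2 * k := by
  rw [card_union_add_card_inter, (mem_powersetCard.1 hA).2, (mem_powersetCard.1 hB).2, two_mul]

theorem card_inter_lt {A B : Finset α} (hA : A ∈ powersetCard k X)
    (hB : B ∈ powersetCard k X) (hAB : A ≠ B) : #(A ∩ B) < k := by
  rw [mem_powersetCard] at hA hB
  by_contra! h
  have h1 := eq_of_subset_of_card_le (inter_subset_left : A ∩ B ⊆ A) (by omega)
  have h2 := eq_of_subset_of_card_le (inter_subset_right : A ∩ B ⊆ B) (by omega)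
  exact hAB (h1.symm.trans h2)

theorem card_filter_meet_both_eq {A B : Finset α} (hk : 1 ≤ k) (hX : 2 * k < #X)
    (hA : A ∈ powersetCard k X) (hB : B ∈ powersetCard k X) (hAB : #(A ∩ B) = k - 1) :
    (#{D ∈ powersetCard k X | (A ∩ D).Nonempty ∧ (B ∩ D).Nonempty} : ℤ) + 2 = maxSum #X k := by
  have := card_union_of_mem hA hB
  rw [card_filter_meet_both hA hB, maxSum_eq hk hX, Nat.sub_sub,
    (by omega : #(A ∪ B) = k + 1)]

theorem card_filter_meet_both_lt {A B : Finset α} (hk : 1 ≤ k) (hX : 2 * k < #X)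
    (hA : A ∈ powersetCard k X) (hB : B ∈ powersetCard k X) (hne : A ≠ B)
    (hAB : #(A ∩ B) ≠ k - 1) :
    (#{D ∈ powersetCard k X | (A ∩ D).Nonempty ∧ (B ∩ D).Nonempty} : ℤ) + 2 < maxSum #X k := by
  have := card_union_of_mem hA hB
  have := card_inter_lt hA hB hne
  rw [card_filter_meet_both hA hB, maxSum_eq hk hX]
  have := choose_mono_strict (k := k) (by omega : #X - #(A ∪ B) < #X - k - 1) hk (by omega)
  omega

theorem card_filter_meet_both_le {A B : Finset α} (hk : 1 ≤ k) (hX : 2 * k < #X)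
    (hA : A ∈ powersetCard k X) (hB : B ∈ powersetCard k X) (hne : A ≠ B) :
    (#{D ∈ powersetCard k X | (A ∩ D).Nonempty ∧ (B ∩ D).Nonempty} : ℤ) + 2 ≤ maxSum #X k := by
  by_cases hAB : #(A ∩ B) = k - 1
  · exact (card_filter_meet_both_eq hk hX hA hB hAB).le
  · exact (card_filter_meet_both_lt hk hX hA hB hne hAB).le

namespace IsCrossPair

variable {F G : Finset (Finset α)}

theorem right_subset_filter (h : IsCrossPair X k F G) {A B : Finset α} (hA : A ∈ F)
    (hB : B ∈ F) :
    G ⊆ {D ∈ powersetCard k X | (A ∩ D).Nonempty ∧ (B ∩ D).Nonempty} :=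
  fun D hD => mem_filter.2 ⟨h.right_sub hD, h.cross A hA D hD, h.cross B hB D hD⟩

/-- If two members `A`, `B` of the first family are both met by all sets of `L`, while every set
of `L` is disjoint from some member of the first family, then `L` measures how far the second
family is from the largest possible one. -/
theorem card_add_card_le (h : IsCrossPair X k F G) (hk : 1 ≤ k) (hX : 2 * k < #X)
    {A B : Finset α} (hA : A ∈ F) (hB : B ∈ F) (hne : A ≠ B) {L : Finset (Finset α)}
    (hL : L ⊆ powersetCard k X)
    (hLA : ∀ D ∈ L, (A ∩ D).Nonempty) (hLB : ∀ D ∈ L, (B ∩ D).Nonempty)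
    (hLF : ∀ D ∈ L, ∃ C ∈ F, Disjoint C D) : (#G : ℤ) + #L + 2 ≤ maxSum #X k := by
  have hd : Disjoint G L := by
    rw [disjoint_left]
    intro D hG hD
    obtain ⟨C, hC, hCD⟩ := hLF D hD
    have := h.cross C hC D hG
    rw [disjoint_iff_inter_eq_empty] at hCD
    simp [hCD] at this
  have hsub : G ∪ L ⊆ {D ∈ powersetCard k X | (A ∩ D).Nonempty ∧ (B ∩ D).Nonempty} :=
    union_subset (h.right_subset_filter hA hB)
      fun D hD => mem_filter.2 ⟨hL hD, hLA D hD, hLB D hD⟩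
  have h1 := card_le_card hsub
  rw [card_union_of_disjoint hd] at h1
  have h2 := card_filter_meet_both_le hk hX (h.left_sub hA) (h.left_sub hB) hne
  omega

theorem card_add_le_of_card_eq_two (h : IsCrossPair X k F G) (hk : 1 ≤ k) (hX : 2 * k < #X)
    (hF : #F = 2) : (#F + #G : ℤ) ≤ maxSum #X k := by
  obtain ⟨A, B, hne, rfl⟩ := card_eq_two.1 hF
  have := h.card_add_card_le (L := ∅) hk hX (mem_insert_self A _)
    (mem_insert_of_mem (mem_singleton_self B)) hne (by simp) (by simp) (by simp) (by simp)
  rw [hF]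
  simp only [card_empty] at this
  push_cast at *
  linarith

theorem card_inter_of_card_eq_two (hk : 1 ≤ k) (hX : 2 * k < #X)
    {A B : Finset α} (hne : A ≠ B) (h : IsCrossPair X k {A, B} G)
    (hs : maxSum #X k ≤ #G + 2) : #(A ∩ B) = k - 1 := by
  by_contra hAB
  have hA : A ∈ ({A, B} : Finset (Finset α)) := by simp
  have hB : B ∈ ({A, B} : Finset (Finset α)) := by simp
  have h1 := card_filter_meet_both_lt hk hX (h.left_sub hA) (h.left_sub hB) hne hAB
  have h2 := card_le_card (h.right_subset_filter hA hB)
  omega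

/-- Pairs whose first family has exactly three members are far from extremal. -/
theorem card_add_lt_of_card_eq_three (h : IsCrossPair X k F G) (hk : 3 ≤ k) (hX : 2 * k < #X)
    (hF : #F = 3) : (#F + #G : ℤ) < maxSum #X k := by
  obtain ⟨A, B, C, hAB, hAC, hBC, rfl⟩ := card_eq_three.1 hF
  have hA := mem_powersetCard.1 (h.left_sub (by simp : A ∈ _))
  have hB := mem_powersetCard.1 (h.left_sub (by simp : B ∈ _))
  have hC := mem_powersetCard.1 (h.left_sub (by simp : C ∈ _))
  have key : ∀ E : Finset α, #E = k → E ≠ C → (E \ C).Nonempty := by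
    intro E hE hne
    rw [sdiff_nonempty]
    intro hs
    exact hne (eq_of_subset_of_card_le hs (by omega))
  obtain ⟨x, hx⟩ := key A hA.2 hAC
  obtain ⟨y, hy⟩ := key B hB.2 hBC
  rw [mem_sdiff] at hx hy
  have hxy : {x, y} ⊆ X \ C := by
    intro z hz
    rw [mem_insert, mem_singleton] at hz
    rcases hz with rfl | rfl
    · exact mem_sdiff.2 ⟨hA.1 hx.1, hx.2⟩
    · exact mem_sdiff.2 ⟨hB.1 hy.1, hy.2⟩
  have hc := card_sdiff_of_subset hC.1
  have h2 : #{x, y} ≤ 2 := card_le_two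
  obtain ⟨Y, hY1, hY2, hYc⟩ := exists_subsuperset_card_eq hxy (by omega : #{x, y} ≤ k + 1)
    (by omega)
  have hL : #((Y \ {x, y}).image fun u => Y.erase u) = #(Y \ {x, y}) := by
    refine card_image_of_injOn fun u hu v hv huv => ?_
    have hu := (mem_sdiff.1 (mem_coe.1 hu)).1
    have huv : Y.erase u = Y.erase v := huv
    by_contra hne
    exact notMem_erase u Y (huv ▸ mem_erase.2 ⟨hne, hu⟩)
  have hL2 := card_sdiff_of_subset hY1
  have memL : ∀ D ∈ (Y \ {x, y}).image fun u => Y.erase u,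
      #D = k ∧ D ⊆ X \ C ∧ x ∈ D ∧ y ∈ D := by
    intro D hD
    obtain ⟨u, hu, rfl⟩ := mem_image.1 hD
    simp only [mem_sdiff, mem_insert, mem_singleton, not_or] at hu
    refine ⟨by rw [card_erase_of_mem hu.1, hYc]; rfl, (erase_subset _ _).trans hY2,
      mem_erase.2 ⟨Ne.symm hu.2.1, hY1 (by simp)⟩, mem_erase.2 ⟨Ne.symm hu.2.2, hY1 (by simp)⟩⟩
  have := h.card_add_card_le (L := (Y \ {x, y}).image fun u => Y.erase u) (by omega) hX
    (by simp : A ∈ _) (by simp : B ∈ _) hAB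
    (fun D hD => mem_powersetCard.2 ⟨(memL D hD).2.1.trans sdiff_subset, (memL D hD).1⟩)
    (fun D hD => ⟨x, mem_inter.2 ⟨hx.1, (memL D hD).2.2.1⟩⟩)
    (fun D hD => ⟨y, mem_inter.2 ⟨hy.1, (memL D hD).2.2.2⟩⟩)
    (fun D hD => ⟨C, by simp, (disjoint_sdiff.mono_right (memL D hD).2.1)⟩)
  omega

end IsCrossPair

end Counting

section TwoClasses

variable {X : Finset α} {k : ℕ} {F G : Finset (Finset α)}

theorem mem_book {X Y A : Finset α} : A ∈ book X Y ↔ ∃ x ∈ X, x ∉ Y ∧ insert x Y = A := by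
  simp [book, and_assoc]

theorem card_book (X Y : Finset α) : #(book X Y) = #(X \ Y) := by
  refine card_image_of_injOn fun u hu v hv huv => ?_
  have huv : insert u Y = insert v Y := huv
  have : u ∈ insert v Y := huv ▸ mem_insert_self u Y
  exact (mem_insert.1 this).resolve_right (mem_sdiff.1 (mem_coe.1 hu)).2

theorem le_choose_of_pos_of_lt {N j : ℕ} (h1 : 1 ≤ j) (h2 : j < N) : N ≤ N.choose j := by
  induction N generalizing j with
  | zero => omega
  | succ N ih =>
    obtain ⟨j, rfl⟩ := Nat.exists_eq_succ_of_ne_zero (by omega : j ≠ 0)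
    rw [Nat.succ_eq_add_one, Nat.choose_succ_succ']
    rcases Nat.lt_or_ge (j + 1) N with h | h
    · have := ih (by omega) h
      have := Nat.choose_pos (by omega : j ≤ N)
      omega
    · obtain rfl : N = j + 1 := by omega
      rw [Nat.choose_self, Nat.choose_succ_self_right]

theorem lt_choose_of_lt {N j : ℕ} (h1 : 2 ≤ j) (h2 : j + 1 < N) : N < N.choose j := by
  obtain ⟨j, rfl⟩ := Nat.exists_eq_succ_of_ne_zero (by omega : j ≠ 0)
  obtain ⟨N, rfl⟩ := Nat.exists_eq_succ_of_ne_zero (by omega : N ≠ 0)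
  simp only [Nat.succ_eq_add_one] at *
  have e1 := le_choose_of_pos_of_lt (by omega : 1 ≤ j) (by omega : j < N)
  have e2 := le_choose_of_pos_of_lt (by omega : 1 ≤ j + 1) (by omega : j + 1 < N)
  rw [Nat.choose_succ_succ']
  omega

theorem IsCrossPair.card_add_lt_of_powersetCard_subset (h : IsCrossPair X k F G) (hk : 3 ≤ k)
    (hX : 2 * k < #X) {W : Finset α} (hW : W ⊆ X) (hWc : #W = k + 1)
    (hWF : powersetCard k W ⊆ F) (hF : #F ≤ k + 2) : (#F + #G : ℤ) < maxSum #X k := by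
  obtain ⟨a, ha, b, hb, hab⟩ := one_lt_card.1 (by omega : 1 < #W)
  have hab' : {a, b} ⊆ W := by
    intro x hx
    rw [mem_insert, mem_singleton] at hx
    rcases hx with rfl | rfl <;> assumption
  have h2 := card_sdiff_of_subset hab'
  have h3 : #{a, b} = 2 := card_pair hab
  obtain ⟨c, hc, d, hd, hcd⟩ := one_lt_card.1 (by omega : 1 < #(W \ {a, b}))
  simp only [mem_sdiff, mem_insert, mem_singleton, not_or] at hc hd
  have herase : ∀ x ∈ W, W.erase x ∈ F := fun x hx =>
    hWF (mem_powersetCard.2 ⟨erase_subset _ _, by rw [card_erase_of_mem hx, hWc]; rfl⟩)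
  set Z := powersetCard (k - 1) (X \ W) with hZ
  have hZW : ∀ Y ∈ Z, ∀ w ∈ W, w ∉ Y := fun Y hY w hw hwY =>
    (mem_sdiff.1 ((mem_powersetCard.1 hY).1 hwY)).2 hw
  have hZc : k ≤ #Z := by
    rw [hZ, card_powersetCard, card_sdiff_of_subset hW, hWc]
    calc k = k.choose (k - 1) := by
          rw [Nat.choose_symm (by omega : 1 ≤ k), Nat.choose_one_right]
      _ ≤ _ := Nat.choose_le_choose _ (by omega)
  have hinj : ∀ w ∈ W, #(Z.image (insert w)) = #Z := by
    intro w hw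
    refine card_image_of_injOn fun u hu v hv huv => ?_
    have huv : insert w u = insert w v := huv
    rw [← erase_insert (hZW u hu w hw), huv, erase_insert (hZW v hv w hw)]
  have hdisj : Disjoint (Z.image (insert c)) (Z.image (insert d)) := by
    rw [disjoint_left]
    intro D hD hD'
    obtain ⟨Y, hY, rfl⟩ := mem_image.1 hD
    obtain ⟨Y', hY', he⟩ := mem_image.1 hD'
    have : c ∈ insert d Y' := he ▸ mem_insert_self c Y
    exact (mem_insert.1 this).elim hcd (hZW Y' hY' c hc.1)
  have hmem : ∀ w ∈ W, ∀ D ∈ Z.image (insert w), D ∈ powersetCard k X ∧ w ∈ D ∧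
      Disjoint (W.erase w) D := by
    intro w hw D hD
    obtain ⟨Y, hY, rfl⟩ := mem_image.1 hD
    have hY' := mem_powersetCard.1 hY
    refine ⟨mem_powersetCard.2 ⟨insert_subset (hW hw) (hY'.1.trans sdiff_subset), ?_⟩,
      mem_insert_self _ _, ?_⟩
    · rw [card_insert_of_notMem (hZW Y hY w hw), hY'.2]; omega
    · rw [disjoint_left]
      intro x hx hxD
      rw [mem_erase] at hx
      exact (mem_insert.1 hxD).elim hx.1 (hZW Y hY x hx.2)
  have hne : W.erase a ≠ W.erase b := fun he =>
    notMem_erase a W (he ▸ mem_erase.2 ⟨hab, ha⟩)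
  have hall : ∀ D ∈ Z.image (insert c) ∪ Z.image (insert d), D ∈ powersetCard k X ∧
      (W.erase a ∩ D).Nonempty ∧ (W.erase b ∩ D).Nonempty ∧ ∃ C ∈ F, Disjoint C D := by
    intro D hD
    rcases mem_union.1 hD with hD | hD
    · obtain ⟨h1, h2, h3⟩ := hmem c hc.1 D hD
      exact ⟨h1, ⟨c, by simp [hc, h2]⟩, ⟨c, by simp [hc, h2]⟩, _, herase c hc.1, h3⟩
    · obtain ⟨h1, h2, h3⟩ := hmem d hd.1 D hD
      exact ⟨h1, ⟨d, by simp [hd, h2]⟩, ⟨d, by simp [hd, h2]⟩, _, herase d hd.1, h3⟩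
  have := h.card_add_card_le (by omega) hX (herase a ha) (herase b hb) hne
    (L := Z.image (insert c) ∪ Z.image (insert d)) (fun D hD => (hall D hD).1)
    (fun D hD => (hall D hD).2.1) (fun D hD => (hall D hD).2.2.1) (fun D hD => (hall D hD).2.2.2)
  rw [card_union_of_disjoint hdisj, hinj c hc.1, hinj d hd.1] at this
  omega

theorem IsCrossPair.card_add_lt_of_eq_book {Y : Finset α} (h : IsCrossPair X k (book X Y) G)
    (hk : 4 ≤ k) (hX : 2 * k < #X) (hY : Y ⊆ X) (hYc : #Y = k - 1) :
    (#(book X Y) + #G : ℤ) < maxSum #X k := by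
  have hR := card_sdiff_of_subset hY
  obtain ⟨a, ha, b, hb, hab⟩ := one_lt_card.1 (by omega : 1 < #(X \ Y))
  have hab' : {a, b} ⊆ X \ Y := by
    intro x hx
    rw [mem_insert, mem_singleton] at hx
    rcases hx with rfl | rfl <;> assumption
  have h2 := card_sdiff_of_subset hab'
  have h3 : #{a, b} = 2 := card_pair hab
  set Z := powersetCard (k - 2) ((X \ Y) \ {a, b}) with hZ
  have hZab : ∀ T ∈ Z, Disjoint {a, b} T := fun T hT =>
    disjoint_sdiff.mono_right (mem_powersetCard.1 hT).1
  have hZc : #(Z.image ({a, b} ∪ ·)) = #Z := by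
    refine card_image_of_injOn fun u hu v hv huv => ?_
    have huv : {a, b} ∪ u = {a, b} ∪ v := huv
    rw [← union_sdiff_cancel_left (hZab u hu), huv, union_sdiff_cancel_left (hZab v hv)]
  have hZn : #X - k - 1 < #Z := by
    rw [hZ, card_powersetCard, h2, h3, hR, (by omega : #X - #Y - 2 = #X - k - 1)]
    exact lt_choose_of_lt (by omega) (by omega)
  have hmem : ∀ D ∈ Z.image ({a, b} ∪ ·), D ⊆ X \ Y ∧ #D = k ∧ a ∈ D ∧ b ∈ D := by
    intro D hD
    obtain ⟨T, hT, rfl⟩ := mem_image.1 hD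
    have hT' := mem_powersetCard.1 hT
    refine ⟨union_subset hab' (hT'.1.trans sdiff_subset), ?_, by simp, by simp⟩
    rw [card_union_of_disjoint (hZab T hT), h3, hT'.2]
    omega
  have hins : ∀ x ∈ X \ Y, insert x Y ∈ book X Y := fun x hx => mem_image_of_mem _ hx
  have hne : insert a Y ≠ insert b Y := by
    intro he
    have : a ∈ insert b Y := he ▸ mem_insert_self a Y
    exact (mem_insert.1 this).elim hab (mem_sdiff.1 ha).2
  have := h.card_add_card_le (by omega) hX (hins a ha) (hins b hb) hne
    (L := Z.image ({a, b} ∪ ·))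
    (fun D hD => mem_powersetCard.2 ⟨(hmem D hD).1.trans sdiff_subset, (hmem D hD).2.1⟩)
    (fun D hD => ⟨a, by simp [(hmem D hD).2.2.1]⟩)
    (fun D hD => ⟨b, by simp [(hmem D hD).2.2.2]⟩)
    (fun D hD => by
      obtain ⟨hD1, hD2, -, -⟩ := hmem D hD
      obtain ⟨c, hc⟩ := card_pos.1
        (by rw [card_sdiff_of_subset hD1]; omega : 0 < #((X \ Y) \ D))
      rw [mem_sdiff] at hc
      refine ⟨_, hins c hc.1, ?_⟩
      rw [disjoint_insert_left]
      exact ⟨hc.2, disjoint_sdiff.mono_right hD1⟩)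
  rw [hZc] at this
  rw [card_book]
  omega

variable {P Q : Finset α}

theorem eq_of_mem_of_partial (hPQ : Disjoint P Q) (hP : ∀ i ∈ P, ∀ j ∈ P, swapFam i j F = F)
    (hsep : ∀ p ∈ P, ∀ q ∈ Q, ∀ A ∈ F, ∀ B ∈ F, (p ∈ A ↔ q ∈ A) → (p ∈ B ↔ q ∈ B) → A = B)
    {E : Finset α} (hE : E ∈ F) {p p' q x : α} (hp : p ∈ P) (hpE : p ∈ E) (hp' : p' ∈ P)
    (hpE' : p' ∉ E) (hq : q ∈ Q) (hqE : q ∈ E) (hx : x ∈ P) (hxE : x ∈ E) : x = p := by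
  by_contra hne
  have hE' := swapFam_eq_self_iff.1 (hP p hp p' hp') E hE
  rw [swapSet_eq_insert hpE hpE'] at hE'
  have h1 : q ≠ p := fun h => disjoint_left.1 hPQ hp (h ▸ hq)
  have := hsep x hx q hq E hE _ hE' (by simp [hxE, hqE]) (by simp [hxE, hqE, hne, h1])
  rw [this] at hpE'
  exact hpE' (mem_insert_self _ _)

theorem eq_of_notMem_of_partial (hPQ : Disjoint P Q) (hP : ∀ i ∈ P, ∀ j ∈ P, swapFam i j F = F)
    (hsep : ∀ p ∈ P, ∀ q ∈ Q, ∀ A ∈ F, ∀ B ∈ F, (p ∈ A ↔ q ∈ A) → (p ∈ B ↔ q ∈ B) → A = B)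
    {E : Finset α} (hE : E ∈ F) {p p' q x : α} (hp : p ∈ P) (hpE : p ∈ E) (hp' : p' ∈ P)
    (hpE' : p' ∉ E) (hq : q ∈ Q) (hqE : q ∉ E) (hx : x ∈ P) (hxE : x ∉ E) : x = p' := by
  by_contra hne
  have hE' := swapFam_eq_self_iff.1 (hP p hp p' hp') E hE
  rw [swapSet_eq_insert hpE hpE'] at hE'
  have h1 : q ≠ p' := fun h => disjoint_left.1 hPQ hp' (h ▸ hq)
  have := hsep x hx q hq E hE _ hE' (by simp [hxE, hqE]) (by simp [hxE, hqE, hne, h1])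
  rw [this] at hpE'
  exact hpE' (mem_insert_self _ _)

theorem two_classes_of_partial (hPQ : Disjoint P Q) (hU : P ∪ Q = X)
    (hP : ∀ i ∈ P, ∀ j ∈ P, swapFam i j F = F) (hQ : ∀ i ∈ Q, ∀ j ∈ Q, swapFam i j F = F)
    (hsep : ∀ p ∈ P, ∀ q ∈ Q, ∀ A ∈ F, ∀ B ∈ F, (p ∈ A ↔ q ∈ A) → (p ∈ B ↔ q ∈ B) → A = B)
    (hF : F ⊆ powersetCard k X) (hk : 3 ≤ k) (hX : 2 * k < #X) (hQn : Q.Nonempty)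
    {E : Finset α} (hE : E ∈ F) {p p' : α} (hp : p ∈ P) (hpE : p ∈ E) (hp' : p' ∈ P)
    (hpE' : p' ∉ E) :
    (∃ W ⊆ X, #W = k + 1 ∧ powersetCard k W ⊆ F ∧ #F ≤ k + 2) ∨
      ∃ Y ⊆ X, #Y = k - 1 ∧ F = book X Y := by
  have hPX : P ⊆ X := hU ▸ subset_union_left
  have hQX : Q ⊆ X := hU ▸ subset_union_right
  have hcard : #P + #Q = #X := by rw [← card_union_of_disjoint hPQ, hU]
  have hmemX : ∀ x ∈ X, x ∉ P → x ∈ Q := fun x hx hxP =>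
    (mem_union.1 (hU ▸ hx : x ∈ P ∪ Q)).resolve_left hxP
  have hEk := mem_powersetCard.1 (hF hE)
  by_cases hq : ∃ q ∈ Q, q ∈ E
  · obtain ⟨q, hq, hqE⟩ := hq
    have u1 : ∀ x ∈ P, x ∈ E → x = p := fun x hx hxE =>
      eq_of_mem_of_partial hPQ hP hsep hE hp hpE hp' hpE' hq hqE hx hxE
    by_cases hq' : ∃ q' ∈ Q, q' ∉ E
    · exfalso
      obtain ⟨q', hq', hqE'⟩ := hq'
      have hsep' : ∀ p ∈ Q, ∀ q ∈ P, ∀ A ∈ F, ∀ B ∈ F, (p ∈ A ↔ q ∈ A) →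
          (p ∈ B ↔ q ∈ B) → A = B :=
        fun p hp q hq A hA B hB h1 h2 => hsep q hq p hp A hA B hB h1.symm h2.symm
      have u2 : ∀ x ∈ Q, x ∈ E → x = q := fun x hx hxE =>
        eq_of_mem_of_partial hPQ.symm hQ hsep' hE hq hqE hq' hqE' hp hpE hx hxE
      have : E ⊆ {p, q} := by
        intro x hx
        rw [mem_insert, mem_singleton]
        by_cases hxP : x ∈ P
        · exact Or.inl (u1 x hxP hx)
        · exact Or.inr (u2 x (hmemX x (hEk.1 hx) hxP) hx)
      have := card_le_card this
      have := card_le_two (a := p) (b := q)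
      omega
    · right
      push Not at hq'
      have hEQ : E = insert p Q := by
        ext x
        rw [mem_insert]
        constructor
        · intro hx
          by_cases hxP : x ∈ P
          · exact Or.inl (u1 x hxP hx)
          · exact Or.inr (hmemX x (hEk.1 hx) hxP)
        · rintro (rfl | hx)
          · exact hpE
          · exact hq' x hx
      have hpQ : ∀ x ∈ P, x ∉ Q := fun x hx hxQ => disjoint_left.1 hPQ hx hxQ
      have hQc : #Q = k - 1 := by
        rw [hEQ, card_insert_of_notMem (hpQ p hp)] at hEk
        omega
      have hmem : ∀ x ∈ P, insert x Q ∈ F := by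
        intro x hx
        refine mem_of_swapFam_eq hP hE ?_ ?_
        · rw [hEQ, card_insert_of_notMem (hpQ x hx), card_insert_of_notMem (hpQ p hp)]
        · rw [hEQ, insert_sdiff_of_mem _ hx, insert_sdiff_of_mem _ hp]
      refine ⟨Q, hQX, hQc, ?_⟩
      ext A
      rw [mem_book]
      constructor
      · intro hA
        by_contra hno
        push Not at hno
        have hAk := mem_powersetCard.1 (hF hA)
        have hs : ∀ x ∈ P, ∀ y ∈ Q, ¬ (x ∈ A ↔ y ∈ A) := by
          intro x hx y hy hxy
          exact hno x (hPX hx) (hpQ x hx)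
            (hsep x hx y hy _ (hmem x hx) A hA (by simp [hy]) hxy)
        by_cases hqA : q ∈ A
        · have : A ⊆ Q := by
            intro x hx
            refine hmemX x (hAk.1 hx) fun hxP => hs x hxP q hq (by simp [hx, hqA])
          have := card_le_card this
          omega
        · have : P ⊆ A := by
            intro x hx
            by_contra hxA
            exact hs x hx q hq (by simp [hxA, hqA])
          have := card_le_card this
          omega
      · rintro ⟨x, hx, hxQ, rfl⟩
        refine hmem x ?_
        by_contra hxP
        exact hxQ (hmemX x hx hxP)
  · left
    push Not at hq
    obtain ⟨q, hqQ⟩ := hQn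
    have u1 : ∀ x ∈ P, x ∉ E → x = p' := fun x hx hxE =>
      eq_of_notMem_of_partial hPQ hP hsep hE hp hpE hp' hpE' hqQ (hq q hqQ) hx hxE
    have hEP : E ⊆ P := by
      intro x hx
      by_contra hxP
      exact hq x (hmemX x (hEk.1 hx) hxP) hx
    have hPE : P = insert p' E := by
      ext x
      rw [mem_insert]
      constructor
      · intro hx
        by_cases hxE : x ∈ E
        · exact Or.inr hxE
        · exact Or.inl (u1 x hx hxE)
      · rintro (rfl | hx)
        · exact hp'
        · exact hEP hx
    have hPc : #P = k + 1 := by rw [hPE, card_insert_of_notMem hpE', hEk.2]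
    have hsub : powersetCard k P ⊆ F := by
      intro A hA
      rw [mem_powersetCard] at hA
      refine mem_of_swapFam_eq hP hE (by rw [hA.2, hEk.2]) ?_
      rw [sdiff_eq_empty_iff_subset.2 hA.1, sdiff_eq_empty_iff_subset.2 hEP]
    refine ⟨P, hPX, hPc, hsub, ?_⟩
    have hFsub : F ⊆ insert Q (powersetCard k P) := by
      intro A hA
      rw [mem_insert]
      by_cases hAP : A ⊆ P
      · exact Or.inr (mem_powersetCard.2 ⟨hAP, (mem_powersetCard.1 (hF hA)).2⟩)
      left
      have hAX := (mem_powersetCard.1 (hF hA)).1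
      have hs : ∀ x ∈ P, ∀ y ∈ Q, ¬ (x ∈ A ↔ y ∈ A) := by
        intro x hx y hy hxy
        have hmem : P.erase x ∈ F := hsub (mem_powersetCard.2 ⟨erase_subset _ _, by
          rw [card_erase_of_mem hx, hPc]; rfl⟩)
        have := hsep x hx y hy _ hmem A hA
          (by simp [disjoint_right.1 hPQ hy]) hxy
        exact hAP (this ▸ erase_subset _ _)
      obtain ⟨z, hzA, hzP⟩ := not_subset.1 hAP
      have hzQ := hmemX z (hAX hzA) hzP
      have hPA : ∀ x ∈ P, x ∉ A := fun x hx hxA => hs x hx z hzQ (by simp [hxA, hzA])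
      ext x
      constructor
      · intro hx
        exact hmemX x (hAX hx) fun hxP => hPA x hxP hx
      · intro hx
        by_contra hxA
        exact hs p hp x hx (by simp [hxA, hPA p hp])
    have h1 := (card_le_card hFsub).trans (card_insert_le _ _)
    rw [card_powersetCard, hPc, Nat.choose_succ_self_right] at h1
    exact h1

theorem two_classes (hPQ : Disjoint P Q) (hU : P ∪ Q = X)
    (hP : ∀ i ∈ P, ∀ j ∈ P, swapFam i j F = F) (hQ : ∀ i ∈ Q, ∀ j ∈ Q, swapFam i j F = F)
    (hsep : ∀ p ∈ P, ∀ q ∈ Q, ∀ A ∈ F, ∀ B ∈ F, (p ∈ A ↔ q ∈ A) → (p ∈ B ↔ q ∈ B) → A = B)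
    (hF : F ⊆ powersetCard k X) (hF3 : 3 ≤ #F) (hk : 3 ≤ k) (hX : 2 * k < #X)
    (hPn : P.Nonempty) (hQn : Q.Nonempty) :
    (∃ W ⊆ X, #W = k + 1 ∧ powersetCard k W ⊆ F ∧ #F ≤ k + 2) ∨
      ∃ Y ⊆ X, #Y = k - 1 ∧ F = book X Y := by
  obtain ⟨E, hE, hEn⟩ : ∃ E ∈ F, E ∉ ({P, Q} : Finset (Finset α)) := by
    by_contra! h
    have h1 := card_le_card (show F ⊆ {P, Q} from h)
    have h2 := card_le_two (a := P) (b := Q)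
    omega
  have hEk := mem_powersetCard.1 (hF hE)
  simp only [mem_insert, mem_singleton, not_or] at hEn
  by_cases h1 : (∃ p ∈ P, p ∈ E) ∧ ∃ p' ∈ P, p' ∉ E
  · obtain ⟨⟨p, hp, hpE⟩, p', hp', hpE'⟩ := h1
    exact two_classes_of_partial hPQ hU hP hQ hsep hF hk hX hQn hE hp hpE hp' hpE'
  by_cases h2 : (∃ p ∈ Q, p ∈ E) ∧ ∃ p' ∈ Q, p' ∉ E
  · obtain ⟨⟨p, hp, hpE⟩, p', hp', hpE'⟩ := h2
    exact two_classes_of_partial hPQ.symm (union_comm Q P ▸ hU) hQ hP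
      (fun p hp q hq A hA B hB h1 h2 => hsep q hq p hp A hA B hB h1.symm h2.symm)
      hF hk hX hPn hE hp hpE hp' hpE'
  exfalso
  have hmem : ∀ x ∈ E, x ∈ P ∨ x ∈ Q := fun x hx => mem_union.1 (hU ▸ hEk.1 hx)
  by_cases hpE : ∃ p ∈ P, p ∈ E
  · have h1' : P ⊆ E := by
      intro x hx
      by_contra hxE
      exact h1 ⟨hpE, x, hx, hxE⟩
    by_cases hqE : ∃ p ∈ Q, p ∈ E
    · have h2' : Q ⊆ E := by
        intro x hx
        by_contra hxE
        exact h2 ⟨hqE, x, hx, hxE⟩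
      have := card_le_card (hU ▸ union_subset h1' h2' : X ⊆ E)
      omega
    · refine hEn.1 (Subset.antisymm (fun x hx => ?_) h1')
      exact (hmem x hx).resolve_right fun h => hqE ⟨x, h, hx⟩
  · by_cases hqE : ∃ p ∈ Q, p ∈ E
    · have h2' : Q ⊆ E := by
        intro x hx
        by_contra hxE
        exact h2 ⟨hqE, x, hx, hxE⟩
      refine hEn.2 (Subset.antisymm (fun x hx => ?_) h2')
      exact (hmem x hx).resolve_left fun h => hpE ⟨x, h, hx⟩
    · obtain ⟨x, hx⟩ := card_pos.1 (by omega : 0 < #E)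
      exact (hmem x hx).elim (fun h => hpE ⟨x, h, hx⟩) fun h => hqE ⟨x, h, hx⟩

end TwoClasses

section Minimal

variable {X : Finset α} {k s : ℕ} {F G : Finset (Finset α)}

theorem separated_of_swapSet_notMem {i j : α} {C : Finset α} (hC : C ∈ F)
    (h : swapSet i j C ∉ F) : i ∈ C ∧ j ∉ C ∨ i ∉ C ∧ j ∈ C := by
  by_contra hn
  have : i ∈ C ↔ j ∈ C := by tauto
  rw [swapSet_eq_self this] at h
  exact h hC

theorem swapSet_notMem_of_notMem_inter {i j : α} {A B C : Finset α}
    (hAB : F ∩ swapFam i j F = {A, B}) (hC : C ∈ F) (hCA : C ≠ A) (hCB : C ≠ B) :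
    swapSet i j C ∉ F := by
  intro h
  have : C ∈ F ∩ swapFam i j F := mem_inter.2 ⟨hC, mem_swapFam.2 h⟩
  rw [hAB, mem_insert, mem_singleton] at this
  exact this.elim hCA hCB

theorem eq_erase_of_subset {C W : Finset α} {x : α} (hC : C ⊆ W) (hc : #W = #C + 1)
    (hx : x ∈ W) (hxC : x ∉ C) : C = W.erase x := by
  refine eq_of_subset_of_card_le (fun y hy => mem_erase.2 ⟨fun h => hxC (h ▸ hy), hC hy⟩) ?_
  rw [card_erase_of_mem hx]
  omega

theorem card_insert_insert_of_swapSet_notMem {i j : α} {C : Finset α} (hC : C ∈ F)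
    (h : swapSet i j C ∉ F) : #(insert i (insert j C)) = #C + 1 := by
  rcases separated_of_swapSet_notMem hC h with ⟨h1, h2⟩ | ⟨h1, h2⟩
  · rw [insert_eq_of_mem (mem_insert_of_mem h1), card_insert_of_notMem h2]
  · rw [insert_eq_of_mem h2, card_insert_of_notMem h1]

/-- When an extremal pair meets a transposed copy in exactly two sets, these two sets form the
first family of an extremal pair, so they share all but one of their points. -/
theorem IsCrossPair.card_inter_of_inter_swapFam_eq (hs : SumBound X k s)
    (hM : maxSum #X k ≤ s) (hk : 1 ≤ k) (hX : 2 * k < #X)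
    (h : IsCrossPair X k F G) (hle : #F ≤ #G) (hsum : #F + #G = s) {i j : α} (hi : i ∈ X)
    (hj : j ∈ X) {A B : Finset α} (hne : A ≠ B) (hAB : F ∩ swapFam i j F = {A, B}) :
    #(A ∩ B) = k - 1 := by
  have h1 := h.inter_union (h.map_swap hi hj)
  have h2 := h.uncross hs hle hsum hi hj (by rw [hAB, card_pair hne])
  rw [hAB] at h1 h2
  rw [card_pair hne] at h2
  exact IsCrossPair.card_inter_of_card_eq_two hk hX hne h1 (by omega)

/-- With `A` and `B` as above, every other member of the first family leaves uncovered, apart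
from `i` and `j`, no point of `A` or no point of `B`. -/
theorem IsCrossPair.subset_or_subset_of_inter_swapFam_eq (hs : SumBound X k s)
    (hk : 2 ≤ k) (hX : 2 * k < #X)
    (h : IsCrossPair X k F G) (hle : #F ≤ #G) (hsum : #F + #G = s) (hF2 : 2 ≤ #F) {i j : α}
    (hi : i ∈ X) (hj : j ∈ X) {A B : Finset α} (hne : A ≠ B) (hAB : F ∩ swapFam i j F = {A, B})
    {C : Finset α} (hC : C ∈ F) (hCA : C ≠ A) (hCB : C ≠ B) :
    A ⊆ insert i (insert j C) ∨ B ⊆ insert i (insert j C) := by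
  by_contra! hn
  obtain ⟨⟨x, hxA, hx⟩, y, hyB, hy⟩ := And.intro (not_subset.1 hn.1) (not_subset.1 hn.2)
  have hA : A ∈ F := (mem_inter.1 (hAB ▸ mem_insert_self A _)).1
  have hB : B ∈ F := (mem_inter.1 (hAB ▸ mem_insert_of_mem (mem_singleton_self B))).1
  have hAX := (mem_powersetCard.1 (h.left_sub hA)).1
  have hBX := (mem_powersetCard.1 (h.left_sub hB)).1
  have hCk := mem_powersetCard.1 (h.left_sub hC)
  have hWc := card_insert_insert_of_swapSet_notMem hC
    (swapSet_notMem_of_notMem_inter hAB hC hCA hCB)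
  have hWX : insert i (insert j C) ⊆ X := insert_subset hi (insert_subset hj hCk.1)
  have hxy : {x, y} ⊆ X \ insert i (insert j C) := by
    intro z hz
    rw [mem_insert, mem_singleton] at hz
    rcases hz with rfl | rfl
    · exact mem_sdiff.2 ⟨hAX hxA, hx⟩
    · exact mem_sdiff.2 ⟨hBX hyB, hy⟩
  have hc := card_sdiff_of_subset hWX
  obtain ⟨D, hD1, hD2, hDc⟩ := exists_subsuperset_card_eq hxy (card_le_two.trans hk)
    (by omega)
  have h1 := h.inter_union (h.map_swap hi hj)
  have h2 := h.uncross hs hle hsum hi hj (by rw [hAB, card_pair hne])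
  rw [hAB] at h1 h2
  have hnot : ∀ z ∈ insert i (insert j C), z ∉ D := fun z hz hzD => (mem_sdiff.1 (hD2 hzD)).2 hz
  have hDG : D ∉ G := by
    intro hDG
    obtain ⟨z, hz⟩ := h.cross C hC D hDG
    rw [mem_inter] at hz
    exact hnot z (by simp [hz.1]) hz.2
  have hDG' := h1.mem_right hs (by rw [card_pair hne])
    ((hF2.trans hle).trans (card_le_card subset_union_left)) h2
    (mem_powersetCard.2 ⟨hD2.trans sdiff_subset, hDc⟩) (by
      intro E hE
      rw [mem_insert, mem_singleton] at hE
      rcases hE with rfl | rfl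
      · exact ⟨x, mem_inter.2 ⟨hxA, hD1 (by simp)⟩⟩
      · exact ⟨y, mem_inter.2 ⟨hyB, hD1 (by simp)⟩⟩)
  rcases mem_union.1 hDG' with hd | hd
  · exact hDG hd
  · rw [mem_swapFam, swapSet_eq_self (by simp [hnot i (by simp), hnot j (by simp)])] at hd
    exact hDG hd

theorem IsCrossPair.subset_union_of_subset_insert (hs : SumBound X k s)
    (hM : maxSum #X k ≤ s) (hk : 3 ≤ k) (hX : 2 * k < #X)
    (h : IsCrossPair X k F G) (hle : #F ≤ #G) (hsum : #F + #G = s)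
    (hmin : ∀ i ∈ X, ∀ j ∈ X, swapFam i j F = F ∨ #(F ∩ swapFam i j F) ≤ 2) {i j : α}
    (hi : i ∈ X) (hj : j ∈ X) {A B : Finset α} (hne : A ≠ B) (hAB : F ∩ swapFam i j F = {A, B})
    {C : Finset α} (hC : C ∈ F) (hCA : C ≠ A) (hCB : C ≠ B)
    (hsub : A ⊆ insert i (insert j C)) : C ⊆ A ∪ B ∧ i ∈ A ∧ j ∈ A := by
  have hA : A ∈ F := (mem_inter.1 (hAB ▸ mem_insert_self A _)).1
  have hB : B ∈ F := (mem_inter.1 (hAB ▸ mem_insert_of_mem (mem_singleton_self B))).1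
  have hAk := mem_powersetCard.1 (h.left_sub hA)
  have hBk := mem_powersetCard.1 (h.left_sub hB)
  have hCk := mem_powersetCard.1 (h.left_sub hC)
  have hint := h.card_inter_of_inter_swapFam_eq hs hM (by omega) hX hle hsum hi hj hne hAB
  have hCn := swapSet_notMem_of_notMem_inter hAB hC hCA hCB
  have hWc := card_insert_insert_of_swapSet_notMem hC hCn
  set W := insert i (insert j C) with hW
  have hiW : i ∈ W := by simp [hW]
  have hjW : j ∈ W := by simp [hW]
  have hCW : C ⊆ W := fun x hx => by simp [hW, hx]
  have hCsep := separated_of_swapSet_notMem hC hCn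
  -- a set `W.erase i` or `W.erase j` is `C` or its transposed copy
  have hswap : ∀ E ∈ F, E ⊆ W → i ∉ E ∨ j ∉ E → E = C := by
    intro E hE hEW hij
    have hEk := mem_powersetCard.1 (h.left_sub hE)
    have hei : i ∉ E → E = W.erase i := eq_erase_of_subset hEW (by omega) hiW
    have hej : j ∉ E → E = W.erase j := eq_erase_of_subset hEW (by omega) hjW
    rcases hCsep with ⟨h1, h2⟩ | ⟨h1, h2⟩
    · have hC' := eq_erase_of_subset hCW hWc hjW h2
      rcases hij with hij | hij
      · exfalso
        refine hCn ?_
        rw [swapSet_eq_insert h1 h2]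
        convert hE using 1
        rw [hei hij, hW, insert_eq_of_mem (mem_insert_of_mem h1), erase_insert_of_ne]
        rintro rfl
        exact h2 h1
      · exact (hej hij).trans hC'.symm
    · have hC' := eq_erase_of_subset hCW hWc hiW h1
      rcases hij with hij | hij
      · exact (hei hij).trans hC'.symm
      · exfalso
        refine hCn ?_
        rw [swapSet_comm, swapSet_eq_insert h2 h1]
        convert hE using 1
        rw [hej hij, hW, insert_eq_of_mem h2, erase_insert_of_ne]
        rintro rfl
        exact h1 h2
  have hijA : i ∈ A ∧ j ∈ A := by
    by_contra hn
    exact hCA (hswap A hA hsub (by tauto)).symm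
  refine ⟨?_, hijA⟩
  have hijne : i ≠ j := by
    rintro rfl
    tauto
  have hswA : swapSet i j A = A := swapSet_eq_self (by simp [hijA])
  have hBsep : i ∈ B ↔ j ∈ B := by
    have hB' : swapSet i j B ∈ F ∩ swapFam i j F := by
      refine mem_inter.2 ⟨?_, by rw [mem_swapFam, swapSet_swapSet]; exact hB⟩
      rw [← mem_swapFam]
      exact (mem_inter.1 (hAB ▸ mem_insert_of_mem (mem_singleton_self B))).2
    rw [hAB, mem_insert, mem_singleton] at hB'
    rcases hB' with hB' | hB'
    · exfalso
      rw [← swapSet_swapSet i j B, hB', hswA] at hne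
      exact hne rfl
    · have : i ∈ swapSet i j B ↔ j ∈ B := by rw [mem_swapSet, Equiv.swap_apply_left]
      rwa [hB'] at this
  have hAB1 : #(A \ B) = 1 := by
    have := card_sdiff_add_card_inter A B
    omega
  have hBA1 : #(B \ A) = 1 := by
    have := card_sdiff_add_card_inter B A
    rw [inter_comm] at this
    omega
  obtain ⟨a, haAB⟩ := card_eq_one.1 hAB1
  obtain ⟨b, hbBA⟩ := card_eq_one.1 hBA1
  have ha : a ∈ A ∧ a ∉ B := mem_sdiff.1 (haAB ▸ mem_singleton_self a)
  have hb : b ∈ B ∧ b ∉ A := mem_sdiff.1 (hbBA ▸ mem_singleton_self b)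
  have hijB : i ∈ B ∧ j ∈ B := by
    by_contra hn
    have hi' : i ∈ A \ B := mem_sdiff.2 ⟨hijA.1, by tauto⟩
    have hj' : j ∈ A \ B := mem_sdiff.2 ⟨hijA.2, by tauto⟩
    rw [haAB, mem_singleton] at hi' hj'
    exact hijne (hi'.trans hj'.symm)
  intro x hx
  by_contra hxAB
  rw [mem_union, not_or] at hxAB
  have hAW := eq_erase_of_subset hsub (by omega) (hCW hx) hxAB.1
  have hbW : b ∉ W := by
    intro hbW
    refine hb.2 ?_
    rw [hAW, mem_erase]
    exact ⟨fun hbx => hxAB.2 (hbx ▸ hb.1), hbW⟩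
  have haC : a ∈ C := by
    have := hsub ha.1
    rw [hW, mem_insert, mem_insert] at this
    rcases this with rfl | rfl | this
    · exact absurd hijB.1 ha.2
    · exact absurd hijB.2 ha.2
    · exact this
  have haX := hAk.1 ha.1
  have hxX := hCk.1 hx
  have hBC : ({B, C} : Finset (Finset α)) ⊆ F ∩ swapFam a x F := by
    intro E hE
    rw [mem_insert, mem_singleton] at hE
    rw [mem_inter, mem_swapFam]
    rcases hE with rfl | rfl
    · rw [swapSet_eq_self (by simp [ha.2, hxAB.2])]
      exact ⟨hB, hB⟩
    · rw [swapSet_eq_self (by simp [haC, hx])]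
      exact ⟨hC, hC⟩
  rcases hmin a haX x hxX with hfix | hcard
  · have hA' := swapFam_eq_self_iff.1 hfix A hA
    rw [swapSet_eq_insert ha.1 hxAB.1] at hA'
    have hA'A : insert x (A.erase a) ≠ A := fun he => hxAB.1 (he ▸ mem_insert_self _ _)
    have hA'B : insert x (A.erase a) ≠ B := fun he => hxAB.2 (he ▸ mem_insert_self _ _)
    have := separated_of_swapSet_notMem hA'
      (swapSet_notMem_of_notMem_inter hAB hA' hA'A hA'B)
    have hi' : i ∈ insert x (A.erase a) :=
      mem_insert_of_mem (mem_erase.2 ⟨fun he => ha.2 (he ▸ hijB.1), hijA.1⟩)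
    have hj' : j ∈ insert x (A.erase a) :=
      mem_insert_of_mem (mem_erase.2 ⟨fun he => ha.2 (he ▸ hijB.2), hijA.2⟩)
    tauto
  · have heq : F ∩ swapFam a x F = {B, C} :=
      (eq_of_subset_of_card_le hBC (by rw [card_pair hCB.symm]; exact hcard)).symm
    have hint' := h.card_inter_of_inter_swapFam_eq hs hM (by omega) hX hle hsum haX hxX
      hCB.symm heq
    have hBC1 : #(B \ C) = 1 := by
      have := card_sdiff_add_card_inter B C
      omega
    obtain ⟨c, hc⟩ := card_eq_one.1 hBC1
    have hb' : b ∈ B \ C := mem_sdiff.2 ⟨hb.1, fun hbC => hbW (hCW hbC)⟩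
    rcases hCsep with ⟨-, h2⟩ | ⟨h2, -⟩
    · have hj' : j ∈ B \ C := mem_sdiff.2 ⟨hijB.2, h2⟩
      rw [hc, mem_singleton] at hb' hj'
      exact hb.2 (hb' ▸ hj' ▸ hijA.2)
    · have hi' : i ∈ B \ C := mem_sdiff.2 ⟨hijB.1, h2⟩
      rw [hc, mem_singleton] at hb' hi'
      exact hb.2 (hb' ▸ hi' ▸ hijA.1)

theorem IsCrossPair.card_inter_swapFam_le_one (hs : SumBound X k s)
    (hM : maxSum #X k ≤ s) (hk : 3 ≤ k) (hX : 2 * k < #X)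
    (h : IsCrossPair X k F G) (hle : #F ≤ #G) (hsum : #F + #G = s) (hF : 4 ≤ #F)
    (hmin : ∀ i ∈ X, ∀ j ∈ X, swapFam i j F = F ∨ #(F ∩ swapFam i j F) ≤ 2) {i j : α}
    (hi : i ∈ X) (hj : j ∈ X) (hij : swapFam i j F ≠ F) : #(F ∩ swapFam i j F) ≤ 1 := by
  by_contra hn
  have h2 : #(F ∩ swapFam i j F) = 2 := by
    have := (hmin i hi j hj).resolve_left hij
    omega
  obtain ⟨A, B, hne, hAB⟩ := card_eq_two.1 h2
  have hA : A ∈ F := (mem_inter.1 (hAB ▸ mem_insert_self A _)).1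
  have hB : B ∈ F := (mem_inter.1 (hAB ▸ mem_insert_of_mem (mem_singleton_self B))).1
  have hint := h.card_inter_of_inter_swapFam_eq hs hM (by omega) hX hle hsum hi hj hne hAB
  have hunion := card_union_of_mem (h.left_sub hA) (h.left_sub hB)
  have key : ∀ C ∈ F, C ≠ A → C ≠ B → C ⊆ A ∪ B ∧ i ∈ A ∪ B ∧ j ∈ A ∪ B := by
    intro C hC hCA hCB
    rcases h.subset_or_subset_of_inter_swapFam_eq hs (by omega) hX hle hsum (by omega) hi hj hne
      hAB hC hCA hCB with hsub | hsub
    · obtain ⟨h1, h2, h3⟩ := h.subset_union_of_subset_insert hs hM hk hX hle hsum hmin hi hj hne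
        hAB hC hCA hCB hsub
      exact ⟨h1, mem_union_left _ h2, mem_union_left _ h3⟩
    · obtain ⟨h1, h2, h3⟩ := h.subset_union_of_subset_insert hs hM hk hX hle hsum hmin hi hj
        hne.symm (by rw [hAB, pair_comm]) hC hCB hCA hsub
      exact ⟨union_comm B A ▸ h1, mem_union_right _ h2, mem_union_right _ h3⟩
  have hone : #(F \ {A, B}) ≤ 1 := by
    rw [card_le_one]
    intro C hC C' hC'
    simp only [mem_sdiff, mem_insert, mem_singleton, not_or] at hC hC'
    obtain ⟨h1, h2, h3⟩ := key C hC.1 hC.2.1 hC.2.2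
    obtain ⟨h1', -, -⟩ := key C' hC'.1 hC'.2.1 hC'.2.2
    have hCk := mem_powersetCard.1 (h.left_sub hC.1)
    have hCk' := mem_powersetCard.1 (h.left_sub hC'.1)
    have hn := swapSet_notMem_of_notMem_inter hAB hC.1 hC.2.1 hC.2.2
    have hsep := separated_of_swapSet_notMem hC.1 hn
    have hsep' := separated_of_swapSet_notMem hC'.1
      (swapSet_notMem_of_notMem_inter hAB hC'.1 hC'.2.1 hC'.2.2)
    have hei : ∀ E ⊆ A ∪ B, #E = k → i ∉ E → E = (A ∪ B).erase i := fun E hE hEk =>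
      eq_erase_of_subset hE (by omega) h2
    have hej : ∀ E ⊆ A ∪ B, #E = k → j ∉ E → E = (A ∪ B).erase j := fun E hE hEk =>
      eq_erase_of_subset hE (by omega) h3
    rcases hsep with ⟨hiC, hjC⟩ | ⟨hiC, hjC⟩ <;> rcases hsep' with ⟨hiC', hjC'⟩ | ⟨hiC', hjC'⟩
    · rw [hej C h1 hCk.2 hjC, hej C' h1' hCk'.2 hjC']
    · exfalso
      refine hn ?_
      convert hC'.1 using 1
      have hsX : swapSet i j C ⊆ A ∪ B := swapSet_subset h1 h2 h3
      rw [hei C' h1' hCk'.2 hiC']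
      refine hei _ hsX (by rw [card_swapSet, hCk.2]) ?_
      rwa [mem_swapSet, Equiv.swap_apply_left]
    · exfalso
      refine hn ?_
      convert hC'.1 using 1
      have hsX : swapSet i j C ⊆ A ∪ B := swapSet_subset h1 h2 h3
      rw [hej C' h1' hCk'.2 hjC']
      refine hej _ hsX (by rw [card_swapSet, hCk.2]) ?_
      rwa [mem_swapSet, Equiv.swap_apply_right]
    · rw [hei C h1 hCk.2 hiC, hei C' h1' hCk'.2 hiC']
  have := le_card_sdiff {A, B} F
  have := card_le_two (a := A) (b := B)
  omega

/-- An extremal pair that cannot be made smaller by uncrossing has `k = 3` and consists of all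
triples through two fixed points. -/
theorem IsCrossPair.eq_book_of_minimal (hs : SumBound X k s)
    (hM : maxSum #X k ≤ s) (hk : 3 ≤ k) (hX : 2 * k < #X)
    (h : IsCrossPair X k F G) (hle : #F ≤ #G) (hsum : #F + #G = s) (hF : 3 ≤ #F)
    (hmin : ∀ i ∈ X, ∀ j ∈ X, swapFam i j F = F ∨ #(F ∩ swapFam i j F) ≤ 2) :
    k = 3 ∧ ∃ Y ⊆ X, #Y = 2 ∧ F = book X Y := by
  have hF4 : 4 ≤ #F := by
    by_contra hn
    have := h.card_add_lt_of_card_eq_three hk hX (by omega)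
    omega
  have hone : ∀ i ∈ X, ∀ j ∈ X, swapFam i j F ≠ F → #(F ∩ swapFam i j F) ≤ 1 :=
    fun i hi j hj hij => h.card_inter_swapFam_le_one hs hM hk hX hle hsum hF4 hmin hi hj hij
  have hmemI : ∀ i j, ∀ A ∈ F, (i ∈ A ↔ j ∈ A) → A ∈ F ∩ swapFam i j F := by
    intro i j A hA hij
    rw [mem_inter, mem_swapFam, swapSet_eq_self hij]
    exact ⟨hA, hA⟩
  obtain ⟨i, hi, j, hj, hij⟩ : ∃ i ∈ X, ∃ j ∈ X, swapFam i j F ≠ F := by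
    by_contra! hall
    obtain ⟨E, hE⟩ := card_pos.1 (by omega : 0 < #F)
    obtain ⟨D, hD⟩ := card_pos.1 (by omega : 0 < #G)
    have hEk := mem_powersetCard.1 (h.left_sub hE)
    have hDk := mem_powersetCard.1 (h.right_sub hD)
    obtain ⟨E', hE', hEc⟩ := exists_subset_card_eq
      (by rw [card_sdiff_of_subset hDk.1]; omega : k ≤ #(X \ D))
    have := mem_of_swapFam_eq hall hE (hEc.trans hEk.2.symm) (by
      rw [sdiff_eq_empty_iff_subset.2 hEk.1,
        sdiff_eq_empty_iff_subset.2 (hE'.trans sdiff_subset)])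
    obtain ⟨z, hz⟩ := h.cross E' this D hD
    rw [mem_inter] at hz
    exact (mem_sdiff.1 (hE' hz.1)).2 hz.2
  have hself : ∀ x, swapFam x x F = F := fun x =>
    swapFam_eq_self_iff.2 fun A hA => by rwa [swapSet_eq_self Iff.rfl]
  have hcover : ∀ x ∈ X, swapFam i x F = F ∨ swapFam j x F = F := by
    intro x hx
    by_contra! hn
    have hsub : F ⊆ (F ∩ swapFam i j F) ∪ ((F ∩ swapFam i x F) ∪ (F ∩ swapFam j x F)) := by
      intro A hA
      rw [mem_union, mem_union]
      have : (i ∈ A ↔ j ∈ A) ∨ (i ∈ A ↔ x ∈ A) ∨ (j ∈ A ↔ x ∈ A) := by tauto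
      exact this.imp (hmemI i j A hA) (Or.imp (hmemI i x A hA) (hmemI j x A hA))
    have h1 := card_le_card hsub
    have h2 := card_union_le (F ∩ swapFam i j F) ((F ∩ swapFam i x F) ∪ (F ∩ swapFam j x F))
    have h3 := card_union_le (F ∩ swapFam i x F) (F ∩ swapFam j x F)
    have h4 := hone i hi j hj hij
    have h5 := hone i hi x hx hn.1
    have h6 := hone j hj x hx hn.2
    omega
  have hcls : ∀ u x y, swapFam u x F = F → swapFam u y F = F → swapFam x y F = F :=
    fun u x y hx hy => swapFam_trans (by rwa [swapFam_comm]) hy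
  have hsep : ∀ p ∈ X.filter (fun x => swapFam i x F = F),
      ∀ q ∈ X.filter (fun x => swapFam j x F = F), swapFam p q F ≠ F := by
    intro p hp q hq hpq
    rw [mem_filter] at hp hq
    refine hij (swapFam_trans (swapFam_trans hp.2 hpq) ?_)
    rw [swapFam_comm]
    exact hq.2
  have hres := two_classes (F := F) (X := X) (k := k)
    (P := X.filter fun x => swapFam i x F = F) (Q := X.filter fun x => swapFam j x F = F)
    (by
      rw [disjoint_left]
      exact fun x hx hx' => hsep x hx x hx' (hself x))
    (by
      rw [← filter_or]
      exact filter_true_of_mem hcover)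
    (fun x hx y hy => hcls i x y (mem_filter.1 hx).2 (mem_filter.1 hy).2)
    (fun x hx y hy => hcls j x y (mem_filter.1 hx).2 (mem_filter.1 hy).2)
    (fun p hp q hq A hA B hB hpA hpB => card_le_one.1
      (hone p (mem_filter.1 hp).1 q (mem_filter.1 hq).1 (hsep p hp q hq))
      A (hmemI p q A hA hpA) B (hmemI p q B hB hpB))
    h.left_sub hF hk hX ⟨i, mem_filter.2 ⟨hi, hself i⟩⟩ ⟨j, mem_filter.2 ⟨hj, hself j⟩⟩
  rcases hres with ⟨W, hWX, hWc, hWF, hFc⟩ | ⟨Y, hYX, hYc, hFY⟩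
  · have := h.card_add_lt_of_powersetCard_subset hk hX hWX hWc hWF hFc
    omega
  · have hk3 : k = 3 := by
      by_contra hk3
      subst hFY
      have := h.card_add_lt_of_eq_book (by omega) hX hYX hYc
      omega
    exact ⟨hk3, Y, hYX, by omega, hFY⟩

end Minimal

section Extremal

variable {X Y : Finset α} {k s : ℕ} {F G : Finset (Finset α)}

theorem card_filter_meet (hY : Y ⊆ X) :
    (#{D ∈ powersetCard k X | (D ∩ Y).Nonempty} : ℤ) =
      (#X).choose k - (#X - #Y).choose k := by
  have h1 := card_filter_add_card_filter_not (s := powersetCard k X) (fun D => (D ∩ Y).Nonempty)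
  have h2 : {D ∈ powersetCard k X | ¬ (D ∩ Y).Nonempty} = powersetCard k (X \ Y) := by
    rw [← filter_disjoint_powersetCard]
    refine filter_congr fun D _ => ?_
    rw [not_nonempty_iff_eq_empty, disjoint_iff_inter_eq_empty, inter_comm]
  rw [h2, card_powersetCard, card_powersetCard, card_sdiff_of_subset hY] at h1
  omega

theorem card_filter_mem {u : α} (hu : u ∈ X) :
    (#{D ∈ powersetCard k X | u ∈ D} : ℤ) = (#X).choose k - (#X - 1).choose k := by
  rw [← card_singleton u, ← card_filter_meet (singleton_subset_iff.2 hu)]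
  congr 2
  refine filter_congr fun D _ => ?_
  by_cases h : u ∈ D <;> simp [h]

theorem maxSum_three_eq_book {n : ℕ} (hn : 6 < n) :
    maxSum n 3 = (n - 2 : ℕ) + ((n.choose 3 : ℤ) - (n - 2).choose 3) := by
  obtain ⟨m, rfl⟩ := Nat.exists_eq_add_of_lt hn
  have e2 : 6 + m + 1 - 2 = m + 3 + 1 + 1 := by omega
  have e3 : 6 + m + 1 - 3 = m + 3 + 1 := by omega
  rw [maxSum, e2, e3, Nat.choose_succ_succ' (m + 3 + 1) 2, Nat.choose_succ_succ' (m + 3) 1,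
    Nat.choose_one_right]
  push_cast
  ring

theorem maxSum_three_eq_star {n : ℕ} (hn : 6 < n) :
    maxSum n 3 = 2 * ((n.choose 3 : ℤ) - (n - 1).choose 3) := by
  obtain ⟨m, rfl⟩ := Nat.exists_eq_add_of_lt hn
  have e0 : 6 + m + 1 = m + 3 + 1 + 1 + 1 + 1 := by omega
  rw [maxSum, e0]
  simp only [Nat.add_sub_cancel, show m + 3 + 1 + 1 + 1 + 1 - 3 = m + 3 + 1 by omega]
  simp only [Nat.choose_succ_succ' _ 2, Nat.choose_succ_succ' _ 1, Nat.choose_succ_succ' _ 0,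
    Nat.choose_one_right, Nat.choose_zero_right]
  push_cast
  ring

/-- A pair whose first family contains a book has a second family inside the transversals. -/
theorem IsCrossPair.meets_of_book_subset (h : IsCrossPair X k F G) (hX : k < #(X \ Y))
    (hb : book X Y ⊆ F) : G ⊆ {D ∈ powersetCard k X | (D ∩ Y).Nonempty} := by
  intro D hD
  refine mem_filter.2 ⟨h.right_sub hD, ?_⟩
  by_contra hn
  rw [not_nonempty_iff_eq_empty] at hn
  have hDc := (mem_powersetCard.1 (h.right_sub hD)).2
  have : ¬ X \ Y ⊆ D := fun hs => by have := card_le_card hs; omega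
  obtain ⟨x, hx, hxD⟩ := not_subset.1 this
  rw [mem_sdiff] at hx
  obtain ⟨y, hy⟩ := h.cross _ (hb (mem_book.2 ⟨x, hx.1, hx.2, rfl⟩)) D hD
  rw [mem_inter, mem_insert] at hy
  rcases hy.1 with rfl | hy'
  · exact hxD hy.2
  · exact notMem_empty y (hn ▸ mem_inter.2 ⟨hy.2, hy'⟩)

namespace IsCrossPair

theorem exists_book_subset (hs : SumBound X k s)
    (hM : maxSum #X k ≤ s) (hk : 3 ≤ k) (hX : 2 * k < #X)
    (h : IsCrossPair X k F G) (hle : #F ≤ #G) (hsum : #F + #G = s) (hF : 3 ≤ #F) :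
    k = 3 ∧ (s : ℤ) = maxSum #X k ∧ ∃ Y ⊆ X, #Y = 2 ∧ book X Y ⊆ F := by
  induction hm : #F using Nat.strong_induction_on generalizing F G with
  | _ m ih =>
    subst hm
    by_cases hmin : ∀ i ∈ X, ∀ j ∈ X, swapFam i j F = F ∨ #(F ∩ swapFam i j F) ≤ 2
    · obtain ⟨rfl, Y, hY, hYc, rfl⟩ := eq_book_of_minimal hs hM hk hX h hle hsum hF hmin
      refine ⟨rfl, le_antisymm ?_ hM, Y, hY, hYc, subset_rfl⟩
      have hc := card_sdiff_of_subset hY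
      have h1 := card_le_card (h.meets_of_book_subset (by omega) subset_rfl)
      have h2 := card_filter_meet (k := 3) hY
      rw [card_book, hc, hYc] at hsum
      rw [hYc] at h2
      rw [maxSum_three_eq_book (by omega)]
      omega
    · push Not at hmin
      obtain ⟨i, hi, j, hj, hne, h3⟩ := hmin
      have hlt : #(F ∩ swapFam i j F) < #F := by
        refine card_lt_card ((ssubset_iff_subset_ne).2 ⟨inter_subset_left, fun he => hne ?_⟩)
        exact (eq_of_subset_of_card_le (inter_eq_left.1 he) (by simp)).symm
      have l2 : #G ≤ #(G ∪ swapFam i j G) := card_le_card subset_union_left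
      obtain ⟨h1, h2, Y, hY, hYc, hb⟩ := ih _ hlt (h.inter_union (h.map_swap hi hj)) (by omega)
        (h.uncross hs hle hsum hi hj (by omega)) (by omega) rfl
      exact ⟨h1, h2, Y, hY, hYc, hb.trans inter_subset_left⟩

theorem card_add_le_maxSum (hk : 3 ≤ k) (hX : 2 * k < #X) : ∀ {F G : Finset (Finset α)},
    IsCrossPair X k F G → 2 ≤ #F → 2 ≤ #G → (#F + #G : ℤ) ≤ maxSum #X k := by
  classical
  have hex : ∃ s, SumBound X k s := by
    refine ⟨#(powersetCard k X) + #(powersetCard k X), fun F G h _ _ => ?_⟩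
    exact add_le_add (card_le_card h.left_sub) (card_le_card h.right_sub)
  by_contra! hcon
  obtain ⟨F₀, G₀, h₀, hF₀, hG₀, hlt⟩ := hcon
  have hs := Nat.find_spec hex
  have hb₀ := hs _ _ h₀ hF₀ hG₀
  have hn := Nat.find_min hex (m := Nat.find hex - 1) (by omega)
  set s := Nat.find hex
  have hM : maxSum #X k < s := by omega
  simp only [SumBound, not_forall, not_le] at hn
  obtain ⟨F, G, h, hF, hG, hlt⟩ := hn
  have key : ∀ {F G : Finset (Finset α)}, IsCrossPair X k F G → 2 ≤ #F → #F ≤ #G →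
      #F + #G = s → False := by
    intro F G h hF hle hsum
    rcases hF.eq_or_lt with h2 | h3
    · have := h.card_add_le_of_card_eq_two (by omega) hX h2.symm
      omega
    · have := (h.exists_book_subset hs hM.le hk hX hle hsum h3).2.1
      omega
  have := hs _ _ h hF hG
  rcases le_total #F #G with hle | hle
  · exact key h hF hle (by omega)
  · exact key h.symm hG hle (by omega)

end IsCrossPair

theorem mem_book_of_subset {A : Finset α} (hA : A ⊆ X) (hYA : Y ⊆ A) (hc : #A = #Y + 1) :
    A ∈ book X Y := by
  obtain ⟨x, hx⟩ := card_pos.1 (by rw [card_sdiff_of_subset hYA]; omega : 0 < #(A \ Y))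
  rw [mem_sdiff] at hx
  refine mem_book.2 ⟨x, hA hx.1, hx.2, ?_⟩
  exact eq_of_subset_of_card_le (insert_subset hx.1 hYA) (by rw [card_insert_of_notMem hx.2, hc])

theorem swapSet_mem_book (hY : Y ⊆ X) {i j : α} (hi : i ∈ X \ Y) (hj : j ∈ X \ Y) {A : Finset α}
    (hA : A ∈ book X Y) : swapSet i j A ∈ book X Y := by
  obtain ⟨x, hx, hxY, rfl⟩ := mem_book.1 hA
  rw [mem_sdiff] at hi hj
  refine mem_book_of_subset (swapSet_subset (insert_subset hx hY) hi.1 hj.1) ?_ ?_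
  · intro y hy
    rw [mem_swapSet, Equiv.swap_apply_of_ne_of_ne (by rintro rfl; exact hi.2 hy)
      (by rintro rfl; exact hj.2 hy)]
    exact mem_insert_of_mem hy
  · rw [card_swapSet, card_insert_of_notMem hxY]

namespace IsCrossPair

theorem eq_star_of_subset (h : IsCrossPair X 3 F G) (hX : 6 < #X) (hle : #F ≤ #G)
    {u : α} (hu : u ∈ X)
    (hF : {D ∈ powersetCard 3 X | u ∈ D} ⊆ F) :
    F = {D ∈ powersetCard 3 X | u ∈ D} ∧ G = {D ∈ powersetCard 3 X | u ∈ D} := by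
  have hG : G ⊆ {D ∈ powersetCard 3 X | u ∈ D} := by
    intro D hD
    refine mem_filter.2 ⟨h.right_sub hD, ?_⟩
    by_contra huD
    have hDc := mem_powersetCard.1 (h.right_sub hD)
    have h1 : #(X \ D) = #X - 3 := by rw [card_sdiff_of_subset hDc.1, hDc.2]
    obtain ⟨E, huE, hE, hEc⟩ := exists_subsuperset_card_eq (n := 3)
      (singleton_subset_iff.2 (mem_sdiff.2 ⟨hu, huD⟩)) (by simp) (by omega)
    have hEF := hF (mem_filter.2 ⟨mem_powersetCard.2 ⟨hE.trans sdiff_subset, hEc⟩,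
      singleton_subset_iff.1 huE⟩)
    obtain ⟨x, hx⟩ := h.cross E hEF D hD
    rw [mem_inter] at hx
    exact (mem_sdiff.1 (hE hx.1)).2 hx.2
  have h1 := card_le_card hF
  have h2 := card_le_card hG
  exact ⟨(eq_of_subset_of_card_le hF (by omega)).symm, eq_of_subset_of_card_le hG (by omega)⟩

theorem eq_book_or_star_of_swapFam_eq (h : IsCrossPair X 3 F G) (hX : 6 < #X) (hle : #F ≤ #G)
    (hY : Y ⊆ X) (hYc : #Y = 2) (hb : book X Y ⊆ F)
    (hsw : ∀ i ∈ X \ Y, ∀ j ∈ X \ Y, swapFam i j F = F) :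
    F = book X Y ∨ ∃ u ∈ X, F = {D ∈ powersetCard 3 X | u ∈ D} ∧
      G = {D ∈ powersetCard 3 X | u ∈ D} := by
  refine or_iff_not_imp_left.2 fun hne => ?_
  have hYX := card_sdiff_of_subset hY
  obtain ⟨C, hCF, hCb⟩ := not_subset.1 fun hs => hne (subset_antisymm hs hb)
  have hC := mem_powersetCard.1 (h.left_sub hCF)
  have hmem : ∀ D ∈ powersetCard 3 X, (∀ y ∈ Y, y ∈ D ↔ y ∈ C) → D ∈ F := by
    intro D hD hDC
    rw [mem_powersetCard] at hD
    refine mem_of_swapFam_eq hsw hCF (hD.2.trans hC.2.symm) ?_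
    ext y
    have h1 := @hD.1 y
    have h2 := @hC.1 y
    have h3 := hDC y
    simp only [mem_sdiff]
    tauto
  by_cases hCY : ∃ u ∈ Y, u ∈ C
  · obtain ⟨u, huY, huC⟩ := hCY
    refine ⟨u, hY huY, h.eq_star_of_subset hX hle (hY huY) fun D hD => ?_⟩
    rw [mem_filter] at hD
    by_cases hYD : Y ⊆ D
    · have hD' := mem_powersetCard.1 hD.1
      exact hb (mem_book_of_subset hD'.1 hYD (by omega))
    · refine hmem D hD.1 fun y hy => ?_
      have hYC : ¬ Y ⊆ C := fun hYC => hCb (mem_book_of_subset hC.1 hYC (by omega))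
      obtain ⟨v, hv, hvD⟩ := not_subset.1 hYD
      obtain ⟨w, hw, hwC⟩ := not_subset.1 hYC
      obtain ⟨a, b, -, rfl⟩ := card_eq_two.1 hYc
      simp only [mem_insert, mem_singleton] at hy huY hv hw
      rcases hy with rfl | rfl <;> rcases huY with rfl | rfl <;> rcases hv with rfl | rfl <;>
        rcases hw with rfl | rfl <;> tauto
  · push Not at hCY
    obtain ⟨D, hD⟩ := card_pos.1 (by have := card_pos.2 ⟨C, hCF⟩; omega : 0 < #G)
    have hDY := (mem_filter.1 (h.meets_of_book_subset (by omega) hb hD)).2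
    have hDc := (mem_powersetCard.1 (h.right_sub hD)).2
    have h1 := card_sdiff_add_card_inter D Y
    have h2 := hDY.card_pos
    have h3 := le_card_sdiff (D \ Y) (X \ Y)
    obtain ⟨E, hE, hEc⟩ := exists_subset_card_eq (by omega : 3 ≤ #((X \ Y) \ (D \ Y)))
    have hEF := hmem E (mem_powersetCard.2 ⟨hE.trans (sdiff_subset.trans sdiff_subset), hEc⟩)
      fun y hy => iff_of_false (fun hyE => (mem_sdiff.1 (mem_sdiff.1 (hE hyE)).1).2 hy) (hCY y hy)
    obtain ⟨x, hx⟩ := h.cross E hEF D hD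
    rw [mem_inter] at hx
    have := mem_sdiff.1 (hE hx.1)
    exact absurd (mem_sdiff.2 ⟨hx.2, (mem_sdiff.1 this.1).2⟩) this.2

theorem eq_book_or_star (hs : SumBound X 3 s) (hX : 6 < #X) (h : IsCrossPair X 3 F G)
    (hle : #F ≤ #G) (hsum : #F + #G = s) (hY : Y ⊆ X) (hYc : #Y = 2) (hb : book X Y ⊆ F) :
    F = book X Y ∨ ∃ u ∈ X, F = {D ∈ powersetCard 3 X | u ∈ D} ∧
      G = {D ∈ powersetCard 3 X | u ∈ D} := by
  induction hm : #F using Nat.strong_induction_on generalizing F G with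
  | _ m ih =>
    subst hm
    by_cases hsw : ∀ i ∈ X \ Y, ∀ j ∈ X \ Y, swapFam i j F = F
    · exact h.eq_book_or_star_of_swapFam_eq hX hle hY hYc hb hsw
    push Not at hsw
    obtain ⟨i, hi, j, hj, hne⟩ := hsw
    have hi' := (mem_sdiff.1 hi).1
    have hj' := (mem_sdiff.1 hj).1
    have hb' : book X Y ⊆ F ∩ swapFam i j F := fun A hA =>
      mem_inter.2 ⟨hb hA, mem_swapFam.2 (hb (swapSet_mem_book hY hi hj hA))⟩
    have hns : ¬ F ⊆ F ∩ swapFam i j F := fun hsub => hne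
      (eq_of_subset_of_card_le (hsub.trans inter_subset_right) (by simp)).symm
    have hlt : #(F ∩ swapFam i j F) < #F := card_lt_card ⟨inter_subset_left, hns⟩
    have hYX := card_sdiff_of_subset hY
    have hbc := card_book X Y
    have hbl := card_le_card hb'
    have l2 : #G ≤ #(G ∪ swapFam i j G) := card_le_card subset_union_left
    have h' := h.inter_union (h.map_swap hi' hj')
    have hsum' := h.uncross hs hle hsum hi' hj' (by omega)
    rcases ih _ hlt h' (by omega) hsum' hb' rfl with hF' | ⟨u, -, hF', hG'⟩
    · exfalso
      obtain ⟨C, hCF, hCn⟩ := not_subset.1 hns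
      have hC := mem_powersetCard.1 (h.left_sub hCF)
      have hYC : ¬ Y ⊆ C := fun hYC =>
        hCn (hb' (mem_book_of_subset hC.1 hYC (by omega)))
      obtain ⟨y, hy, hyC⟩ := not_subset.1 hYC
      have hCs : swapSet i j C ∉ F := fun hn => hCn (mem_inter.2 ⟨hCF, mem_swapFam.2 hn⟩)
      have hW := card_insert_insert_of_swapSet_notMem hCF hCs
      have hWX := le_card_sdiff (insert i (insert j C)) X
      have hyW : y ∈ X \ insert i (insert j C) := by
        simp only [mem_sdiff, mem_insert, not_or]
        exact ⟨hY hy, fun e => (mem_sdiff.1 hi).2 (e ▸ hy), fun e => (mem_sdiff.1 hj).2 (e ▸ hy),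
          hyC⟩
      obtain ⟨D, hyD, hD, hDc⟩ := exists_subsuperset_card_eq (n := 3)
        (singleton_subset_iff.2 hyW) (by simp) (by omega)
      have hDW : ∀ x ∈ D, x ∉ insert i (insert j C) := fun x hx => (mem_sdiff.1 (hD hx)).2
      have hDG : D ∈ G ∪ swapFam i j G := by
        refine h'.mem_right hs (by omega) (by omega) hsum'
          (mem_powersetCard.2 ⟨hD.trans sdiff_subset, hDc⟩) fun A hA => ?_
        rw [hF'] at hA
        obtain ⟨x, -, -, rfl⟩ := mem_book.1 hA
        exact ⟨y, mem_inter.2 ⟨mem_insert_of_mem hy, singleton_subset_iff.1 hyD⟩⟩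
      rw [mem_union, mem_swapFam, swapSet_eq_self, or_self] at hDG
      · obtain ⟨x, hx⟩ := h.cross C hCF D hDG
        rw [mem_inter] at hx
        exact hDW x hx.2 (by simp [hx.1])
      · exact iff_of_false (fun hiD => hDW i hiD (by simp)) (fun hjD => hDW j hjD (by simp))
    · rw [hG', ← hF'] at l2
      omega

end IsCrossPair

theorem card_book_add_card_filter_meet (hX : 6 < #X) (hY : Y ⊆ X) (hYc : #Y = 2) :
    (#(book X Y) + #{D ∈ powersetCard 3 X | (D ∩ Y).Nonempty} : ℤ) = maxSum #X 3 := by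
  rw [card_book, card_filter_meet hY, card_sdiff_of_subset hY, hYc, maxSum_three_eq_book hX]

theorem card_star_add_card_star (hX : 6 < #X) {u : α} (hu : u ∈ X) :
    (#{D ∈ powersetCard 3 X | u ∈ D} + #{D ∈ powersetCard 3 X | u ∈ D} : ℤ) = maxSum #X 3 := by
  rw [card_filter_mem hu, maxSum_three_eq_star hX, two_mul]

namespace IsCrossPair

theorem eq_of_card_add_eq_maxSum (h : IsCrossPair X k F G) (hk : 3 ≤ k) (hX : 2 * k < #X)
    (hle : #F ≤ #G) (hF : 2 ≤ #F) (hsum : (#F + #G : ℤ) = maxSum #X k) :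
    (∃ A ∈ powersetCard k X, ∃ B ∈ powersetCard k X, #(A ∩ B) = k - 1 ∧ F = {A, B} ∧
      G = {D ∈ powersetCard k X | (D ∩ A).Nonempty ∧ (D ∩ B).Nonempty}) ∨
    (k = 3 ∧ ((∃ Y ⊆ X, #Y = 2 ∧ F = book X Y ∧
        G = {D ∈ powersetCard 3 X | (D ∩ Y).Nonempty}) ∨
      ∃ u ∈ X, F = {D ∈ powersetCard 3 X | u ∈ D} ∧ G = {D ∈ powersetCard 3 X | u ∈ D})) := by
  have hs : SumBound X k (#F + #G) := fun F' G' h' hF' hG' => by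
    have := card_add_le_maxSum hk hX h' hF' hG'
    omega
  have hsup : ∀ D ∈ powersetCard k X, (∀ A ∈ F, (A ∩ D).Nonempty) → D ∈ G :=
    fun D hD hc => h.mem_right hs hF (hF.trans hle) rfl hD hc
  rcases hF.eq_or_lt with h2 | h3
  · left
    obtain ⟨A, B, hne, rfl⟩ := card_eq_two.1 h2.symm
    refine ⟨A, h.left_sub (by simp), B, h.left_sub (by simp),
      card_inter_of_card_eq_two (by omega) hX hne h (by omega), rfl, ?_⟩
    ext D
    rw [mem_filter, inter_comm D A, inter_comm D B]
    constructor
    · intro hD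
      exact mem_filter.1 (h.right_subset_filter (by simp) (by simp) hD)
    · rintro ⟨hD, hA, hB⟩
      refine hsup D hD ?_
      simp [hA, hB]
  · right
    obtain ⟨rfl, -, Y, hY, hYc, hb⟩ := h.exists_book_subset hs (by omega) hk hX hle rfl h3
    refine ⟨rfl, (h.eq_book_or_star hs hX hle rfl hY hYc hb).imp_left ?_⟩
    rintro rfl
    refine ⟨Y, hY, hYc, rfl, subset_antisymm (h.meets_of_book_subset ?_ hb) ?_⟩
    · rw [card_sdiff_of_subset hY]
      omega
    · intro D hD
      obtain ⟨hD, y, hy⟩ := mem_filter.1 hD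
      refine hsup D hD fun A hA => ?_
      obtain ⟨x, -, -, rfl⟩ := mem_book.1 hA
      rw [mem_inter] at hy
      exact ⟨y, mem_inter.2 ⟨mem_insert_of_mem hy.2, hy.1⟩⟩

/-- Each member of the second family forbids its complement in the first one. -/
theorem card_add_le_choose (h : IsCrossPair X k F G) (hX : #X = 2 * k) :
    #F + #G ≤ (#X).choose k := by
  have hinj : Set.InjOn (X \ ·) (G : Set (Finset α)) := fun A hA B hB hAB => by
    have hA' := (mem_powersetCard.1 (h.right_sub hA)).1
    have hB' := (mem_powersetCard.1 (h.right_sub hB)).1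
    rw [← Finset.sdiff_sdiff_eq_self hA', ← Finset.sdiff_sdiff_eq_self hB']
    exact congrArg (X \ ·) hAB
  have hd : Disjoint F (G.image (X \ ·)) := by
    rw [disjoint_left]
    intro A hA hA'
    obtain ⟨B, hB, rfl⟩ := mem_image.1 hA'
    have := h.cross _ hA B hB
    rw [sdiff_inter_self] at this
    exact not_nonempty_empty this
  rw [← card_image_of_injOn hinj, ← card_union_of_disjoint hd, ← card_powersetCard]
  refine card_le_card (union_subset h.left_sub fun A hA => ?_)
  obtain ⟨B, hB, rfl⟩ := mem_image.1 hA
  have hB' := mem_powersetCard.1 (h.right_sub hB)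
  refine mem_powersetCard.2 ⟨sdiff_subset, ?_⟩
  rw [card_sdiff_of_subset hB'.1, hB'.2]
  omega

end IsCrossPair

theorem image_perm_eq_self {σ : Equiv.Perm α} (hσ : ∀ x ∈ X, σ x ∈ X) : X.image σ = X :=
  eq_of_subset_of_card_le (image_subset_iff.2 hσ) (card_image_of_injective _ σ.injective).ge

theorem image_filter_powersetCard {σ : Equiv.Perm α} (hσ : ∀ x ∈ X, σ x ∈ X)
    {p q : Finset α → Prop} [DecidablePred p] [DecidablePred q]
    (hpq : ∀ D, q (D.image σ) ↔ p D) :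
    ({D ∈ powersetCard k X | p D}).image (fun s => s.image fun x => σ x) =
      {D ∈ powersetCard k X | q D} := by
  ext E
  simp only [mem_image, mem_filter, mem_powersetCard]
  constructor
  · rintro ⟨D, ⟨⟨hD, hc⟩, hp⟩, rfl⟩
    exact ⟨⟨image_subset_iff.2 fun x hx => hσ x (hD hx),
      (card_image_of_injective _ σ.injective).trans hc⟩, (hpq D).2 hp⟩
  · rintro ⟨⟨hE, hc⟩, hq⟩
    have hE' : (E.image σ.symm).image σ = E := by simp [image_image]
    refine ⟨E.image σ.symm, ⟨⟨fun x hx => ?_, ?_⟩, (hpq _).1 (hE'.symm ▸ hq)⟩, hE'⟩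
    · obtain ⟨y, hy, rfl⟩ := mem_image.1 hx
      have := hE hy
      rw [← image_perm_eq_self hσ, mem_image] at this
      obtain ⟨z, hz, rfl⟩ := this
      simpa using hz
    · rw [card_image_of_injective _ σ.symm.injective, hc]

theorem image_book {σ : Equiv.Perm α} (hσ : ∀ x ∈ X, σ x ∈ X) :
    (book X Y).image (fun s => s.image fun x => σ x) = book X (Y.image σ) := by
  have h : book X (Y.image σ) = (X.image σ \ Y.image σ).image (insert · (Y.image σ)) := by
    rw [image_perm_eq_self hσ, book]
  rw [h, ← image_sdiff _ _ σ.injective, book, image_image, image_image]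
  refine image_congr fun x _ => ?_
  simp [image_insert]

theorem exists_perm_image_pair {a b u v : α} (hab : a ≠ b) (huv : u ≠ v) (ha : a ∈ X) (hb : b ∈ X)
    (hu : u ∈ X) (hv : v ∈ X) :
    ∃ σ : Equiv.Perm α, (∀ x ∈ X, σ x ∈ X) ∧ ({u, v} : Finset α).image σ = {a, b} := by
  have hsw : ∀ {i j x : α}, i ∈ X → j ∈ X → x ∈ X → Equiv.swap i j x ∈ X := by
    intro i j x hi hj hx
    rw [Equiv.swap_apply_def]
    split_ifs <;> assumption
  have hw : Equiv.swap u a v ∈ X := hsw hu ha hv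
  have hwa : a ≠ Equiv.swap u a v := by
    intro h
    rw [← Equiv.swap_apply_left u a] at h
    exact huv ((Equiv.swap u (Equiv.swap u a u)).injective (by simpa using h))
  refine ⟨Equiv.swap b (Equiv.swap u a v) * Equiv.swap u a,
    fun x hx => hsw hb hw (hsw hu ha hx), ?_⟩
  simp [image_insert, Equiv.swap_apply_of_ne_of_ne hab hwa]

theorem book_Icc (n : ℕ) :
    book (Icc 1 n) (Icc 1 2) = (Icc 3 n).image (fun i => insert i (Icc 1 2)) := by
  have : Icc 1 n \ Icc 1 2 = Icc 3 n := by
    ext x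
    simp only [mem_sdiff, mem_Icc]
    omega
  rw [book, this]

end Extremal

end CrossIntersecting

/-- Let `k ≥ 3`, `n ≥ 2k`, and let `ℱ, 𝒢 ⊆ ([n] choose k)` be cross-intersecting
with `|𝒢| ≥ |ℱ| ≥ 2`.  Then `|ℱ|+|𝒢| ≤ C(n,k) − C(n−k,k) − C(n−k−1,k−1) + 2`,
and for `n > 2k` equality holds iff, up to a permutation of `[n]`, `(ℱ,𝒢)` is
one of the extremal configurations. -/
theorem stmt_12 (k n : ℕ) (hk : 3 ≤ k) (hn : 2 * k ≤ n)
    (F G : Finset (Finset ℕ))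
    (hF : F ⊆ powersetCard k (Icc 1 n))
    (hG : G ⊆ powersetCard k (Icc 1 n))
    (hcross : ∀ A ∈ F, ∀ B ∈ G, (A ∩ B).Nonempty)
    (hFG : F.card ≤ G.card) (hF2 : 2 ≤ F.card) :
    ((F.card : ℤ) + G.card ≤
      (n.choose k : ℤ) - (n - k).choose k - (n - k - 1).choose (k - 1) + 2) ∧
    (2 * k < n →
      (((F.card : ℤ) + G.card =
        (n.choose k : ℤ) - (n - k).choose k - (n - k - 1).choose (k - 1) + 2) ↔
      ∃ σ : Equiv.Perm ℕ, (∀ x ∈ Icc 1 n, σ x ∈ Icc 1 n) ∧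
        ((∃ F₁ ∈ powersetCard k (Icc 1 n), ∃ F₂ ∈ powersetCard k (Icc 1 n),
            (F₁ ∩ F₂).card = k - 1 ∧
            F.image (fun s => s.image fun x => σ x) = {F₁, F₂} ∧
            G.image (fun s => s.image fun x => σ x) =
              (powersetCard k (Icc 1 n)).filter fun B =>
                (B ∩ F₁).Nonempty ∧ (B ∩ F₂).Nonempty) ∨
         (k = 3 ∧
          ((F.image (fun s => s.image fun x => σ x) =
              (Icc 3 n).image (fun i => insert i (Icc 1 2)) ∧
            G.image (fun s => s.image fun x => σ x) =
              (powersetCard 3 (Icc 1 n)).filter fun B => (B ∩ Icc 1 2).Nonempty) ∨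
           (F.image (fun s => s.image fun x => σ x) =
              (powersetCard 3 (Icc 1 n)).filter (fun B => 1 ∈ B) ∧
            G.image (fun s => s.image fun x => σ x) =
              (powersetCard 3 (Icc 1 n)).filter fun B => 1 ∈ B)))))) := by
  have hc : #(Icc 1 n) = n := by simp
  have h : IsCrossPair (Icc 1 n) k F G := ⟨hF, hG, hcross⟩
  change _ ≤ maxSum n k ∧ (_ → (_ = maxSum n k ↔ _))
  constructor
  · rcases hn.eq_or_lt with rfl | hlt
    · have := h.card_add_le_choose hc
      rw [hc] at this
      have e1 : 2 * k - k = k := by omega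
      rw [maxSum, e1, Nat.choose_self, Nat.choose_self]
      omega
    · have := IsCrossPair.card_add_le_maxSum hk (hc.symm ▸ hlt) h hF2 (hF2.trans hFG)
      rwa [hc] at this
  intro hlt
  have hX : 2 * k < #(Icc 1 n) := hc.symm ▸ hlt
  constructor
  · intro hsum
    rcases h.eq_of_card_add_eq_maxSum hk hX hFG hF2 (hc.symm ▸ hsum) with
      ⟨A, hA, B, hB, hAB, rfl, rfl⟩ | ⟨rfl, ⟨Y, hY, hYc, rfl, rfl⟩ | ⟨u, hu, rfl, rfl⟩⟩
    · refine ⟨1, fun x hx => hx, Or.inl ⟨A, hA, B, hB, hAB, ?_, ?_⟩⟩ <;> simp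
    · obtain ⟨u, v, huv, rfl⟩ := card_eq_two.1 hYc
      obtain ⟨σ, hσ, hY'⟩ := exists_perm_image_pair (X := Icc 1 n) (a := 1) (b := 2) (by simp) huv
        (by simp; omega) (by simp; omega) (hY (by simp)) (hY (by simp))
      have h12 : ({1, 2} : Finset ℕ) = Icc 1 2 := rfl
      rw [h12] at hY'
      refine ⟨σ, hσ, Or.inr ⟨rfl, Or.inl ⟨?_, image_filter_powersetCard hσ fun D => ?_⟩⟩⟩
      · rw [image_book hσ, hY', book_Icc]
      · rw [← hY', ← image_inter _ _ σ.injective, image_nonempty]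
    · have h1 : 1 ∈ Icc 1 n := by simp; omega
      have hσ : ∀ x ∈ Icc 1 n, Equiv.swap u 1 x ∈ Icc 1 n := by
        intro x hx
        rw [Equiv.swap_apply_def]
        split_ifs <;> assumption
      have hp : ∀ D : Finset ℕ, 1 ∈ D.image (Equiv.swap u 1) ↔ u ∈ D := by
        intro D
        have := (Equiv.swap u 1).injective.mem_finset_image (s := D) (a := u)
        rwa [Equiv.swap_apply_left] at this
      exact ⟨Equiv.swap u 1, hσ, Or.inr ⟨rfl, Or.inr
        ⟨image_filter_powersetCard hσ hp, image_filter_powersetCard hσ hp⟩⟩⟩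
  · rintro ⟨σ, -, hσ⟩
    have hcard : ∀ H : Finset (Finset ℕ), #(H.image fun s => s.image fun x => σ x) = #H :=
      fun H => card_image_of_injective _ (image_injective σ.injective)
    rw [← hcard F, ← hcard G]
    rcases hσ with ⟨A, hA, B, hB, hAB, e1, e2⟩ | ⟨rfl, ⟨e1, e2⟩ | ⟨e1, e2⟩⟩
    · have hne : A ≠ B := by
        rintro rfl
        rw [inter_self, (mem_powersetCard.1 hA).2] at hAB
        omega
      have := card_filter_meet_both_eq (by omega) hX hA hB hAB
      simp only [inter_comm A, inter_comm B, hc] at this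
      rw [e1, e2, card_pair hne, ← this]
      push_cast
      ring
    · have := card_book_add_card_filter_meet (X := Icc 1 n) hX (Y := Icc 1 2)
        (Icc_subset_Icc_right (by omega)) (by simp)
      rw [e1, e2, ← book_Icc, this, hc]
    · have := card_star_add_card_star (X := Icc 1 n) hX (u := 1) (by simp; omega)
      rw [e1, e2, this, hc]
end

section
/- Let k ≥ 4 and n ≥ 2k be positive integers. Let ℱ ⊆ ([n] choose k) and 𝒢 ⊆ ([n] choose k) be cross-intersecting families with |𝒢| ≥ |ℱ| ≥ 3. Then |ℱ| + |𝒢| ≤ C(n,k) − C(n−k,k) − C(n−k−1,k−1) − C(n−k−2,k−2) + 3. Moreover, for n > 2k, equality holds if and only if, up to a permutation of [n], ℱ = {F₁, F₂, F₃} with Fᵢ = [k−1] ∪ {k−1+i} for each i ∈ {1,2,3} and 𝒢 = {G ∈ ([n] choose k) : G ∩ Fᵢ ≠ ∅ for i = 1,2,3}, or k = 4 and ℱ = {[3] ∪ {i} : i ∈ {4,…,n}} and 𝒢 = {G ∈ ([n] choose 4) : G ∩ [3] ≠ ∅}. -/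
open Finset

/-- The `k`-subsets of `U` that are disjoint from some member of `F`. -/
def avoiding {α : Type*} [DecidableEq α] (U : Finset α) (k : ℕ) (F : Finset (Finset α)) :
    Finset (Finset α) :=
  {B ∈ powersetCard k U | ∃ A ∈ F, Disjoint A B}

section Avoiding

variable {α : Type*} [DecidableEq α] {U : Finset α} {k : ℕ} {F F₀ H : Finset (Finset α)}

lemma avoiding_mono (h : F₀ ⊆ F) : avoiding U k F₀ ⊆ avoiding U k F := by
  intro B hB
  simp only [avoiding, mem_filter] at hB ⊢
  obtain ⟨h1, A, hA, h2⟩ := hB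
  exact ⟨h1, A, h hA, h2⟩

lemma card_powersetCard_filter_superset {T Y : Finset α} (hTY : T ⊆ Y) (hT : #T ≤ k) :
    #{B ∈ powersetCard k Y | T ⊆ B} = (#Y - #T).choose (k - #T) := by
  rw [← card_sdiff_of_subset hTY, ← card_powersetCard]
  refine card_bij' (fun B _ => B \ T) (fun B _ => B ∪ T) ?_ ?_ ?_ ?_
  · intro B hB
    simp only [mem_filter, mem_powersetCard] at hB ⊢
    exact ⟨sdiff_subset_sdiff hB.1.1 le_rfl, by rw [card_sdiff_of_subset hB.2, hB.1.2]⟩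
  · intro B hB
    simp only [mem_filter, mem_powersetCard, subset_sdiff] at hB ⊢
    refine ⟨⟨union_subset hB.1.1 hTY, ?_⟩, subset_union_right⟩
    rw [card_union_of_disjoint hB.1.2, hB.2]
    omega
  · intro B hB
    simp only [mem_filter] at hB
    exact sdiff_union_of_subset hB.2
  · intro B hB
    simp only [mem_powersetCard, subset_sdiff] at hB
    exact union_sdiff_cancel_right hB.1.2

lemma card_avoiding_add_card_le {A : Finset α} (hH : H ⊆ powersetCard k (U \ A))
    (hF : ∀ X ∈ H, ∀ B ∈ F, ¬ Disjoint B X) :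
    #(avoiding U k F) + #H ≤ #(avoiding U k (insert A F)) := by
  rw [← card_union_of_disjoint]
  · refine card_le_card (union_subset (avoiding_mono (subset_insert _ _)) fun X hX => ?_)
    have := hH hX
    simp only [mem_powersetCard, subset_sdiff] at this
    simp only [avoiding, mem_filter, mem_powersetCard]
    exact ⟨⟨this.1.1, this.2⟩, A, mem_insert_self _ _, this.1.2.symm⟩
  · rw [disjoint_left]
    intro X hX hXH
    simp only [avoiding, mem_filter] at hX
    obtain ⟨-, B, hB, hd⟩ := hX
    exact hF X hXH B hB hd

lemma card_avoiding_add_choose_le {A T : Finset α} (hAU : A ⊆ U) (hT : T ⊆ U \ A) (hTk : #T ≤ k)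
    (hF : ∀ B ∈ F, ¬ Disjoint B T) :
    #(avoiding U k F) + (#U - #A - #T).choose (k - #T) ≤ #(avoiding U k (insert A F)) := by
  rw [← card_sdiff_of_subset hAU, ← card_powersetCard_filter_superset hT hTk]
  refine card_avoiding_add_card_le (filter_subset _ _) fun X hX B hB hd => ?_
  exact hF B hB (hd.mono_right (mem_filter.1 hX).2)

lemma exists_transversal {A : Finset α} (hFU : ∀ B ∈ F, B ⊆ U) (hA : ∀ B ∈ F, ¬ B ⊆ A)
    (hc : #F ≤ #(U \ A)) : ∃ T ⊆ U \ A, #T = #F ∧ ∀ B ∈ F, ¬ Disjoint B T := by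
  have h : ∀ B : F, ∃ x ∈ B.1, x ∉ A := fun B => not_subset.1 (hA B.1 B.2)
  choose f hf hfA using h
  obtain ⟨T, h1, h2, h3⟩ := exists_subsuperset_card_eq (s := F.attach.image f) (t := U \ A)
    (n := #F)
    (by
      intro x hx
      obtain ⟨B, -, rfl⟩ := mem_image.1 hx
      exact mem_sdiff.2 ⟨hFU B.1 B.2 (hf B), hfA B⟩)
    (card_image_le.trans card_attach.le) hc
  exact ⟨T, h2, h3, fun B hB => not_disjoint_iff.2
    ⟨f ⟨B, hB⟩, hf _, h1 (mem_image_of_mem _ (mem_attach _ _))⟩⟩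

lemma card_avoiding_add_sum_le (hn : 2 * k ≤ #U) (hF : F ⊆ powersetCard k U) (h₀ : F₀ ⊆ F)
    {p : ℕ} (hp₀ : #F₀ ≤ p) (hp : p ≤ #F) (hpk : p ≤ k + 1) :
    #(avoiding U k F₀) + ∑ i ∈ Ico #F₀ p, (#U - k - i).choose (k - i) ≤ #(avoiding U k F) := by
  induction p, hp₀ using Nat.le_induction generalizing F with
  | base => simpa using card_le_card (avoiding_mono h₀)
  | succ p hp₀ ih =>
    obtain ⟨F₁, h01, h1, hF₁⟩ := exists_subsuperset_card_eq h₀ (by omega) hp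
    obtain ⟨A, hA, hA₀⟩ := exists_mem_notMem_of_card_lt_card (s := F₀) (t := F₁) (by omega)
    have hc : #(F₁.erase A) = p := by rw [card_erase_of_mem hA, hF₁]; rfl
    have hmem : ∀ B ∈ F₁, B ⊆ U ∧ #B = k := fun B hB => mem_powersetCard.1 (hF (h1 hB))
    have hUA : #(U \ A) = #U - k := by rw [card_sdiff_of_subset (hmem A hA).1, (hmem A hA).2]
    have hrec := ih (F := F₁.erase A) ((erase_subset _ _).trans (h1.trans hF))
      (subset_erase.2 ⟨h01, hA₀⟩) hc.ge (by omega)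
    obtain ⟨T, hT, hTc, hTF⟩ := exists_transversal (F := F₁.erase A) (A := A) (U := U)
      (fun B hB => (hmem B (mem_of_mem_erase hB)).1)
      (fun B hB hBA => ne_of_mem_erase hB (eq_of_subset_of_card_le hBA
        (by rw [(hmem A hA).2, (hmem B (mem_of_mem_erase hB)).2]))) (by omega)
    have hstep := card_avoiding_add_choose_le (k := k) (hmem A hA).1 hT (by omega) hTF
    rw [insert_erase hA, (hmem A hA).2, hTc, hc] at hstep
    rw [sum_Ico_succ_top hp₀]
    have := card_le_card (avoiding_mono (U := U) (k := k) h1)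
    omega

lemma card_avoiding_le_sum_range (hn : 2 * k ≤ #U) (hF : F ⊆ powersetCard k U) (h₀ : F₀ ⊆ F)
    (hc : #F₀ ≤ k + 1)
    (ht : #(avoiding U k F) ≤ ∑ i ∈ range (min #F (k + 1)), (#U - k - i).choose (k - i)) :
    #(avoiding U k F₀) ≤ ∑ i ∈ range #F₀, (#U - k - i).choose (k - i) := by
  have h1 : #F₀ ≤ min #F (k + 1) := le_min (card_le_card h₀) hc
  have h := card_avoiding_add_sum_le hn hF h₀ h1 (min_le_left _ _) (min_le_right _ _)
  rw [← sum_range_add_sum_Ico _ h1] at ht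
  omega

lemma card_sdiff_eq_one_of_card_avoiding_pair_le (hk : 1 ≤ k) (hn : 2 * k < #U) {A B : Finset α}
    (hA : A ∈ powersetCard k U) (hB : B ∈ powersetCard k U) (hAB : A ≠ B)
    (ht : #(avoiding U k {A, B}) ≤ (#U - k).choose k + (#U - k - 1).choose (k - 1)) :
    #(B \ A) = 1 := by
  rw [mem_powersetCard] at hA hB
  have hpos : 0 < #(B \ A) := by
    rw [card_pos, sdiff_nonempty]
    exact fun h => hAB (eq_of_subset_of_card_le h (by omega)).symm
  by_contra hne
  obtain ⟨x, hx, y, hy, hxy⟩ := one_lt_card.1 (show 1 < #(B \ A) by omega)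
  rw [mem_sdiff] at hx hy
  have hUA : #(U \ A) = #U - k := by rw [card_sdiff_of_subset hA.1, hA.2]
  have hxUA : x ∈ U \ A := mem_sdiff.2 ⟨hB.1 hx.1, hx.2⟩
  obtain ⟨X, hyX, hXs, hXc⟩ := exists_subsuperset_card_eq (s := {y}) (t := (U \ A).erase x)
    (n := k) (by
      rw [singleton_subset_iff, mem_erase, mem_sdiff]
      exact ⟨hxy.symm, hB.1 hy.1, hy.2⟩) (by simpa using hk)
    (by rw [card_erase_of_mem hxUA]; omega)
  have hxX : x ∉ X := fun h => (mem_erase.1 (hXs h)).1 rfl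
  have h0 := card_avoiding_add_card_le (U := U) (A := A) (k := k) (F := {B})
    (H := insert X {Z ∈ powersetCard k (U \ A) | {x} ⊆ Z})
    (insert_subset (mem_powersetCard.2 ⟨hXs.trans (erase_subset _ _), hXc⟩) (filter_subset _ _))
    (by
      intro Z hZ C hC
      rw [mem_singleton.1 hC, not_disjoint_iff]
      rcases mem_insert.1 hZ with rfl | hZ
      · exact ⟨y, hy.1, hyX (mem_singleton_self _)⟩
      · exact ⟨x, hx.1, (mem_filter.1 hZ).2 (mem_singleton_self _)⟩)
  rw [card_insert_of_notMem (by simp [hxX]), card_powersetCard_filter_superset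
    (singleton_subset_iff.2 hxUA) (by simpa using hk), hUA, card_singleton] at h0
  have h1 := card_avoiding_add_sum_le (U := U) (k := k) (F := {B}) (F₀ := ∅) (p := 1) hn.le
    (by simpa using hB) (by simp) (by simp) (by simp) (by omega)
  simp at h1
  omega

lemma inter_eq_inter_of_card_avoiding_triple_le (hk : 2 ≤ k) (hn : 2 * k < #U)
    {A B C : Finset α} (hA : A ∈ powersetCard k U) (hB : B ∈ powersetCard k U)
    (hC : C ∈ powersetCard k U) (hAB : #(A \ B) = 1) (hAC : #(A \ C) = 1) (hBC : #(B \ C) = 1)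
    (ht : #(avoiding U k {C, A, B}) ≤
      (#U - k).choose k + (#U - k - 1).choose (k - 1) + (#U - k - 2).choose (k - 2)) :
    A ∩ C = B ∩ C := by
  rw [mem_powersetCard] at hA hB hC
  obtain ⟨x, hx⟩ := card_eq_one.1 hAC
  obtain ⟨y, hy⟩ := card_eq_one.1 hBC
  have hx' : x ∈ A ∧ x ∉ C := by rw [← mem_sdiff, hx]; simp
  have hy' : y ∈ B ∧ y ∉ C := by rw [← mem_sdiff, hy]; simp
  by_cases hxy : x = y
  · subst hxy
    exfalso
    have h0 := card_avoiding_add_choose_le (U := U) (A := C) (k := k) (F := {A, B}) (T := {x})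
      hC.1 (by simpa using ⟨hA.1 hx'.1, hx'.2⟩) (by simp; omega)
      (by simp [hx'.1, hy'.1])
    have hABne : A ≠ B := by rintro rfl; simp at hAB
    have h1 := card_avoiding_add_sum_le (U := U) (k := k) (F := {A, B}) (F₀ := ∅) (p := 2) hn.le
      (by simp [insert_subset_iff, hA, hB]) (by simp) (by simp) (by rw [card_pair hABne]) (by omega)
    simp [sum_range_succ, hC.2] at h0 h1
    have h2 : (#U - k - 1).choose (k - 1) =
        (#U - k - 2).choose (k - 2) + (#U - k - 2).choose (k - 1) := by
      rw [show #U - k - 1 = (#U - k - 2) + 1 by omega, show k - 1 = (k - 2) + 1 by omega,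
        Nat.choose_succ_succ]
    have h3 : 0 < (#U - k - 2).choose (k - 1) := Nat.choose_pos (by omega)
    omega
  · by_contra hne
    have hcA : #(A ∩ C) = k - 1 := by have := card_inter_add_card_sdiff A C; omega
    have hcB : #(B ∩ C) = k - 1 := by have := card_inter_add_card_sdiff B C; omega
    have hns : ¬ A ∩ C ⊆ B ∩ C := fun h => hne (eq_of_subset_of_card_le h (by omega))
    obtain ⟨c, hc, hcB⟩ := not_subset.1 hns
    rw [mem_inter] at hc hcB
    have hxB : x ∉ B := by
      intro h
      have : x ∈ B \ C := mem_sdiff.2 ⟨h, hx'.2⟩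
      rw [hy, mem_singleton] at this
      exact hxy this
    have : 1 < #(A \ B) := one_lt_card.2 ⟨x, mem_sdiff.2 ⟨hx'.1, hxB⟩, c,
      mem_sdiff.2 ⟨hc.1, fun h => hcB ⟨h, hc.2⟩⟩, fun h => hx'.2 (h ▸ hc.2)⟩
    omega

lemma exists_common_subset_of_card_avoiding_le (hk : 2 ≤ k) (hn : 2 * k < #U)
    (hF : F ⊆ powersetCard k U) (hF3 : 3 ≤ #F)
    (ht : #(avoiding U k F) ≤ ∑ i ∈ range (min #F (k + 1)), (#U - k - i).choose (k - i)) :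
    ∃ K, #K = k - 1 ∧ ∀ A ∈ F, K ⊆ A := by
  have hpair : ∀ A ∈ F, ∀ B ∈ F, A ≠ B → #(A \ B) = 1 := by
    intro A hA B hB hAB
    have h := card_avoiding_le_sum_range (F₀ := {B, A}) hn.le hF (by simp [insert_subset_iff, *])
      (by rw [card_pair hAB.symm]; omega) ht
    rw [card_pair hAB.symm] at h
    exact card_sdiff_eq_one_of_card_avoiding_pair_le (by omega) hn (hF hB) (hF hA) hAB.symm
      (by simpa [sum_range_succ] using h)
  obtain ⟨A, hA, B, hB, hAB⟩ := one_lt_card.1 (show 1 < #F by omega)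
  have hcard : ∀ C ∈ F, C ≠ A → #(A ∩ C) = k - 1 := by
    intro C hC hCA
    have := card_inter_add_card_sdiff A C
    have := (mem_powersetCard.1 (hF hA)).2
    have := hpair A hA C hC hCA.symm
    omega
  refine ⟨A ∩ B, hcard B hB hAB.symm, fun C hC => ?_⟩
  by_cases hCA : C = A
  · exact hCA ▸ inter_subset_left
  by_cases hCB : C = B
  · exact hCB ▸ inter_subset_right
  have hc3 : #{C, A, B} = 3 := card_eq_three.2 ⟨C, A, B, hCA, hCB, hAB, rfl⟩
  have h := card_avoiding_le_sum_range (F₀ := {C, A, B}) hn.le hF (by simp [insert_subset_iff, *])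
    (by omega) ht
  rw [hc3] at h
  have h := inter_eq_inter_of_card_avoiding_triple_le hk hn (hF hA) (hF hB) (hF hC)
    (hpair A hA B hB hAB) (hpair A hA C hC (Ne.symm hCA)) (hpair B hB C hC (Ne.symm hCB))
    (by simpa [sum_range_succ] using h)
  have h2 : A ∩ C ⊆ A ∩ B := subset_inter inter_subset_left (h ▸ inter_subset_left)
  rw [← eq_of_subset_of_card_le h2 (by rw [hcard B hB (Ne.symm hAB), hcard C hC hCA])]
  exact inter_subset_right

end Avoiding

section KruskalKatona

open Colex
open scoped FinsetFamily

lemma exists_isInitSeg_card_eq {n r m : ℕ} (hm : m ≤ n.choose r) :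
    ∃ 𝒞 : Finset (Finset (Fin n)), IsInitSeg 𝒞 r ∧ #𝒞 = m := by
  induction hm using Nat.decreasingInduction with
  | self =>
    refine ⟨powersetCard r univ, ⟨Set.sized_powersetCard _ _, ?_⟩, by simp⟩
    rintro s t - ⟨-, ht⟩
    simpa using ht
  | of_succ m hm ih =>
    obtain ⟨𝒞, h𝒞, hc⟩ := ih
    obtain ⟨M, hM, hmax⟩ := exists_max_image 𝒞 toColex (card_pos.1 (by omega))
    refine ⟨𝒞.erase M, ⟨?_, ?_⟩, by rw [card_erase_of_mem hM, hc]; rfl⟩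
    · exact h𝒞.1.mono (by simp)
    · intro s t hs ht
      rw [mem_erase] at hs ⊢
      refine ⟨?_, h𝒞.2 hs.2 ht⟩
      rintro rfl
      exact absurd (hmax s hs.2) (not_le.2 ht.1)

lemma isInitSeg_powersetCard_filter_lt {n : ℕ} (r a : ℕ) :
    IsInitSeg (powersetCard r {i : Fin n | (i : ℕ) < a}) r := by
  refine ⟨Set.sized_powersetCard _ _, ?_⟩
  simp_rw [mem_powersetCard]
  rintro A B hA ⟨hlt, hB⟩
  refine ⟨fun t ht => ?_, hB⟩
  have : toColex (image Fin.val B) < toColex (image Fin.val A) := by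
    rwa [toColex_image_lt_toColex_image Fin.val_strictMono]
  rw [mem_filter]
  refine ⟨mem_univ _, Colex.forall_lt_mono this.le ?_ t (mem_image.2 ⟨t, ht, rfl⟩)⟩
  simp_rw [mem_image]
  rintro _ ⟨x, hx, rfl⟩
  exact (mem_filter.1 (hA.1 hx)).2

lemma exists_choose_add_card_le_card_shadow_iterate {n r s a : ℕ} {𝒜 : Finset (Finset (Fin n))}
    (h𝒜 : (𝒜 : Set (Finset (Fin n))).Sized r) (hs : 1 ≤ s) (hsr : s ≤ r) (hra : r ≤ a)
    (han : a < n)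
    (hl : a.choose r ≤ #𝒜) (hu : #𝒜 ≤ (a + 1).choose r) :
    ∃ (Y : Finset (Fin n)) (D : Finset (Finset (Fin n))), #Y = a ∧ D ⊆ powersetCard (r - 1) Y ∧
      #D = #𝒜 - a.choose r ∧
      a.choose s + #{X ∈ powersetCard (s - 1) Y | ∃ Z ∈ D, X ⊆ Z} ≤ #(∂^[r - s] 𝒜) := by
  obtain ⟨𝒞, h𝒞, hc⟩ := exists_isInitSeg_card_eq (n := n) (r := r) (m := #𝒜)
    (hu.trans (Nat.choose_le_choose _ han))
  set Y : Finset (Fin n) := {i : Fin n | (i : ℕ) < a} with hY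
  have hcard : ∀ b ≤ n, #{i : Fin n | (i : ℕ) < b} = b := by
    intro b hb
    rw [Fin.card_filter_val_lt, min_eq_right hb]
  have hYc : #Y = a := hcard a han.le
  have hlow : powersetCard r Y ⊆ 𝒞 := by
    rcases h𝒞.total (isInitSeg_powersetCard_filter_lt r a) with h | h
    · exact (eq_of_subset_of_card_le h (by rw [card_powersetCard, hYc]; omega)).ge
    · exact h
  have hup : 𝒞 ⊆ powersetCard r {i : Fin n | (i : ℕ) < a + 1} := by
    rcases h𝒞.total (isInitSeg_powersetCard_filter_lt r (a + 1)) with h | h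
    · exact h
    · exact (eq_of_subset_of_card_le h (by rw [card_powersetCard, hcard (a + 1) han]; omega)).ge
  let e : Fin n := ⟨a, han⟩
  have heY : e ∉ Y := by simp [hY, e]
  have hle : ∀ B ∈ 𝒞 \ powersetCard r Y, e ∈ B ∧ B.erase e ⊆ Y ∧ #B = r := by
    intro B hB
    rw [mem_sdiff] at hB
    obtain ⟨h1, h2⟩ := mem_powersetCard.1 (hup hB.1)
    have h3 : B.erase e ⊆ Y := by
      intro x hx
      rw [mem_erase] at hx
      have := (mem_filter.1 (h1 hx.2)).2
      refine mem_filter.2 ⟨mem_univ _, ?_⟩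
      have : (x : ℕ) ≠ a := fun h => hx.1 (Fin.ext h)
      omega
    refine ⟨?_, h3, h2⟩
    by_contra he
    rw [erase_eq_of_notMem he] at h3
    exact hB.2 (mem_powersetCard.2 ⟨h3, h2⟩)
  refine ⟨Y, (𝒞 \ powersetCard r Y).image (·.erase e), hYc, ?_, ?_, ?_⟩
  · intro Z hZ
    obtain ⟨B, hB, rfl⟩ := mem_image.1 hZ
    obtain ⟨h1, h2, h3⟩ := hle B hB
    exact mem_powersetCard.2 ⟨h2, by rw [card_erase_of_mem h1, h3]⟩
  · rw [card_image_of_injOn, card_sdiff_of_subset hlow, card_powersetCard, hYc, hc]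
    intro B hB C hC hBC
    rw [← insert_erase (hle B hB).1, ← insert_erase (hle C hC).1]
    exact congrArg (insert e) hBC
  refine le_trans ?_ (iterated_kk h𝒜 hc.le h𝒞)
  rw [← hYc, ← card_powersetCard]
  set E := {X ∈ powersetCard (s - 1) Y | ∃ Z ∈ (𝒞 \ powersetCard r Y).image (·.erase e), X ⊆ Z}
    with hE
  have hEY : ∀ X ∈ E, e ∉ X := fun X hX he =>
    heY ((mem_powersetCard.1 (mem_filter.1 hX).1).1 he)
  have hEi : #(E.image (insert e)) = #E := by
    refine card_image_of_injOn fun X hX X' hX' h => ?_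
    rw [← erase_insert (hEY X hX), ← erase_insert (hEY X' hX')]
    exact congrArg (fun S => S.erase e) h
  rw [← hEi, ← card_union_of_disjoint]
  · refine card_le_card (union_subset (fun X hX => ?_) fun X' hX' => ?_)
    · rw [mem_powersetCard] at hX
      obtain ⟨Z, h1, h2, h3⟩ := exists_subsuperset_card_eq hX.1 (show #X ≤ r by omega)
        (by omega)
      exact mem_shadow_iterate_iff_exists_mem_card_add.2
        ⟨Z, hlow (mem_powersetCard.2 ⟨h2, h3⟩), h1, by omega⟩
    · obtain ⟨X, hX, rfl⟩ := mem_image.1 hX'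
      have heX := hEY X hX
      rw [hE, mem_filter, mem_powersetCard] at hX
      obtain ⟨⟨-, hXc⟩, Z, hZ, hXZ⟩ := hX
      obtain ⟨B, hB, rfl⟩ := mem_image.1 hZ
      obtain ⟨h1, h2, h3⟩ := hle B hB
      refine mem_shadow_iterate_iff_exists_mem_card_add.2
        ⟨B, (mem_sdiff.1 hB).1, insert_subset h1 (hXZ.trans (erase_subset _ _)), ?_⟩
      rw [card_insert_of_notMem heX]
      omega
  · rw [disjoint_left]
    intro X hX hX'
    obtain ⟨X, -, rfl⟩ := mem_image.1 hX'
    exact heY ((mem_powersetCard.1 hX).1 (mem_insert_self _ _))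

end KruskalKatona

/-- The normalized matching property between two levels of the Boolean lattice. -/
lemma card_mul_choose_le_card_mul_choose {α : Type*} [DecidableEq α] {Y : Finset α} {p q : ℕ}
    {D : Finset (Finset α)} (hpq : p ≤ q) (hD : D ⊆ powersetCard q Y) :
    #D * q.choose p ≤ #{X ∈ powersetCard p Y | ∃ Z ∈ D, X ⊆ Z} * (#Y - p).choose (q - p) := by
  refine card_mul_le_card_mul (fun Z X => X ⊆ Z) (fun Z hZ => ?_) fun X hX => ?_
  · obtain ⟨h1, h2⟩ := mem_powersetCard.1 (hD hZ)
    rw [← h2, ← card_powersetCard]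
    refine card_le_card fun X hX => ?_
    rw [mem_powersetCard] at hX
    simp only [bipartiteAbove, mem_filter, mem_powersetCard]
    exact ⟨⟨⟨hX.1.trans h1, hX.2⟩, Z, hZ, hX.1⟩, hX.1⟩
  · obtain ⟨h1, h2⟩ := mem_powersetCard.1 (mem_filter.1 hX).1
    have := card_powersetCard_filter_superset (k := q) h1 (by omega)
    rw [h2] at this
    rw [← this]
    refine card_le_card fun Z hZ => ?_
    simp only [bipartiteBelow, mem_filter] at hZ ⊢
    exact ⟨hD hZ.1, hZ.2⟩

lemma choose_lt_choose_of_lt_half {a t p : ℕ} (h : t < p) (hp : 2 * p ≤ a) :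
    a.choose t < a.choose p := by
  induction p, Nat.succ_le_of_lt h using Nat.le_induction with
  | base =>
    have h1 := Nat.choose_succ_right_eq a t
    have h2 : 0 < a.choose t := Nat.choose_pos (by omega)
    have h3 : t + 1 < a - t := by omega
    rw [Nat.succ_eq_add_one]
    nlinarith
  | succ q hq ih =>
    have h1 := Nat.choose_succ_right_eq a q
    have h2 := ih (by omega) (by omega)
    have h3 : q + 1 ≤ a - q := by omega
    nlinarith

lemma choose_lt_choose_of_lt_add {a p q : ℕ} (hpq : p < q) (ha : a < p + q) (hp : p ≤ a) :
    a.choose q < a.choose p := by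
  rcases lt_or_ge a q with hq | hq
  · rw [Nat.choose_eq_zero_of_lt hq]
    exact Nat.choose_pos hp
  rw [← Nat.choose_symm hq]
  rcases le_total (2 * p) a with h | h
  · exact choose_lt_choose_of_lt_half (by omega) h
  · rw [← Nat.choose_symm hp]
    exact choose_lt_choose_of_lt_half (by omega) (by omega)

lemma choose_le_choose_of_le_add {a p q : ℕ} (hpq : p ≤ q) (ha : a ≤ p + q) :
    a.choose q ≤ a.choose p := by
  rcases lt_or_ge a q with hq | hq
  · rw [Nat.choose_eq_zero_of_lt hq]
    exact Nat.zero_le _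
  rcases hpq.eq_or_lt with rfl | hpq
  · rfl
  rcases ha.eq_or_lt with rfl | ha
  · rw [Nat.choose_symm_add]
  · exact (choose_lt_choose_of_lt_add hpq ha (by omega)).le

lemma sum_range_choose_sub {N k : ℕ} (h : k ≤ N) :
    ∑ i ∈ range (k + 1), (N - i).choose (k - i) = (N + 1).choose k := by
  induction k generalizing N with
  | zero => simp
  | succ k ih =>
    obtain ⟨N, rfl⟩ : ∃ M, N = M + 1 := ⟨N - 1, by omega⟩
    rw [sum_range_succ', Nat.choose_succ_succ (N + 1) k, ← ih (by omega)]
    simp [Nat.add_sub_add_right, Nat.succ_eq_add_one]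

section Estimates

variable {k n : ℕ}

lemma choose_add_choose_le_choose_add {a : ℕ} (hk : 4 ≤ k) (hn : 2 * k < n)
    (ha : n - k + 2 ≤ a) (han : a ≤ n - 1) :
    (n - k + 1).choose k + a.choose (n - k) < a.choose k + (n - k + 1) := by
  induction a, ha using Nat.le_induction with
  | base =>
    have h1 := Nat.choose_succ_succ (n - k + 1) (k - 1)
    have h2 := Nat.choose_succ_succ (n - k + 1) (n - k - 1)
    have h3 := choose_lt_choose_of_lt_add (a := n - k + 1) (p := k - 1) (q := n - k - 1)
      (by omega) (by omega) (by omega)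
    have h4 := Nat.choose_succ_self_right (n - k)
    simp only [Nat.succ_eq_add_one, show k - 1 + 1 = k by omega,
      show n - k - 1 + 1 = n - k by omega, show n - k + 1 + 1 = n - k + 2 by omega] at h1 h2 h4
    omega
  | succ a ha ih =>
    have h1 := Nat.choose_succ_succ a (k - 1)
    have h2 := Nat.choose_succ_succ a (n - k - 1)
    have h3 := choose_le_choose_of_le_add (a := a) (p := k - 1) (q := n - k - 1)
      (by omega) (by omega)
    simp only [Nat.succ_eq_add_one, show k - 1 + 1 = k by omega,
      show n - k - 1 + 1 = n - k by omega] at h1 h2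
    have := ih (by omega)
    omega

lemma card_mul_choose_le_of_subset_powersetCard {α : Type*} [DecidableEq α] {Y : Finset α}
    {p q : ℕ} {D : Finset (Finset α)} (hpq : p ≤ q) (hq : q ≤ #Y) (hD : D ⊆ powersetCard q Y) :
    #D * (#Y).choose p ≤ #{X ∈ powersetCard p Y | ∃ Z ∈ D, X ⊆ Z} * (#Y).choose q := by
  have h1 := card_mul_choose_le_card_mul_choose hpq hD
  have h2 := Nat.choose_mul (n := #Y) (k := q) (s := p) hpq
  refine Nat.le_of_mul_le_mul_right (c := (#Y - p).choose (q - p)) ?_ (Nat.choose_pos (by omega))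
  calc _ = #D * q.choose p * (#Y).choose q := by rw [mul_assoc, ← h2]; ring
    _ ≤ _ := (Nat.mul_le_mul_right _ h1).trans_eq (by ring)

variable {F : Finset (Finset ℕ)}

lemma exists_sized_card_shadow_iterate_le (hn : 2 * k ≤ n) (hF : F ⊆ powersetCard k (Icc 1 n)) :
    ∃ 𝒜 : Finset (Finset (Fin n)), (𝒜 : Set (Finset (Fin n))).Sized (n - k) ∧ #𝒜 = #F ∧
      #(shadow^[n - k - k] 𝒜) ≤ #(avoiding (Icc 1 n) k F) := by
  let e : Fin n ↪ ℕ := ⟨fun i => i + 1, fun i j h => Fin.ext (by simpa using h)⟩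
  have he : ∀ i, e i = i + 1 := fun _ => rfl
  let φ : Finset ℕ → Finset (Fin n) := fun A => {i | e i ∉ A}
  have hφ : ∀ A, (φ A).map e = Icc 1 n \ A := by
    intro A
    ext x
    simp only [φ, mem_map, mem_filter, mem_univ, true_and, mem_sdiff, mem_Icc]
    constructor
    · rintro ⟨i, hi, rfl⟩
      have := he i
      exact ⟨⟨by omega, by omega⟩, hi⟩
    · rintro ⟨⟨h1, h2⟩, h3⟩
      have hx : e ⟨x - 1, by omega⟩ = x := Nat.sub_add_cancel h1
      exact ⟨_, by rwa [hx], hx⟩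
  have hmem : ∀ A ∈ F, A ⊆ Icc 1 n ∧ #A = k := fun A hA => mem_powersetCard.1 (hF hA)
  refine ⟨F.image φ, ?_, card_image_of_injOn fun A hA B hB h => ?_, ?_⟩
  · intro S hS
    obtain ⟨A, hA, rfl⟩ := mem_image.1 (mem_coe.1 hS)
    rw [← card_map e, hφ, card_sdiff_of_subset (hmem A hA).1, (hmem A hA).2]
    simp
  · have h1 : Icc 1 n \ A = Icc 1 n \ B := by
      rw [← hφ, ← hφ]
      exact congrArg (map e) h
    rw [← Finset.sdiff_sdiff_eq_self (hmem A hA).1, h1, Finset.sdiff_sdiff_eq_self (hmem B hB).1]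
  · rw [← card_map (mapEmbedding e).toEmbedding]
    refine card_le_card fun X' hX' => ?_
    obtain ⟨X, hX, rfl⟩ := mem_map.1 hX'
    obtain ⟨S, hS, hXS, hc⟩ := mem_shadow_iterate_iff_exists_mem_card_add.1 hX
    obtain ⟨A, hA, rfl⟩ := mem_image.1 hS
    have h1 : X.map e ⊆ Icc 1 n \ A := by rw [← hφ]; exact map_subset_map.2 hXS
    have h2 : #(φ A) = n - k := by
      rw [← card_map e, hφ, card_sdiff_of_subset (hmem A hA).1, (hmem A hA).2]
      simp
    rw [subset_sdiff] at h1
    simp only [avoiding, mem_filter, mem_powersetCard, RelEmbedding.coe_toEmbedding,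
      mapEmbedding_apply, card_map]
    exact ⟨⟨h1.1, by omega⟩, A, hA, h1.2.symm⟩

lemma choose_le_card_avoiding (hk : 1 ≤ k) (hn : 2 * k ≤ n) (hF : F ⊆ powersetCard k (Icc 1 n))
    (h : (n - 1).choose (k - 1) ≤ #F) : (n - 1).choose k ≤ #(avoiding (Icc 1 n) k F) := by
  obtain ⟨𝒜, h1, h2, h3⟩ := exists_sized_card_shadow_iterate_le hn hF
  refine le_trans ?_ h3
  have := kruskal_katona_lovasz_form (i := n - k - k) (r := n - k) (k := n - 1) (by omega)
    (by omega) (by omega) h1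
    (by rwa [h2, Nat.choose_symm_of_eq_add (show n - 1 = (n - k) + (k - 1) by omega)])
  rwa [show n - k - (n - k - k) = k by omega] at this

lemma choose_add_card_lt_card_avoiding (hk : 4 ≤ k) (hn : 2 * k < n)
    (hF : F ⊆ powersetCard k (Icc 1 n)) (hl : n - k + 1 < #F) (hu : #F ≤ (n - 1).choose (k - 1)) :
    (n - k + 1).choose k + #F < #(avoiding (Icc 1 n) k F) + (n - k + 1) := by
  obtain ⟨𝒜, h1, h2, h3⟩ := exists_sized_card_shadow_iterate_le hn.le hF
  rw [Nat.choose_symm_of_eq_add (show n - 1 = (k - 1) + (n - k) by omega)] at hu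
  have hex : ∃ b : ℕ, #F ≤ b.choose (n - k) := ⟨_, hu⟩
  have hb := Nat.find_spec hex
  have hbn := Nat.find_min' hex hu
  have hbr : n - k + 2 ≤ Nat.find hex := by
    by_contra hlt
    have := hb.trans (Nat.choose_le_choose (n - k) (show Nat.find hex ≤ n - k + 1 by omega))
    rw [Nat.choose_succ_self_right] at this
    omega
  obtain ⟨a, ha⟩ : ∃ a, Nat.find hex = a + 1 := ⟨Nat.find hex - 1, by omega⟩
  have hal := Nat.find_min hex (m := a) (by omega)
  rw [ha] at hb hbn hbr
  obtain ⟨Y, D, hY, hD, hDc, hsh⟩ := exists_choose_add_card_le_card_shadow_iterate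
    (s := k) (a := a) h1 (by omega) (by omega) (by omega) (by omega) (by omega) (by omega)
  have hm := card_mul_choose_le_of_subset_powersetCard (p := k - 1) (by omega) (by omega) hD
  rw [hY] at hm
  set E := #{X ∈ powersetCard (k - 1) Y | ∃ Z ∈ D, X ⊆ Z}
  have hpos : 0 < a.choose (n - k - 1) := Nat.choose_pos (by omega)
  have hDpos : 0 < #D := by omega
  rcases (show n - k + 1 ≤ a by omega).eq_or_lt with rfl | har
  · have h4 := choose_lt_choose_of_lt_add (a := n - k + 1) (p := k - 1) (q := n - k - 1)
      (by omega) (by omega) (by omega)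
    have h5 : #D < E := by
      by_contra hle
      nlinarith
    have h6 := Nat.choose_succ_self_right (n - k)
    omega
  · have h4 := choose_le_choose_of_le_add (a := a) (p := k - 1) (q := n - k - 1)
      (by omega) (by omega)
    have h5 : #D ≤ E := by
      by_contra hle
      nlinarith
    have h6 := choose_add_choose_le_choose_add hk hn har (by omega)
    omega

lemma choose_add_le_sum_range (hk : 4 ≤ k) (hn : 2 * k < n) {p : ℕ} (hp : 3 ≤ p)
    (hpk : p ≤ k + 1) :
    (n - k).choose k + (n - k - 1).choose (k - 1) + (n - k - 2).choose (k - 2) + p ≤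
        ∑ i ∈ range p, (n - k - i).choose (k - i) + 3 ∧
      (p ≠ 3 → (n - k).choose k + (n - k - 1).choose (k - 1) + (n - k - 2).choose (k - 2) + p <
        ∑ i ∈ range p, (n - k - i).choose (k - i) + 3) := by
  induction p, hp using Nat.le_induction with
  | base => simp [sum_range_succ]
  | succ p hp ih =>
    obtain ⟨ih, ih'⟩ := ih (by omega)
    have h1 : 0 < (n - k - p).choose (k - p) := Nat.choose_pos (by omega)
    rw [sum_range_succ]
    refine ⟨by omega, fun _ => ?_⟩
    rcases hp.eq_or_lt with rfl | hp
    · have := choose_lt_choose_of_lt_add (a := n - k - 3) (p := k - 3) (q := n - k - 3)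
        (by omega) (by omega) (by omega)
      rw [Nat.choose_self] at this
      omega
    · have := ih' hp.ne'
      omega

lemma choose_add_le_choose (hk : 4 ≤ k) (hn : 2 * k < n) :
    (n - k).choose k + (n - k - 1).choose (k - 1) + (n - k - 2).choose (k - 2) + (n - k + 1) ≤
        (n - k + 1).choose k + 3 ∧
      (k ≠ 4 → (n - k).choose k + (n - k - 1).choose (k - 1) + (n - k - 2).choose (k - 2) +
        (n - k + 1) < (n - k + 1).choose k + 3) := by
  obtain ⟨M, hM⟩ : ∃ M, n - k = M + 2 := ⟨n - k - 2, by omega⟩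
  obtain ⟨j, rfl⟩ : ∃ j, k = j + 3 := ⟨k - 3, by omega⟩
  rw [hM]
  simp only [show M + 2 - 1 = M + 1 by omega, show M + 2 - 2 = M by omega,
    show j + 3 - 1 = j + 2 by omega, show j + 3 - 2 = j + 1 by omega]
  have h1 := Nat.choose_succ_succ (M + 2) (j + 2)
  have h2 := Nat.choose_succ_succ (M + 1) (j + 1)
  have h3 := Nat.choose_succ_succ M j
  simp only [Nat.succ_eq_add_one, add_assoc, Nat.reduceAdd] at h1 h2 h3 ⊢
  by_cases hj : j = 1
  · subst hj
    simp at *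
    omega
  · have := choose_lt_choose_of_lt_add (a := M) (p := j) (q := M - 1)
      (by omega) (by omega) (by omega)
    rw [← Nat.choose_symm_of_eq_add (show M = 1 + (M - 1) by omega), Nat.choose_one_right] at this
    omega

lemma card_avoiding_estimate (hk : 4 ≤ k) (hn : 2 * k < n) (hF : F ⊆ powersetCard k (Icc 1 n))
    (hl : 3 ≤ #F) (hu : #F ≤ (n - 1).choose (k - 1)) :
    (n - k).choose k + (n - k - 1).choose (k - 1) + (n - k - 2).choose (k - 2) + #F ≤
        #(avoiding (Icc 1 n) k F) + 3 ∧
      ((n - k).choose k + (n - k - 1).choose (k - 1) + (n - k - 2).choose (k - 2) + #F =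
        #(avoiding (Icc 1 n) k F) + 3 →
      (#F = 3 ∨ k = 4 ∧ #F = n - 3) ∧ ∃ K, #K = k - 1 ∧ ∀ A ∈ F, K ⊆ A) := by
  have hU : #(Icc 1 n) = n := by simp
  have hker := exists_common_subset_of_card_avoiding_le (k := k) (by omega) (by omega) hF hl
  have hs : ∀ p ≤ #F, p ≤ k + 1 → _ := fun p => card_avoiding_add_sum_le (U := Icc 1 n) (k := k)
    (F₀ := ∅) (by omega) hF (by simp) (p := p) (by simp)
  simp only [card_empty, hU, Nat.Ico_zero_eq_range] at hs
  rw [hU] at hker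
  rcases le_or_gt #F (k + 1) with h1 | h1
  · have h2 := hs _ le_rfl h1
    obtain ⟨h3, h4⟩ := choose_add_le_sum_range hk hn hl h1
    refine ⟨by omega, fun h => ?_⟩
    have h5 : #F = 3 := by
      by_contra hne
      have := h4 hne
      omega
    refine ⟨Or.inl h5, hker ?_⟩
    rw [min_eq_left h1]
    omega
  have h2 := hs _ h1.le le_rfl
  rw [sum_range_choose_sub (by omega)] at h2
  obtain ⟨h3, h4⟩ := choose_add_le_choose hk hn
  rcases le_or_gt #F (n - k + 1) with h5 | h5
  · refine ⟨by omega, fun h => ?_⟩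
    have h6 : k = 4 := by
      by_contra hne
      have := h4 hne
      omega
    refine ⟨Or.inr ⟨h6, by omega⟩, hker ?_⟩
    rw [min_eq_right h1.le, sum_range_choose_sub (by omega)]
    omega
  · have := choose_add_card_lt_card_avoiding hk hn hF h5 hu
    omega

end Estimates

section Permutations

variable {n : ℕ}

lemma exists_perm_eq_idxOf {l : List ℕ} (hl : l.Nodup) (h : ∀ x ∈ l, x ∈ Icc 1 n) :
    ∃ σ : Equiv.Perm ℕ, (∀ x ∈ Icc 1 n, σ x ∈ Icc 1 n) ∧ ∀ x ∈ l, σ x = l.idxOf x + 1 := by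
  have hlen : l.length ≤ n := by
    rw [← List.toFinset_card_of_nodup hl]
    refine (card_le_card (t := Icc 1 n) fun x hx => h x (List.mem_toFinset.1 hx)).trans ?_
    simp
  have hcard := Fintype.card_coe (Icc 1 n)
  obtain ⟨g, hg⟩ := Finset.exists_equiv_extend_of_card_eq hcard (s := {x | x.1 ∈ l})
    (f := fun x => l.idxOf x.1 + 1)
    (by
      intro y hy
      obtain ⟨x, hx, rfl⟩ := mem_image.1 hy
      have := List.idxOf_lt_length_of_mem (mem_filter.1 hx).2
      rw [mem_Icc]
      omega)
    (by
      intro x hx y hy hxy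
      exact Subtype.ext ((List.idxOf_inj (mem_filter.1 hx).2).1 (Nat.succ_injective hxy)))
  refine ⟨Equiv.Perm.ofSubtype g, fun x hx => ?_, fun x hx => ?_⟩
  · rw [Equiv.Perm.ofSubtype_apply_of_mem g hx]
    exact (g ⟨x, hx⟩).2
  · rw [Equiv.Perm.ofSubtype_apply_of_mem g (h x hx)]
    exact hg ⟨x, h x hx⟩ (mem_filter.2 ⟨mem_univ _, hx⟩)

variable {k : ℕ} {σ : Equiv.Perm ℕ} {F G : Finset (Finset ℕ)}

lemma image_Icc_eq_of_mapsTo (hσ : ∀ x ∈ Icc 1 n, σ x ∈ Icc 1 n) :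
    (Icc 1 n).image (fun x => σ x) = Icc 1 n :=
  eq_of_subset_of_card_le (image_subset_iff.2 hσ) (card_image_of_injective _ σ.injective).ge

lemma card_image_image_perm (F : Finset (Finset ℕ)) (σ : Equiv.Perm ℕ) :
    #(F.image fun s => s.image fun x => σ x) = #F :=
  card_image_of_injective _ (image_injective σ.injective)

lemma image_filter_inter_nonempty (hσ : ∀ x ∈ Icc 1 n, σ x ∈ Icc 1 n) :
    ({B ∈ powersetCard k (Icc 1 n) | ∀ A ∈ F, (A ∩ B).Nonempty}.image
        fun s => s.image fun x => σ x) =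
      {B ∈ powersetCard k (Icc 1 n) |
        ∀ A ∈ F.image (fun s => s.image fun x => σ x), (A ∩ B).Nonempty} := by
  have hinj : Function.Injective fun x => σ x := σ.injective
  ext B
  simp only [mem_image, mem_filter, mem_powersetCard, forall_exists_index, and_imp,
    forall_apply_eq_imp_iff₂]
  constructor
  · rintro ⟨C, ⟨⟨h1, h2⟩, h3⟩, rfl⟩
    refine ⟨⟨?_, by rw [card_image_of_injective _ hinj, h2]⟩, fun A hA => ?_⟩
    · rw [← image_Icc_eq_of_mapsTo hσ]
      exact image_subset_image h1
    · rw [← image_inter _ _ hinj]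
      exact (h3 A hA).image _
  · rintro ⟨⟨h1, h2⟩, h3⟩
    have hB : (B.image σ.symm).image (fun x => σ x) = B := by simp [image_image]
    refine ⟨B.image σ.symm, ⟨⟨?_, by rw [card_image_of_injective _ σ.symm.injective, h2]⟩,
      fun A hA => ?_⟩, hB⟩
    · rw [← image_subset_image_iff hinj, hB, image_Icc_eq_of_mapsTo hσ]
      exact h1
    · have := h3 A hA
      rwa [← hB, ← image_inter _ _ hinj, image_nonempty] at this

lemma image_eq_Icc_of_idxOf {K : Finset ℕ} {l : List ℕ}
    (hσ : ∀ x ∈ K.toList ++ l, σ x = (K.toList ++ l).idxOf x + 1) :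
    K.image (fun x => σ x) = Icc 1 #K := by
  refine eq_of_subset_of_card_le (image_subset_iff.2 fun x hx => ?_) ?_
  · have hx' : x ∈ K.toList := mem_toList.2 hx
    have h := List.idxOf_lt_length_of_mem hx'
    rw [hσ x (List.mem_append_left _ hx'), List.idxOf_append_of_mem hx', mem_Icc]
    rw [length_toList] at h
    omega
  · rw [card_image_of_injective _ (show Function.Injective fun x => σ x from σ.injective)]
    simp

lemma eq_image_insert_of_common_subset {U K : Finset ℕ} (hk : 1 ≤ k) (hF : F ⊆ powersetCard k U)
    (hF2 : 2 ≤ #F) (hK : #K = k - 1) (hKF : ∀ A ∈ F, K ⊆ A) :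
    K ⊆ U ∧ ∃ X ⊆ U \ K, #X = #F ∧ F = X.image fun x => insert x K := by
  obtain ⟨A₀, hA₀⟩ := card_pos.1 (show 0 < #F by omega)
  refine ⟨(hKF _ hA₀).trans (mem_powersetCard.1 (hF hA₀)).1, ?_⟩
  set X := {x ∈ U \ K | insert x K ∈ F} with hX
  have hFX : F = X.image fun x => insert x K := by
    ext A
    constructor
    · intro hA
      obtain ⟨h1, h2⟩ := mem_powersetCard.1 (hF hA)
      obtain ⟨x, hx⟩ := card_eq_one.1 (show #(A \ K) = 1 by
        rw [card_sdiff_of_subset (hKF A hA)]; omega)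
      have hxA : x ∈ A \ K := by simp [hx]
      have hA' : insert x K = A := by
        rw [insert_eq, ← hx, sdiff_union_of_subset (hKF A hA)]
      refine mem_image.2 ⟨x, mem_filter.2 ⟨sdiff_subset_sdiff h1 le_rfl hxA, ?_⟩, hA'⟩
      rwa [hA']
    · intro hA
      obtain ⟨x, hx, rfl⟩ := mem_image.1 hA
      exact (mem_filter.1 hx).2
  refine ⟨X, filter_subset _ _, ?_, hFX⟩
  conv_rhs => rw [hFX]
  refine (card_image_of_injOn fun x hx y hy hxy => ?_).symm
  have hx' := (mem_sdiff.1 (mem_filter.1 hx).1).2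
  have : x ∈ insert y K := by
    rw [← show insert x K = insert y K from hxy]
    exact mem_insert_self _ _
  exact (mem_insert.1 this).resolve_right hx'

lemma image_image_insert (X K : Finset ℕ) (σ : Equiv.Perm ℕ) :
    ((X.image fun x => insert x K).image fun s => s.image fun x => σ x) =
      (X.image fun x => σ x).image fun x => insert x (K.image fun x => σ x) := by
  simp only [image_image, Function.comp_def, image_insert]

lemma card_le_card_avoiding_two_mul (hF : F ⊆ powersetCard k (Icc 1 (2 * k))) :
    #F ≤ #(avoiding (Icc 1 (2 * k)) k F) := by
  have hmem : ∀ A ∈ F, A ⊆ Icc 1 (2 * k) ∧ #A = k := fun A hA => mem_powersetCard.1 (hF hA)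
  refine card_le_card_of_injOn (fun A => Icc 1 (2 * k) \ A) (fun A hA => ?_)
    fun A hA B hB h => ?_
  · refine mem_filter.2 ⟨mem_powersetCard.2 ⟨sdiff_subset, ?_⟩, A, hA, disjoint_sdiff⟩
    rw [card_sdiff_of_subset (hmem A hA).1, (hmem A hA).2, Nat.card_Icc]
    omega
  · rw [← Finset.sdiff_sdiff_eq_self (hmem A hA).1, ← Finset.sdiff_sdiff_eq_self (hmem B hB).1]
    exact congrArg (Icc 1 (2 * k) \ ·) h

end Permutations

section Extremal

variable {k n : ℕ}

lemma filter_sunflower_eq (hk : 1 ≤ k) (n : ℕ) {F : Finset (Finset ℕ)}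
    (hF : F = {insert k (Icc 1 (k - 1)), insert (k + 1) (Icc 1 (k - 1)),
      insert (k + 2) (Icc 1 (k - 1))}) :
    {B ∈ powersetCard k (Icc 1 n) | ∀ A ∈ F, (A ∩ B).Nonempty} =
      {B ∈ powersetCard k (Icc 1 n) |
        ∀ i ∈ Icc 1 3, (B ∩ insert (k - 1 + i) (Icc 1 (k - 1))).Nonempty} := by
  subst hF
  have h3 : Icc 1 3 = ({1, 2, 3} : Finset ℕ) := rfl
  refine filter_congr fun B _ => ?_
  simp only [inter_comm B, h3, mem_insert, mem_singleton, forall_eq_or_imp, forall_eq,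
    show k - 1 + 1 = k by omega, show k - 1 + 2 = k + 1 by omega, show k - 1 + 3 = k + 2 by omega]

lemma filter_full_sunflower_eq (hn : 8 < n) {F : Finset (Finset ℕ)}
    (hF : F = (Icc 4 n).image fun i => insert i (Icc 1 3)) :
    {B ∈ powersetCard 4 (Icc 1 n) | ∀ A ∈ F, (A ∩ B).Nonempty} =
      {B ∈ powersetCard 4 (Icc 1 n) | (B ∩ Icc 1 3).Nonempty} := by
  subst hF
  refine filter_congr fun B hB => ?_
  rw [mem_powersetCard] at hB
  simp only [mem_image, forall_exists_index, and_imp, forall_apply_eq_imp_iff₂]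
  constructor
  · intro h
    by_contra hne
    rw [not_nonempty_iff_eq_empty, ← disjoint_iff_inter_eq_empty] at hne
    have h1 : Icc 4 n ⊆ B := by
      intro i hi
      obtain ⟨x, hx⟩ := h i hi
      rw [mem_inter, mem_insert] at hx
      rcases hx.1 with rfl | h'
      · exact hx.2
      · exact absurd h' (disjoint_left.1 hne hx.2)
    have := card_le_card h1
    simp at this
    omega
  · rintro ⟨x, hx⟩ i -
    rw [mem_inter] at hx
    exact ⟨x, mem_inter.2 ⟨mem_insert_of_mem hx.2, hx.1⟩⟩

lemma choose_le_card_filter_sunflower (hk : 2 ≤ k) (n : ℕ) :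
    n.choose k ≤ #{B ∈ powersetCard k (Icc 1 n) |
        ∀ i ∈ Icc 1 3, (B ∩ insert (k - 1 + i) (Icc 1 (k - 1))).Nonempty} +
      ((n - k).choose k + (n - k - 1).choose (k - 1) + (n - k - 2).choose (k - 2)) := by
  have h0 : ∀ m, #(Icc (m + 1) n) = n - m := by intro m; simp
  have h1 : #(powersetCard k (Icc (k + 1) n)) = (n - k).choose k := by rw [card_powersetCard, h0]
  have h2 : #((powersetCard (k - 1) (Icc (k + 1 + 1) n)).image (insert k)) ≤
      (n - k - 1).choose (k - 1) := by
    refine card_image_le.trans ?_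
    rw [card_powersetCard, h0]
    rfl
  have h3 : #((powersetCard (k - 2) (Icc (k + 2 + 1) n)).image fun B => insert k (insert (k + 1) B))
      ≤ (n - k - 2).choose (k - 2) := by
    refine card_image_le.trans ?_
    rw [card_powersetCard, h0]
    rfl
  have h4 : n.choose k = #(powersetCard k (Icc 1 n)) := by simp
  rw [h4]
  refine le_trans (card_le_card ?_) ((card_union_le _ _).trans (Nat.add_le_add_left
    ((card_union_le _ _).trans (add_le_add ((card_union_le _ _).trans (add_le_add h1.le h2)) h3))
    _))
  intro B hB
  by_cases hall : ∀ i ∈ Icc 1 3, (B ∩ insert (k - 1 + i) (Icc 1 (k - 1))).Nonempty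
  · exact mem_union_left _ (mem_filter.2 ⟨hB, hall⟩)
  refine mem_union_right _ ?_
  push Not at hall
  obtain ⟨i, hi, hBi⟩ := hall
  rw [mem_powersetCard] at hB
  obtain ⟨hBn, hBk⟩ := hB
  have hB1 : ∀ x ∈ B, k ≤ x ∧ x ≤ n ∧ x ≠ k - 1 + i := by
    intro x hx
    have hxn := mem_Icc.1 (hBn hx)
    have hx' : x ∉ insert (k - 1 + i) (Icc 1 (k - 1)) := fun h =>
      notMem_empty x (hBi ▸ mem_inter.2 ⟨hx, h⟩)
    rw [mem_insert, mem_Icc] at hx'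
    omega
  have hi' := mem_Icc.1 hi
  simp only [mem_union, mem_image, mem_powersetCard]
  by_cases hkB : k ∈ B
  · by_cases hkB' : k + 1 ∈ B
    · right
      have hmem : k + 1 ∈ B.erase k := mem_erase.2 ⟨by omega, hkB'⟩
      have := hB1 k hkB
      have := hB1 _ hkB'
      refine ⟨(B.erase k).erase (k + 1), ⟨fun x hx => ?_, ?_⟩, ?_⟩
      · simp only [mem_erase] at hx
        have := hB1 x hx.2.2
        rw [mem_Icc]
        omega
      · rw [card_erase_of_mem hmem, card_erase_of_mem hkB, hBk]
        rfl
      · rw [insert_erase hmem, insert_erase hkB]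
    · left; right
      refine ⟨B.erase k, ⟨fun x hx => ?_, by rw [card_erase_of_mem hkB, hBk]⟩, insert_erase hkB⟩
      rw [mem_erase] at hx
      have := hB1 x hx.2
      have : x ≠ k + 1 := fun h => hkB' (h ▸ hx.2)
      rw [mem_Icc]
      omega
  · left; left
    refine ⟨fun x hx => ?_, hBk⟩
    have := hB1 x hx
    have : x ≠ k := fun h => hkB (h ▸ hx)
    rw [mem_Icc]
    omega

lemma choose_le_card_filter_inter_Icc (hn : 8 < n) :
    n.choose 4 + 3 ≤ #{B ∈ powersetCard 4 (Icc 1 n) | (B ∩ Icc 1 3).Nonempty} +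
      ((n - 4).choose 4 + (n - 4 - 1).choose (4 - 1) + (n - 4 - 2).choose (4 - 2)) +
      (n - 3) := by
  obtain ⟨m, rfl⟩ : ∃ m, n = m + 6 := ⟨n - 6, by omega⟩
  have h1 : #{B ∈ powersetCard 4 (Icc 1 (m + 6)) | ¬ (B ∩ Icc 1 3).Nonempty} ≤
      (m + 3).choose 4 := by
    have h2 : #(powersetCard 4 (Icc 4 (m + 6))) = (m + 3).choose 4 := by simp
    rw [← h2]
    refine card_le_card fun B hB => ?_
    rw [mem_filter, mem_powersetCard, not_nonempty_iff_eq_empty,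
      ← disjoint_iff_inter_eq_empty] at hB
    refine mem_powersetCard.2 ⟨fun x hx => ?_, hB.1.2⟩
    have h3 := hB.1.1 hx
    have h4 := disjoint_left.1 hB.2 hx
    rw [mem_Icc] at h3 h4 ⊢
    omega
  have h2 := card_filter_add_card_filter_not (s := powersetCard 4 (Icc 1 (m + 6)))
    (fun B => (B ∩ Icc 1 3).Nonempty)
  rw [card_powersetCard, Nat.card_Icc] at h2
  have h3 := Nat.choose_succ_succ (m + 2) 3
  have h4 := Nat.choose_succ_succ (m + 1) 2
  have h5 := Nat.choose_succ_succ m 1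
  simp only [Nat.succ_eq_add_one, Nat.reduceAdd, add_assoc, Nat.choose_one_right] at h3 h4 h5
  simp only [show m + 6 - 4 = m + 2 by omega, show m + 2 - 1 = m + 1 by omega,
    show m + 2 - 2 = m by omega, show m + 6 - 3 = m + 3 by omega,
    show m + 6 + 1 - 1 = m + 6 by omega, Nat.reduceSub] at h2 ⊢
  omega

end Extremal

/-- Let `k ≥ 4`, `n ≥ 2k`, and let `ℱ, 𝒢 ⊆ ([n] choose k)` be cross-intersecting
with `|𝒢| ≥ |ℱ| ≥ 3`.  Then
`|ℱ|+|𝒢| ≤ C(n,k) − C(n−k,k) − C(n−k−1,k−1) − C(n−k−2,k−2) + 3`, and for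
`n > 2k` equality holds iff, up to a permutation of `[n]`, `(ℱ,𝒢)` is one of the
two extremal configurations. -/
theorem stmt_13 (k n : ℕ) (hk : 4 ≤ k) (hn : 2 * k ≤ n)
    (F G : Finset (Finset ℕ))
    (hF : F ⊆ powersetCard k (Icc 1 n))
    (hG : G ⊆ powersetCard k (Icc 1 n))
    (hcross : ∀ A ∈ F, ∀ B ∈ G, (A ∩ B).Nonempty)
    (hFG : F.card ≤ G.card) (hF3 : 3 ≤ F.card) :
    ((F.card : ℤ) + G.card ≤
      (n.choose k : ℤ) - (n - k).choose k - (n - k - 1).choose (k - 1)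
        - (n - k - 2).choose (k - 2) + 3) ∧
    (2 * k < n →
      (((F.card : ℤ) + G.card =
        (n.choose k : ℤ) - (n - k).choose k - (n - k - 1).choose (k - 1)
          - (n - k - 2).choose (k - 2) + 3) ↔
      ∃ σ : Equiv.Perm ℕ, (∀ x ∈ Icc 1 n, σ x ∈ Icc 1 n) ∧
        ((F.image (fun s => s.image fun x => σ x) =
            {insert k (Icc 1 (k - 1)), insert (k + 1) (Icc 1 (k - 1)),
              insert (k + 2) (Icc 1 (k - 1))} ∧
          G.image (fun s => s.image fun x => σ x) =
            (powersetCard k (Icc 1 n)).filter fun B =>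
              ∀ i ∈ Icc 1 3, (B ∩ insert (k - 1 + i) (Icc 1 (k - 1))).Nonempty) ∨
         (k = 4 ∧
          F.image (fun s => s.image fun x => σ x) =
            (Icc 4 n).image (fun i => insert i (Icc 1 3)) ∧
          G.image (fun s => s.image fun x => σ x) =
            (powersetCard k (Icc 1 n)).filter fun B => (B ∩ Icc 1 3).Nonempty)))) := by
  have hcard : #(powersetCard k (Icc 1 n)) = n.choose k := by simp
  set H := {B ∈ powersetCard k (Icc 1 n) | ∀ A ∈ F, (A ∩ B).Nonempty} with hH
  have hGH : G ⊆ H := fun B hB => mem_filter.2 ⟨hG hB, fun A hA => hcross A hA B hB⟩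
  have hHN : #H + #(avoiding (Icc 1 n) k F) = n.choose k := by
    rw [← hcard, hH, avoiding, ← card_filter_add_card_filter_not (s := powersetCard k (Icc 1 n))
      (fun B => ∀ A ∈ F, (A ∩ B).Nonempty)]
    congr 2
    refine filter_congr fun B _ => ?_
    simp [disjoint_iff_inter_eq_empty]
  have hGc := card_le_card hGH
  rcases hn.eq_or_lt with rfl | hn
  · refine ⟨?_, fun h => absurd h (lt_irrefl _)⟩
    have hFN := card_le_card_avoiding_two_mul hF
    simp only [show 2 * k - k = k by omega, Nat.choose_self]
    omega
  have hu : #F ≤ (n - 1).choose (k - 1) := by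
    by_contra hlt
    have h1 := choose_le_card_avoiding (by omega) hn.le hF (by omega)
    have h2 := Nat.choose_succ_succ (n - 1) (k - 1)
    simp only [Nat.succ_eq_add_one, show n - 1 + 1 = n by omega,
      show k - 1 + 1 = k by omega] at h2
    omega
  obtain ⟨hle, heq⟩ := card_avoiding_estimate hk hn hF hF3 hu
  refine ⟨by omega, fun _ => ⟨fun h => ?_, ?_⟩⟩
  · have hGeq : G = H := eq_of_subset_of_card_le hGH (by omega)
    obtain ⟨hF3n, K, hK, hKF⟩ := heq (by omega)
    obtain ⟨hKU, X, hXU, hXc, hFX⟩ := eq_image_insert_of_common_subset (by omega) hF (by omega)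
      hK hKF
    rcases hF3n with hF3 | ⟨rfl, hFn⟩
    · obtain ⟨x, y, z, hxy, hxz, hyz, rfl⟩ := card_eq_three.1 (hXc.trans hF3)
      simp only [insert_subset_iff, singleton_subset_iff, mem_sdiff] at hXU
      obtain ⟨⟨hxU, hxK⟩, ⟨hyU, hyK⟩, hzU, hzK⟩ := hXU
      obtain ⟨σ, hσ, hσl⟩ := exists_perm_eq_idxOf (n := n) (l := K.toList ++ [x, y, z])
        (by
          rw [List.nodup_append']
          refine ⟨nodup_toList _, by simp [*], ?_⟩
          simp [*])
        (by
          intro w hw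
          simp only [List.mem_append, mem_toList, List.mem_cons, List.not_mem_nil, or_false] at hw
          rcases hw with hw | rfl | rfl | rfl
          · exact hKU hw
          all_goals assumption)
      have hKσ := image_eq_Icc_of_idxOf hσl
      have hx : σ x = k := by
        rw [hσl x (by simp), List.idxOf_append_of_notMem (by simpa using hxK)]
        simp [hK]
        omega
      have hy : σ y = k + 1 := by
        rw [hσl y (by simp), List.idxOf_append_of_notMem (by simpa using hyK)]
        simp [hK, hxy]
        omega
      have hz : σ z = k + 2 := by
        rw [hσl z (by simp), List.idxOf_append_of_notMem (by simpa using hzK)]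
        simp [hK, hxz, hyz]
        omega
      have hFσ : F.image (fun s => s.image fun x => σ x) =
          {insert k (Icc 1 (k - 1)), insert (k + 1) (Icc 1 (k - 1)),
            insert (k + 2) (Icc 1 (k - 1))} := by
        rw [hFX, image_image_insert, hKσ, hK]
        simp only [image_insert, image_singleton, hx, hy, hz]
      refine ⟨σ, hσ, Or.inl ⟨hFσ, ?_⟩⟩
      rw [hGeq, hH, image_filter_inter_nonempty hσ, filter_sunflower_eq (by omega) n hFσ]
    · have hX : X = Icc 1 n \ K := eq_of_subset_of_card_le hXU (by
        rw [card_sdiff_of_subset hKU, hK, hXc, hFn]; simp)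
      obtain ⟨σ, hσ, hσl⟩ := exists_perm_eq_idxOf (n := n) (l := K.toList ++ [])
        (by simpa using nodup_toList K) (fun w hw => hKU (by simpa using hw))
      have hKσ := image_eq_Icc_of_idxOf hσl
      have hFσ : F.image (fun s => s.image fun x => σ x) =
          (Icc 4 n).image (fun i => insert i (Icc 1 3)) := by
        rw [hFX, image_image_insert, hKσ, hK, hX, image_sdiff _ _ σ.injective,
          image_Icc_eq_of_mapsTo hσ, hKσ, hK]
        congr 1
        ext i
        simp only [mem_sdiff, mem_Icc]
        omega
      refine ⟨σ, hσ, Or.inr ⟨rfl, hFσ, ?_⟩⟩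
      rw [hGeq, hH, image_filter_inter_nonempty hσ, filter_full_sunflower_eq (by omega) hFσ]
  · rintro ⟨σ, hσ, ⟨-, hGσ⟩ | ⟨rfl, hFσ, hGσ⟩⟩
    · have h1 := choose_le_card_filter_sunflower (k := k) (by omega) n
      rw [← hGσ, card_image_image_perm] at h1
      omega
    · have h1 := choose_le_card_filter_inter_Icc (n := n) (by omega)
      rw [← hGσ, card_image_image_perm] at h1
      have h2 : #F = n - 3 := by
        rw [← card_image_image_perm F σ, hFσ, card_image_of_injOn, Nat.card_Icc]
        · omega
        · intro i hi j hj hij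
          have hi4 := (mem_Icc.1 (mem_coe.1 hi)).1
          have : i ∈ insert j (Icc 1 3) := by
            rw [← show insert i (Icc 1 3) = insert j (Icc 1 3) from hij]
            exact mem_insert_self _ _
          rw [mem_insert, mem_Icc] at this
          omega
      omega
end

section
/- Let n ≥ 6 be an integer. Let ℱ ⊆ ([n] choose 3) and 𝒢 ⊆ ([n] choose 2) be cross-intersecting families such that |ℱ| ≥ 2 and ℱ is 2-intersecting. If ℱ ∪ 𝒢 is not isomorphic to a subfamily of 𝒜 = {{1,2} ∪ {i} : i ∈ [3,n]} ∪ {G ∈ ([n] choose 2) : G ∩ {1,2} ≠ ∅}, then |ℱ| + |𝒢| ≤ C(n,2) − C(n−3,2) − C(n−4,1) + 2, with equality if and only if ℱ = {F₁, F₂} for some F₁, F₂ ∈ ([n] choose 3) with |F₁ ∩ F₂| = 2 and 𝒢 = {G ∈ ([n] choose 2) : G ∩ F₁ ≠ ∅ and G ∩ F₂ ≠ ∅}. -/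
open Finset

/-- `𝒜 = {{1,2} ∪ {i} : i ∈ [3,n]} ∪ {G ∈ ([n] choose 2) : G ∩ {1,2} ≠ ∅}`. -/
def Afam (n : ℕ) : Finset (Finset ℕ) :=
  ((Icc 3 n).image fun i => insert i (Icc 1 2))
    ∪ ((powersetCard 2 (Icc 1 n)).filter fun B => (B ∩ Icc 1 2).Nonempty)

/-- `𝒜` is isomorphic to a subfamily of `ℬ`. -/
def SubIsoTo (n : ℕ) (A B : Finset (Finset ℕ)) : Prop :=
  ∃ σ : Equiv.Perm ℕ, (∀ x ∈ Icc 1 n, σ x ∈ Icc 1 n) ∧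
    A.image (fun s => s.image fun x => σ x) ⊆ B

theorem choose_expression_eq_two_mul {n : ℕ} (hn : 6 ≤ n) :
    (n.choose 2 : ℤ) - (n - 3).choose 2 - (n - 4).choose 1 + 2 = 2 * n := by
  obtain ⟨m, rfl⟩ := Nat.exists_eq_add_of_le' hn
  have h3 : m + 6 - 3 = m + 3 := by omega
  have h4 : m + 6 - 4 = m + 2 := by omega
  rw [h3, h4]
  simp only [Nat.choose_succ_succ' _ 1, Nat.choose_one_right]
  push_cast
  ring

theorem card_inter_triple {A : Finset ℕ} {a b c : ℕ} (hab : a ≠ b) (hac : a ≠ c) (hbc : b ≠ c) :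
    (A ∩ {a, b, c}).card =
      (if a ∈ A then 1 else 0) + (if b ∈ A then 1 else 0) + (if c ∈ A then 1 else 0) := by
  rw [inter_comm, ← filter_mem_eq_inter, card_filter, sum_insert (by simp [hab, hac]),
    sum_insert (by simp [hbc]), sum_singleton, add_assoc]

theorem eq_triple {A : Finset ℕ} {a b c : ℕ} (hA : A.card = 3) (ha : a ∈ A) (hb : b ∈ A)
    (hc : c ∈ A) (hab : a ≠ b) (hac : a ≠ c) (hbc : b ≠ c) : A = {a, b, c} := by
  refine (eq_of_subset_of_card_le ?_ ?_).symm
  · simp [insert_subset_iff, ha, hb, hc]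
  · rw [hA, card_eq_three.2 ⟨a, b, c, hab, hac, hbc, rfl⟩]

theorem eq_pair {A : Finset ℕ} {a b : ℕ} (hA : A.card = 2) (ha : a ∈ A) (hb : b ∈ A)
    (hab : a ≠ b) : A = {a, b} := by
  refine (eq_of_subset_of_card_le ?_ ?_).symm
  · simp [insert_subset_iff, ha, hb]
  · rw [hA, card_pair hab]

theorem exists_triples {A B : Finset ℕ} (hA : A.card = 3) (hB : B.card = 3)
    (hAB : (A ∩ B).card = 2) :
    ∃ a b c d, a ≠ b ∧ a ≠ c ∧ a ≠ d ∧ b ≠ c ∧ b ≠ d ∧ c ≠ d ∧ A = {a, b, c} ∧ B = {a, b, d} := by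
  obtain ⟨a, b, hab, h⟩ := card_eq_two.1 hAB
  have h1 := card_sdiff_add_card_inter A B
  have h2 := card_sdiff_add_card_inter B A
  rw [inter_comm B A] at h2
  obtain ⟨c, hc⟩ : (A \ B).Nonempty := card_pos.1 (by omega)
  obtain ⟨d, hd⟩ : (B \ A).Nonempty := card_pos.1 (by omega)
  have ha : a ∈ A ∩ B := by simp [h]
  have hb : b ∈ A ∩ B := by simp [h]
  rw [mem_sdiff] at hc hd
  rw [mem_inter] at ha hb
  have hac : a ≠ c := fun e => hc.2 (e ▸ ha.2)
  have hbc : b ≠ c := fun e => hc.2 (e ▸ hb.2)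
  have had : a ≠ d := fun e => hd.2 (e ▸ ha.1)
  have hbd : b ≠ d := fun e => hd.2 (e ▸ hb.1)
  exact ⟨a, b, c, d, hab, hac, had, hbc, hbd, fun e => hc.2 (e ▸ hd.1),
    eq_triple hA ha.1 hb.1 hc.1 hab hac hbc, eq_triple hB ha.2 hb.2 hd.1 hab had hbd⟩

/-- The pairs inside `s` containing `a` number `s.card - 1`. -/
theorem card_pairs_mem {s : Finset ℕ} {a : ℕ} (ha : a ∈ s) :
    ((powersetCard 2 s).filter fun B => a ∈ B).card = s.card - 1 := by
  have h : ((powersetCard 2 s).filter fun B => a ∈ B) = (s.erase a).image fun x => {a, x} := by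
    ext B
    simp only [mem_filter, mem_powersetCard, mem_image, mem_erase]
    constructor
    · rintro ⟨⟨hs, h2⟩, haB⟩
      obtain ⟨x, hx, hxa⟩ := exists_mem_ne (by omega : 1 < B.card) a
      exact ⟨x, ⟨hxa, hs hx⟩, (eq_pair h2 haB hx hxa.symm).symm⟩
    · rintro ⟨x, ⟨hxa, hx⟩, rfl⟩
      exact ⟨⟨by simp [insert_subset_iff, ha, hx], card_pair hxa.symm⟩, by simp⟩
  rw [h, card_image_of_injOn, card_erase_of_mem ha]
  intro x hx y hy hxy
  simp only [coe_erase, Set.mem_sdiff, Set.mem_singleton_iff] at hx hy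
  have : x ∈ ({a, y} : Finset ℕ) := by
    rw [show ({a, y} : Finset ℕ) = {a, x} from hxy.symm]
    simp
  simpa [hx.2] using this

theorem card_pairs_meeting {n : ℕ} (hn : 6 ≤ n) {A B : Finset ℕ}
    (hA : A ∈ powersetCard 3 (Icc 1 n)) (hB : B ∈ powersetCard 3 (Icc 1 n))
    (hAB : (A ∩ B).card = 2) :
    ((powersetCard 2 (Icc 1 n)).filter fun P =>
      (P ∩ A).Nonempty ∧ (P ∩ B).Nonempty).card = 2 * n - 2 := by
  rw [mem_powersetCard] at hA hB
  obtain ⟨a, b, c, d, hab, hac, had, hbc, hbd, hcd, rfl, rfl⟩ := exists_triples hA.2 hB.2 hAB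
  have ha : a ∈ Icc 1 n := hA.1 (by simp)
  have hb : b ∈ Icc 1 n := hA.1 (by simp)
  have hc : c ∈ Icc 1 n := hA.1 (by simp)
  have hd : d ∈ Icc 1 n := hB.1 (by simp)
  have h : ((powersetCard 2 (Icc 1 n)).filter fun P =>
      (P ∩ {a, b, c}).Nonempty ∧ (P ∩ {a, b, d}).Nonempty) =
      insert {c, d} (((powersetCard 2 (Icc 1 n)).filter fun P => a ∈ P) ∪
        ((powersetCard 2 ((Icc 1 n).erase a)).filter fun P => b ∈ P)) := by
    ext P
    simp only [mem_filter, mem_insert, mem_union, mem_powersetCard, subset_erase]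
    constructor
    · rintro ⟨⟨hs, h2⟩, ⟨x, hx⟩, ⟨y, hy⟩⟩
      simp only [mem_inter, mem_insert, mem_singleton] at hx hy
      by_cases haP : a ∈ P
      · exact .inr (.inl ⟨⟨hs, h2⟩, haP⟩)
      by_cases hbP : b ∈ P
      · exact .inr (.inr ⟨⟨⟨hs, haP⟩, h2⟩, hbP⟩)
      have hcP : c ∈ P := by grind
      have hdP : d ∈ P := by grind
      exact .inl (eq_pair h2 hcP hdP hcd)
    · rintro (rfl | ⟨hP, haP⟩ | ⟨⟨⟨hP, -⟩, h2⟩, hbP⟩)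
      · exact ⟨⟨by simp only [insert_subset_iff, singleton_subset_iff]; exact ⟨hc, hd⟩,
          card_pair hcd⟩, ⟨c, by simp⟩, ⟨d, by simp⟩⟩
      · exact ⟨hP, ⟨a, by simp [haP]⟩, ⟨a, by simp [haP]⟩⟩
      · exact ⟨⟨hP, h2⟩, ⟨b, by simp [hbP]⟩, ⟨b, by simp [hbP]⟩⟩
  rw [h, card_insert_of_notMem (by simp [had, hac, hbc, hbd]), card_union_of_disjoint,
    card_pairs_mem ha, card_pairs_mem (by simp only [mem_erase]; exact ⟨hab.symm, hb⟩),
    card_erase_of_mem ha, Nat.card_Icc]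
  · omega
  · rw [disjoint_left]
    intro P h1 h2
    simp only [mem_filter, mem_powersetCard, subset_erase] at h1 h2
    exact h2.1.1.2 h1.2

theorem subIsoTo_Afam {n : ℕ} (hn : 6 ≤ n) {F G : Finset (Finset ℕ)} {a b : ℕ} (hab : a ≠ b)
    (ha : a ∈ Icc 1 n) (hb : b ∈ Icc 1 n)
    (hF : ∀ A ∈ F, A ∈ powersetCard 3 (Icc 1 n) ∧ a ∈ A ∧ b ∈ A)
    (hG : ∀ B ∈ G, B ∈ powersetCard 2 (Icc 1 n) ∧ (a ∈ B ∨ b ∈ B)) :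
    SubIsoTo n (F ∪ G) (Afam n) := by
  obtain ⟨σ, hσ, hσa, hσb⟩ : ∃ σ : Equiv.Perm ℕ, (∀ x ∈ Icc 1 n, σ x ∈ Icc 1 n) ∧
      σ a = 1 ∧ σ b = 2 := by
    refine ⟨(Equiv.swap 1 a).trans (Equiv.swap (Equiv.swap 1 a b) 2), ?_, ?_, ?_⟩
    all_goals simp only [mem_Icc, Equiv.trans_apply, Equiv.swap_apply_def] at *
    all_goals grind
  refine ⟨σ, hσ, ?_⟩
  intro T hT
  obtain ⟨S, hS, rfl⟩ := mem_image.1 hT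
  have hsub : S ⊆ Icc 1 n → S.image (fun x => σ x) ⊆ Icc 1 n := fun h => by
    intro y hy
    obtain ⟨x, hx, rfl⟩ := mem_image.1 hy
    exact hσ x (h hx)
  have h12 : Icc 1 2 = ({1, 2} : Finset ℕ) := rfl
  rw [Afam, mem_union, h12]
  rcases mem_union.1 hS with hS | hS
  · obtain ⟨h3, haS, hbS⟩ := hF S hS
    rw [mem_powersetCard] at h3
    left
    obtain ⟨x, hx, hxab⟩ := exists_mem_notMem_of_card_lt_card
      (s := {a, b}) (t := S) (by rw [card_pair hab]; omega)
    simp only [mem_insert, mem_singleton, not_or] at hxab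
    have hS3 := eq_triple h3.2 hx haS hbS hxab.1 hxab.2 hab
    have hx1 : σ x ≠ 1 := fun e => hxab.1 (σ.injective (e.trans hσa.symm))
    have hx2 : σ x ≠ 2 := fun e => hxab.2 (σ.injective (e.trans hσb.symm))
    have hxn := hσ x (h3.1 hx)
    rw [mem_Icc] at hxn
    exact mem_image.2 ⟨σ x, mem_Icc.2 (by omega), by simp [hS3, image_insert, hσa, hσb]⟩
  · obtain ⟨h2, hS2⟩ := hG S hS
    rw [mem_powersetCard] at h2
    right
    rw [mem_filter, mem_powersetCard, card_image_of_injective _ σ.injective]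
    refine ⟨⟨hsub h2.1, h2.2⟩, ?_⟩
    rcases hS2 with h | h
    · exact ⟨1, mem_inter.2 ⟨mem_image.2 ⟨a, h, hσa⟩, by simp⟩⟩
    · exact ⟨2, mem_inter.2 ⟨mem_image.2 ⟨b, h, hσb⟩, by simp⟩⟩

/-- Three distinct triples inside a four-element set force a small total size. -/
theorem card_add_card_lt_of_three_triples {n : ℕ} (hn : 6 ≤ n) {F G : Finset (Finset ℕ)}
    (hF : F ⊆ powersetCard 3 (Icc 1 n)) (hG : G ⊆ powersetCard 2 (Icc 1 n))
    (hcross : ∀ A ∈ F, ∀ B ∈ G, (A ∩ B).Nonempty)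
    (hint : ∀ A ∈ F, ∀ B ∈ F, 2 ≤ (A ∩ B).card)
    {a b c d : ℕ} (hab : a ≠ b) (hac : a ≠ c) (had : a ≠ d) (hbc : b ≠ c) (hbd : b ≠ d)
    (hcd : c ≠ d) (h1 : {a, b, c} ∈ F) (h2 : {a, b, d} ∈ F) (h3 : {a, c, d} ∈ F) :
    F.card + G.card < 2 * n := by
  have ha : a ∈ Icc 1 n := (mem_powersetCard.1 (hF h1)).1 (by simp)
  have hF4 : F ⊆ insert {b, c, d} {{a, b, c}, {a, b, d}, {a, c, d}} := by
    intro A hA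
    have hA3 := (mem_powersetCard.1 (hF hA)).2
    have e1 := hint A hA _ h1
    have e2 := hint A hA _ h2
    have e3 := hint A hA _ h3
    rw [card_inter_triple hab hac hbc] at e1
    rw [card_inter_triple hab had hbd] at e2
    rw [card_inter_triple hac had hcd] at e3
    simp only [mem_insert, mem_singleton]
    by_cases haA : a ∈ A
    · by_cases hbA : b ∈ A
      · by_cases hcA : c ∈ A
        · exact .inr (.inl (eq_triple hA3 haA hbA hcA hab hac hbc))
        · exact .inr (.inr (.inl (eq_triple hA3 haA hbA (by grind) hab had hbd)))
      · exact .inr (.inr (.inr (eq_triple hA3 haA (by grind) (by grind) hac had hcd)))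
    · exact .inl (eq_triple hA3 (by grind) (by grind) (by grind) hbc hbd hcd)
  have hGa : ∀ B ∈ G, a ∈ B ∨ B ∈ ({{b, c}, {b, d}, {c, d}} : Finset (Finset ℕ)) := by
    intro B hB
    have hB2 := (mem_powersetCard.1 (hG hB)).2
    obtain ⟨x, hx⟩ := hcross _ h1 B hB
    obtain ⟨y, hy⟩ := hcross _ h2 B hB
    obtain ⟨z, hz⟩ := hcross _ h3 B hB
    simp only [mem_inter, mem_insert, mem_singleton] at hx hy hz ⊢
    by_cases haB : a ∈ B
    · exact .inl haB
    right
    by_cases hbB : b ∈ B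
    · by_cases hcB : c ∈ B
      · exact .inl (eq_pair hB2 hbB hcB hbc)
      · exact .inr (.inl (eq_pair hB2 hbB (by grind) hbd))
    · exact .inr (.inr (eq_pair hB2 (by grind) (by grind) hcd))
  by_cases h4 : {b, c, d} ∈ F
  · have hG6 : G ⊆ powersetCard 2 {a, b, c, d} := by
      intro B hB
      have hB2 := (mem_powersetCard.1 (hG hB)).2
      refine mem_powersetCard.2 ⟨?_, hB2⟩
      rcases hGa B hB with haB | hB'
      · obtain ⟨x, hx⟩ := hcross _ h4 B hB
        simp only [mem_inter, mem_insert, mem_singleton] at hx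
        rw [eq_pair hB2 haB hx.2 (by grind)]
        grind
      · simp only [mem_insert, mem_singleton] at hB'
        rcases hB' with rfl | rfl | rfl <;> grind
    have hG' := card_le_card hG6
    rw [card_powersetCard] at hG'
    have h6 : (({a, b, c, d} : Finset ℕ).card).choose 2 ≤ Nat.choose 4 2 :=
      Nat.choose_le_choose 2 card_le_four
    have h7 : Nat.choose 4 2 = 6 := rfl
    have hF' := (card_le_card hF4).trans card_le_four
    omega
  · have hF' := (card_le_card ((subset_insert_iff_of_notMem h4).1 hF4)).trans card_le_three
    have hGs : G ⊆ ((powersetCard 2 (Icc 1 n)).filter fun B => a ∈ B) ∪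
        {{b, c}, {b, d}, {c, d}} := by
      intro B hB
      rcases hGa B hB with h | h
      · exact mem_union_left _ (mem_filter.2 ⟨hG hB, h⟩)
      · exact mem_union_right _ h
    have hG' := (card_le_card hGs).trans (card_union_le _ _)
    rw [card_pairs_mem ha, Nat.card_Icc] at hG'
    have : ({{b, c}, {b, d}, {c, d}} : Finset (Finset ℕ)).card ≤ 3 := card_le_three
    omega

theorem card_add_card_lt_of_three_le {n : ℕ} (hn : 6 ≤ n) {F G : Finset (Finset ℕ)}
    (hF : F ⊆ powersetCard 3 (Icc 1 n)) (hG : G ⊆ powersetCard 2 (Icc 1 n))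
    (hcross : ∀ A ∈ F, ∀ B ∈ G, (A ∩ B).Nonempty)
    (hint : ∀ A ∈ F, ∀ B ∈ F, 2 ≤ (A ∩ B).card)
    (hA : ¬ SubIsoTo n (F ∪ G) (Afam n))
    {a b c d : ℕ} (hab : a ≠ b) (hac : a ≠ c) (had : a ≠ d) (hbc : b ≠ c) (hbd : b ≠ d)
    (hcd : c ≠ d) (h1 : {a, b, c} ∈ F) (h2 : {a, b, d} ∈ F) (h3 : 3 ≤ F.card) :
    F.card + G.card < 2 * n := by
  by_cases hall : ∀ A ∈ F, a ∈ A ∧ b ∈ A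
  · obtain ⟨E, hE, hE'⟩ := exists_mem_notMem_of_card_lt_card
      (s := {{a, b, c}, {a, b, d}}) (t := F) (card_le_two.trans_lt h3)
    have hE3 := (mem_powersetCard.1 (hF hE)).2
    refine absurd (subIsoTo_Afam hn hab ((mem_powersetCard.1 (hF h1)).1 (by simp))
      ((mem_powersetCard.1 (hF h1)).1 (by simp)) (fun A h => ⟨hF h, hall A h⟩)
      fun B hB => ⟨hG hB, ?_⟩) hA
    by_contra! hB'
    have hB2 := (mem_powersetCard.1 (hG hB)).2
    obtain ⟨x, hx⟩ := hcross _ h1 B hB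
    obtain ⟨y, hy⟩ := hcross _ h2 B hB
    obtain ⟨z, hz⟩ := hcross _ hE B hB
    simp only [mem_inter, mem_insert, mem_singleton] at hx hy hz hE'
    have hBcd : B = {c, d} := eq_pair hB2 (by grind) (by grind) hcd
    rw [hBcd, mem_insert, mem_singleton] at hz
    rcases hz with ⟨hzE, rfl | rfl⟩
    · exact hE' (.inl (eq_triple hE3 (hall E hE).1 (hall E hE).2 hzE hab hac hbc))
    · exact hE' (.inr (eq_triple hE3 (hall E hE).1 (hall E hE).2 hzE hab had hbd))
  · push Not at hall
    obtain ⟨A, hAF, hAab⟩ := hall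
    have hA3 := (mem_powersetCard.1 (hF hAF)).2
    have e1 := hint A hAF _ h1
    have e2 := hint A hAF _ h2
    rw [card_inter_triple hab hac hbc] at e1
    rw [card_inter_triple hab had hbd] at e2
    by_cases haA : a ∈ A
    · have hbA := hAab haA
      have hAeq : A = {a, c, d} := eq_triple hA3 haA (by grind) (by grind) hac had hcd
      exact card_add_card_lt_of_three_triples hn hF hG hcross hint hab hac had hbc hbd hcd h1 h2
        (hAeq ▸ hAF)
    · have hAeq : A = {b, c, d} := eq_triple hA3 (by grind) (by grind) (by grind) hbc hbd hcd
      exact card_add_card_lt_of_three_triples hn hF hG hcross hint hab.symm hbc hbd hac had hcd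
        (insert_comm a b _ ▸ h1) (insert_comm a b _ ▸ h2) (hAeq ▸ hAF)

theorem stmt_14 (n : ℕ) (hn : 6 ≤ n)
    (F G : Finset (Finset ℕ))
    (hF : F ⊆ powersetCard 3 (Icc 1 n))
    (hG : G ⊆ powersetCard 2 (Icc 1 n))
    (hcross : ∀ A ∈ F, ∀ B ∈ G, (A ∩ B).Nonempty)
    (hF2 : 2 ≤ F.card)
    (hint : ∀ A ∈ F, ∀ B ∈ F, 2 ≤ (A ∩ B).card)
    (hA : ¬ SubIsoTo n (F ∪ G) (Afam n)) :
    ((F.card : ℤ) + G.card ≤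
      (n.choose 2 : ℤ) - (n - 3).choose 2 - (n - 4).choose 1 + 2) ∧
    (((F.card : ℤ) + G.card =
        (n.choose 2 : ℤ) - (n - 3).choose 2 - (n - 4).choose 1 + 2) ↔
      ∃ F₁ ∈ powersetCard 3 (Icc 1 n), ∃ F₂ ∈ powersetCard 3 (Icc 1 n),
        (F₁ ∩ F₂).card = 2 ∧ F = {F₁, F₂} ∧
        G = (powersetCard 2 (Icc 1 n)).filter fun B =>
          (B ∩ F₁).Nonempty ∧ (B ∩ F₂).Nonempty) := by
  have hcard : ∀ F₁ ∈ powersetCard 3 (Icc 1 n), ∀ F₂ ∈ powersetCard 3 (Icc 1 n),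
      (F₁ ∩ F₂).card = 2 → F₁ ≠ F₂ := by
    rintro F₁ h₁ F₂ - h rfl
    rw [inter_self, (mem_powersetCard.1 h₁).2] at h
    omega
  rw [choose_expression_eq_two_mul hn]
  have hle : F.card + G.card ≤ 2 * n ∧ (F.card + G.card = 2 * n →
      ∃ F₁ ∈ powersetCard 3 (Icc 1 n), ∃ F₂ ∈ powersetCard 3 (Icc 1 n),
        (F₁ ∩ F₂).card = 2 ∧ F = {F₁, F₂} ∧
        G = (powersetCard 2 (Icc 1 n)).filter fun B =>
          (B ∩ F₁).Nonempty ∧ (B ∩ F₂).Nonempty) := by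
    obtain ⟨F₁, h₁, F₂, h₂, hne⟩ := one_lt_card.1 hF2
    have c₁ := (mem_powersetCard.1 (hF h₁)).2
    have c₂ := (mem_powersetCard.1 (hF h₂)).2
    have hcap : (F₁ ∩ F₂).card = 2 := by
      refine le_antisymm ?_ (hint _ h₁ _ h₂)
      by_contra! h
      have e₁ := eq_of_subset_of_card_le (inter_subset_left : F₁ ∩ F₂ ⊆ F₁) (by omega)
      have e₂ := eq_of_subset_of_card_le (inter_subset_right : F₁ ∩ F₂ ⊆ F₂) (by omega)
      exact hne (e₁.symm.trans e₂)
    rcases hF2.eq_or_lt with h2 | h3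
    · have hFeq : F = {F₁, F₂} := by
        refine (eq_of_subset_of_card_le ?_ ?_).symm
        · simp [insert_subset_iff, h₁, h₂]
        · rw [card_pair hne, h2]
      have hGsub : G ⊆ (powersetCard 2 (Icc 1 n)).filter fun B =>
          (B ∩ F₁).Nonempty ∧ (B ∩ F₂).Nonempty := fun B hB => by
        rw [mem_filter, inter_comm B, inter_comm B]
        exact ⟨hG hB, hcross _ h₁ B hB, hcross _ h₂ B hB⟩
      have hm := card_pairs_meeting hn (hF h₁) (hF h₂) hcap
      have hGle := card_le_card hGsub
      refine ⟨by omega, fun h => ⟨F₁, hF h₁, F₂, hF h₂, hcap, hFeq, ?_⟩⟩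
      exact eq_of_subset_of_card_le hGsub (by omega)
    · obtain ⟨a, b, c, d, hab, hac, had, hbc, hbd, hcd, rfl, rfl⟩ := exists_triples c₁ c₂ hcap
      have := card_add_card_lt_of_three_le hn hF hG hcross hint hA hab hac had hbc hbd hcd
        h₁ h₂ h3
      exact ⟨this.le, fun h => absurd h this.ne⟩
  refine ⟨by exact_mod_cast hle.1, fun h => hle.2 (by exact_mod_cast h), ?_⟩
  rintro ⟨F₁, h₁, F₂, h₂, hcap, rfl, rfl⟩
  rw [card_pair (hcard _ h₁ _ h₂ hcap), card_pairs_meeting hn h₁ h₂ hcap]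
  omega
end

section
/- Let n ≥ 4 be an integer. Let ℱ ⊆ ([n] choose 2) and 𝒢 ⊆ ([n] choose 2) be cross-intersecting families with |𝒢| ≥ |ℱ| ≥ 2, and suppose ℱ ∪ 𝒢 is not isomorphic to a subfamily of ℬ = {{1} ∪ {i} : i ∈ [2,n]}. Then |ℱ| + |𝒢| ≤ C(n,2) − C(n−2,2) − C(n−3,1) + 2. Moreover, for n ≥ 5, equality holds if and only if ℱ = {F₁, F₂} for some F₁, F₂ ∈ ([n] choose 2) with |F₁ ∩ F₂| = 1 and 𝒢 = {G ∈ ([n] choose 2) : G ∩ F₁ ≠ ∅ and G ∩ F₂ ≠ ∅}. -/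
open Finset

/-- `ℬ = {{1} ∪ {i} : i ∈ [2,n]}`. -/
def Bfam (n : ℕ) : Finset (Finset ℕ) :=
  (Icc 2 n).image fun i => insert i {1}

lemma exists_pair_of_mem_powersetCard_two {s B : Finset ℕ} (h : B ∈ powersetCard 2 s) :
    ∃ x y, x ≠ y ∧ x ∈ s ∧ y ∈ s ∧ B = {x, y} := by
  obtain ⟨hs, hc⟩ := mem_powersetCard.1 h
  obtain ⟨x, y, hxy, rfl⟩ := card_eq_two.1 hc
  exact ⟨x, y, hxy, hs (by simp), hs (by simp), rfl⟩

lemma exists_pair_of_mem_of_mem_powersetCard_two {s B : Finset ℕ} {c : ℕ}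
    (h : B ∈ powersetCard 2 s) (hc : c ∈ B) : ∃ x, x ≠ c ∧ x ∈ s ∧ B = {c, x} := by
  obtain ⟨x, y, hxy, hx, hy, rfl⟩ := exists_pair_of_mem_powersetCard_two h
  rcases mem_insert.1 hc with rfl | hc
  · exact ⟨y, hxy.symm, hy, rfl⟩
  · rw [mem_singleton] at hc
    subst hc
    exact ⟨x, hxy, hx, pair_comm _ _⟩

lemma pair_inter_nonempty {x y : ℕ} {B : Finset ℕ} :
    ((({x, y} : Finset ℕ)) ∩ B).Nonempty ↔ x ∈ B ∨ y ∈ B := by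
  simp [Finset.Nonempty, mem_inter]

lemma eq_pair_of_mem_of_mem {s B : Finset ℕ} {x y : ℕ} (h : B ∈ powersetCard 2 s)
    (hx : x ∈ B) (hy : y ∈ B) (hxy : x ≠ y) : B = {x, y} := by
  refine (eq_of_subset_of_card_le ?_ ?_).symm
  · simp [insert_subset_iff, hx, hy]
  · rw [(mem_powersetCard.1 h).2, card_pair hxy]

lemma mem_of_three_not_mem {s B : Finset ℕ} {a b d : ℕ} (h : B ∈ powersetCard 2 s)
    (hab : a ≠ b) (had : a ≠ d) (hbd : b ≠ d) (ha : a ∈ B) (hb : b ∈ B) : d ∉ B := by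
  rw [eq_pair_of_mem_of_mem h ha hb hab]
  simp [had.symm, hbd.symm]

/-- A family of pairs meeting three pairs of a star consists of pairs through its centre. -/
lemma mem_of_cross_star {s : Finset ℕ} {H K : Finset (Finset ℕ)} {c : ℕ}
    (hH : H ⊆ powersetCard 2 s) (hK : K ⊆ powersetCard 2 s)
    (hcross : ∀ A ∈ H, ∀ B ∈ K, (A ∩ B).Nonempty) (h3 : 3 ≤ H.card)
    (hc : ∀ A ∈ H, c ∈ A) : ∀ B ∈ K, c ∈ B := by
  intro B hB
  by_contra hcB
  obtain ⟨X, hX, Y, hY, Z, hZ, hXY, hXZ, hYZ⟩ := two_lt_card.1 h3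
  obtain ⟨x, -, -, rfl⟩ := exists_pair_of_mem_of_mem_powersetCard_two (hH hX) (hc _ hX)
  obtain ⟨y, -, -, rfl⟩ := exists_pair_of_mem_of_mem_powersetCard_two (hH hY) (hc _ hY)
  obtain ⟨z, -, -, rfl⟩ := exists_pair_of_mem_of_mem_powersetCard_two (hH hZ) (hc _ hZ)
  have hx := (pair_inter_nonempty.1 (hcross _ hX _ hB)).resolve_left hcB
  have hy := (pair_inter_nonempty.1 (hcross _ hY _ hB)).resolve_left hcB
  have hz := (pair_inter_nonempty.1 (hcross _ hZ _ hB)).resolve_left hcB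
  exact mem_of_three_not_mem (hK hB) (by rintro rfl; exact hXY rfl) (by rintro rfl; exact hXZ rfl)
    (by rintro rfl; exact hYZ rfl) hx hy hz

lemma subIsoTo_Bfam_of_star {n c : ℕ} {A : Finset (Finset ℕ)} (hA : A ⊆ powersetCard 2 (Icc 1 n))
    (hn : 1 ≤ n) (hcn : c ∈ Icc 1 n) (hc : ∀ B ∈ A, c ∈ B) : SubIsoTo n A (Bfam n) := by
  have hσ : ∀ x ∈ Icc 1 n, Equiv.swap 1 c x ∈ Icc 1 n := by
    intro x hx
    rw [Equiv.swap_apply_def]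
    split_ifs
    · exact hcn
    · simpa using hn
    · exact hx
  refine ⟨Equiv.swap 1 c, hσ, ?_⟩
  intro S hS
  obtain ⟨B, hB, rfl⟩ := mem_image.1 hS
  obtain ⟨x, hxc, hx, rfl⟩ := exists_pair_of_mem_of_mem_powersetCard_two (hA hB) (hc _ hB)
  have h1 : Equiv.swap 1 c x ≠ 1 := by
    intro h
    apply hxc
    rw [← Equiv.swap_apply_right 1 c] at h
    exact (Equiv.swap 1 c).injective (by simpa using h)
  have h2 := mem_Icc.1 (hσ x hx)
  refine mem_image.2 ⟨Equiv.swap 1 c x, mem_Icc.2 ⟨by omega, h2.2⟩, ?_⟩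
  rw [image_insert, image_singleton, Equiv.swap_apply_right, pair_comm]

lemma card_filter_meet_cherry {s : Finset ℕ} {c a b : ℕ} (hc : c ∈ s) (ha : a ∈ s) (hb : b ∈ s)
    (hac : a ≠ c) (hbc : b ≠ c) (hab : a ≠ b) :
    ((powersetCard 2 s).filter fun B =>
      (B ∩ {c, a}).Nonempty ∧ (B ∩ {c, b}).Nonempty).card = s.card := by
  have key : ((powersetCard 2 s).filter fun B =>
      (B ∩ {c, a}).Nonempty ∧ (B ∩ {c, b}).Nonempty) =
      insert {a, b} ((s.erase c).image fun x => {c, x}) := by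
    ext B
    simp only [mem_filter, inter_comm B, pair_inter_nonempty, mem_insert, mem_image, mem_erase]
    constructor
    · rintro ⟨hB, h1, h2⟩
      by_cases hcB : c ∈ B
      · obtain ⟨x, hxc, hx, rfl⟩ := exists_pair_of_mem_of_mem_powersetCard_two hB hcB
        exact Or.inr ⟨x, ⟨hxc, hx⟩, rfl⟩
      · exact Or.inl (eq_pair_of_mem_of_mem hB (h1.resolve_left hcB) (h2.resolve_left hcB) hab)
    · rintro (rfl | ⟨x, ⟨hxc, hx⟩, rfl⟩)
      · simp [mem_powersetCard, insert_subset_iff, ha, hb, card_pair hab]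
      · simp [mem_powersetCard, insert_subset_iff, hc, hx, card_pair hxc.symm]
  rw [key, card_insert_of_notMem, card_image_of_injOn, card_erase_of_mem hc]
  · have := card_pos.2 ⟨c, hc⟩
    omega
  · intro x hx y hy hxy
    have hx' : x ≠ c := (mem_erase.1 hx).1
    have : x ∈ ({c, y} : Finset ℕ) := by
      have : x ∈ ({c, x} : Finset ℕ) := by simp
      simpa only [hxy] using this
    simpa [hx'] using this
  · rw [mem_image]
    rintro ⟨x, -, hx⟩
    have : c ∈ ({a, b} : Finset ℕ) := by rw [← hx]; simp
    simp [hac.symm, hbc.symm] at this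

lemma exists_cherry {s A B : Finset ℕ} (hA : A ∈ powersetCard 2 s) (hB : B ∈ powersetCard 2 s)
    (hAB : A ≠ B) (h : (A ∩ B).Nonempty) :
    ∃ c a b, c ∈ s ∧ a ∈ s ∧ b ∈ s ∧ a ≠ c ∧ b ≠ c ∧ a ≠ b ∧ A = {c, a} ∧ B = {c, b} := by
  obtain ⟨c, hc⟩ := h
  rw [mem_inter] at hc
  obtain ⟨a, hac, ha, rfl⟩ := exists_pair_of_mem_of_mem_powersetCard_two hA hc.1
  obtain ⟨b, hbc, hb, rfl⟩ := exists_pair_of_mem_of_mem_powersetCard_two hB hc.2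
  exact ⟨c, a, b, (mem_powersetCard.1 hA).1 hc.1, ha, hb, hac, hbc,
    by rintro rfl; exact hAB rfl, rfl, rfl⟩

lemma card_add_card_le_six_of_disjoint {s : Finset ℕ} {F G : Finset (Finset ℕ)}
    (hF : F ⊆ powersetCard 2 s) (hG : G ⊆ powersetCard 2 s)
    (hcross : ∀ A ∈ F, ∀ B ∈ G, (A ∩ B).Nonempty) (hFG : F.card ≤ G.card)
    {A B : Finset ℕ} (hA : A ∈ F) (hB : B ∈ F) (hAB : ¬ (A ∩ B).Nonempty) :
    F.card + G.card ≤ 6 := by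
  obtain ⟨a, b, hab, -, -, rfl⟩ := exists_pair_of_mem_powersetCard_two (hF hA)
  obtain ⟨c, d, hcd, -, -, rfl⟩ := exists_pair_of_mem_powersetCard_two (hF hB)
  simp only [pair_inter_nonempty, mem_insert, mem_singleton, not_or] at hAB
  obtain ⟨⟨hac, had⟩, hbc, hbd⟩ := hAB
  have hsub : G ⊆ {{a, c}, {a, d}, {b, c}, {b, d}} := by
    intro X hX
    simp only [mem_insert, mem_singleton]
    rcases pair_inter_nonempty.1 (hcross _ hA _ hX) with h1 | h1 <;>
    rcases pair_inter_nonempty.1 (hcross _ hB _ hX) with h2 | h2 <;>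
    simp [eq_pair_of_mem_of_mem (hG hX) h1 h2 (by assumption)]
  have h4 : ({{a, c}, {a, d}, {b, c}, {b, d}} : Finset (Finset ℕ)).card ≤ 4 := card_le_four
  have hG4 := card_le_card hsub
  by_cases h : G.card ≤ 3
  · omega
  have hGeq := eq_of_subset_of_card_le hsub (by omega)
  have hF2 : F ⊆ {{a, b}, {c, d}} := by
    intro X hX
    have m : ∀ x y, {x, y} ∈ G → x ∈ X ∨ y ∈ X := fun x y h =>
      pair_inter_nonempty.1 (by rw [inter_comm]; exact hcross _ hX _ h)
    have m1 := m a c (by simp [hGeq])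
    have m2 := m a d (by simp [hGeq])
    have m3 := m b c (by simp [hGeq])
    have m4 := m b d (by simp [hGeq])
    simp only [mem_insert, mem_singleton]
    by_cases ha : a ∈ X
    · by_cases hb : b ∈ X
      · exact Or.inl (eq_pair_of_mem_of_mem (hF hX) ha hb hab)
      · exact Or.inr (eq_pair_of_mem_of_mem (hF hX) (m3.resolve_left hb) (m4.resolve_left hb) hcd)
    · exact Or.inr (eq_pair_of_mem_of_mem (hF hX) (m1.resolve_left ha) (m2.resolve_left ha) hcd)
  have := (card_le_card hF2).trans card_le_two
  omega

lemma subset_triangle {s : Finset ℕ} {H : Finset (Finset ℕ)} {a b c : ℕ}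
    (hH : H ⊆ powersetCard 2 s) (hac : a ≠ c) (hbc : b ≠ c) (hab : a ≠ b)
    (h1 : ∀ B ∈ H, c ∈ B ∨ a ∈ B) (h2 : ∀ B ∈ H, c ∈ B ∨ b ∈ B) (h3 : ∀ B ∈ H, a ∈ B ∨ b ∈ B) :
    H ⊆ {{c, a}, {c, b}, {a, b}} := by
  intro B hB
  have e1 := eq_pair_of_mem_of_mem (x := c) (y := a) (hH hB)
  have e2 := eq_pair_of_mem_of_mem (x := c) (y := b) (hH hB)
  have e3 := eq_pair_of_mem_of_mem (x := a) (y := b) (hH hB)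
  have := h1 B hB
  have := h2 B hB
  have := h3 B hB
  simp only [mem_insert, mem_singleton]
  have := hac.symm
  have := hbc.symm
  tauto

lemma card_add_card_le_six_of_three_le {n : ℕ} (hn : 1 ≤ n) {F G : Finset (Finset ℕ)}
    (hF : F ⊆ powersetCard 2 (Icc 1 n)) (hG : G ⊆ powersetCard 2 (Icc 1 n))
    (hcross : ∀ A ∈ F, ∀ B ∈ G, (A ∩ B).Nonempty) (hFG : F.card ≤ G.card)
    (hB : ¬ SubIsoTo n (F ∪ G) (Bfam n)) (h3 : 3 ≤ F.card) : F.card + G.card ≤ 6 := by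
  by_cases hint : ∀ A ∈ F, ∀ B ∈ F, (A ∩ B).Nonempty
  swap
  · push Not at hint
    obtain ⟨A, hA, B, hB', h⟩ := hint
    exact card_add_card_le_six_of_disjoint hF hG hcross hFG hA hB' (by simp [h])
  obtain ⟨X, Y, hX, hY, hXY⟩ := one_lt_card_iff.1 (show 1 < F.card by omega)
  obtain ⟨c, a, b, hc, -, -, hac, hbc, hab, rfl, rfl⟩ :=
    exists_cherry (hF hX) (hF hY) hXY (hint _ hX _ hY)
  by_cases hstar : ∀ A ∈ F, c ∈ A
  · have hGc := mem_of_cross_star hF hG hcross h3 hstar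
    refine absurd (subIsoTo_Bfam_of_star (union_subset hF hG) hn hc ?_) hB
    intro B h
    exact (mem_union.1 h).elim (hstar B) (hGc B)
  · push Not at hstar
    obtain ⟨Z, hZ, hcZ⟩ := hstar
    have haZ := (pair_inter_nonempty.1 (hint _ hX _ hZ)).resolve_left hcZ
    have hbZ := (pair_inter_nonempty.1 (hint _ hY _ hZ)).resolve_left hcZ
    obtain rfl := eq_pair_of_mem_of_mem (hF hZ) haZ hbZ hab
    have hsub := fun (H : Finset (Finset ℕ)) (hH : H ⊆ powersetCard 2 (Icc 1 n))
        (hx : ∀ A ∈ F, ∀ B ∈ H, (A ∩ B).Nonempty) =>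
      (card_le_card (subset_triangle hH hac hbc hab
        (fun B hB => pair_inter_nonempty.1 (hx _ hX B hB))
        (fun B hB => pair_inter_nonempty.1 (hx _ hY B hB))
        (fun B hB => pair_inter_nonempty.1 (hx _ hZ B hB)))).trans card_le_three
    have := hsub F hF hint
    have := hsub G hG hcross
    omega

lemma choose_two_sub_choose_two (n : ℕ) (hn : 4 ≤ n) :
    (n.choose 2 : ℤ) - (n - 2).choose 2 - (n - 3).choose 1 + 2 = n + 2 := by
  obtain ⟨m, rfl⟩ := Nat.exists_eq_add_of_le' hn
  rw [show m + 4 - 2 = m + 2 by omega, show m + 4 - 3 = m + 1 by omega]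
  have h1 : (m + 4).choose 2 = (m + 3) + (m + 3).choose 2 := by
    rw [Nat.choose_succ_succ' (m + 3) 1, Nat.choose_one_right]
  have h2 : (m + 3).choose 2 = (m + 2) + (m + 2).choose 2 := by
    rw [Nat.choose_succ_succ' (m + 2) 1, Nat.choose_one_right]
  rw [h1, h2, Nat.choose_one_right]
  push_cast
  ring

theorem stmt_15 (n : ℕ) (hn : 4 ≤ n)
    (F G : Finset (Finset ℕ))
    (hF : F ⊆ powersetCard 2 (Icc 1 n))
    (hG : G ⊆ powersetCard 2 (Icc 1 n))
    (hcross : ∀ A ∈ F, ∀ B ∈ G, (A ∩ B).Nonempty)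
    (hFG : F.card ≤ G.card) (hF2 : 2 ≤ F.card)
    (hB : ¬ SubIsoTo n (F ∪ G) (Bfam n)) :
    ((F.card : ℤ) + G.card ≤
      (n.choose 2 : ℤ) - (n - 2).choose 2 - (n - 3).choose 1 + 2) ∧
    (5 ≤ n →
      (((F.card : ℤ) + G.card =
          (n.choose 2 : ℤ) - (n - 2).choose 2 - (n - 3).choose 1 + 2) ↔
        ∃ F₁ ∈ powersetCard 2 (Icc 1 n), ∃ F₂ ∈ powersetCard 2 (Icc 1 n),
          (F₁ ∩ F₂).card = 1 ∧ F = {F₁, F₂} ∧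
          G = (powersetCard 2 (Icc 1 n)).filter fun B =>
            (B ∩ F₁).Nonempty ∧ (B ∩ F₂).Nonempty)) := by
  rw [choose_two_sub_choose_two n hn]
  have hrev : ∀ F₁ ∈ powersetCard 2 (Icc 1 n), ∀ F₂ ∈ powersetCard 2 (Icc 1 n),
      (F₁ ∩ F₂).card = 1 → F₁ ≠ F₂ ∧ ((powersetCard 2 (Icc 1 n)).filter fun B =>
        (B ∩ F₁).Nonempty ∧ (B ∩ F₂).Nonempty).card = n := by
    intro F₁ h₁ F₂ h₂ h
    have hne : F₁ ≠ F₂ := by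
      rintro rfl
      rw [inter_self, (mem_powersetCard.1 h₁).2] at h
      omega
    refine ⟨hne, ?_⟩
    obtain ⟨c, a, b, hc, ha, hb, hac, hbc, hab, rfl, rfl⟩ :=
      exists_cherry h₁ h₂ hne (card_pos.1 (by omega))
    rw [card_filter_meet_cherry hc ha hb hac hbc hab]
    simp
  have hback : (∃ F₁ ∈ powersetCard 2 (Icc 1 n), ∃ F₂ ∈ powersetCard 2 (Icc 1 n),
      (F₁ ∩ F₂).card = 1 ∧ F = {F₁, F₂} ∧
      G = (powersetCard 2 (Icc 1 n)).filter fun B =>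
        (B ∩ F₁).Nonempty ∧ (B ∩ F₂).Nonempty) → (F.card : ℤ) + G.card = n + 2 := by
    rintro ⟨F₁, h₁, F₂, h₂, h, hFeq, hGeq⟩
    obtain ⟨hne, hcard⟩ := hrev F₁ h₁ F₂ h₂ h
    rw [hGeq, hcard, hFeq, card_pair hne]
    push_cast
    ring
  by_cases h6 : F.card + G.card ≤ 6
  · exact ⟨by omega, fun h5 => ⟨fun h => by omega, hback⟩⟩
  have hF2' : F.card = 2 := by
    by_contra h
    exact h6 (card_add_card_le_six_of_three_le (by omega) hF hG hcross hFG hB (by omega))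
  obtain ⟨F₁, F₂, hne, hFeq⟩ := card_eq_two.1 hF2'
  have m₁ : F₁ ∈ F := by simp [hFeq]
  have m₂ : F₂ ∈ F := by simp [hFeq]
  have hmeet : (F₁ ∩ F₂).Nonempty := by
    by_contra h
    exact h6 (card_add_card_le_six_of_disjoint hF hG hcross hFG m₁ m₂ h)
  have hone : (F₁ ∩ F₂).card = 1 := by
    obtain ⟨c, a, b, -, -, -, hac, hbc, hab, rfl, rfl⟩ := exists_cherry (hF m₁) (hF m₂) hne hmeet
    rw [← insert_inter_distrib, card_eq_one]
    exact ⟨c, by simp [singleton_inter_of_notMem, hab]⟩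
  have hcard := (hrev F₁ (hF m₁) F₂ (hF m₂) hone).2
  have hsub : G ⊆ (powersetCard 2 (Icc 1 n)).filter fun B =>
      (B ∩ F₁).Nonempty ∧ (B ∩ F₂).Nonempty := by
    intro B h
    refine mem_filter.2 ⟨hG h, ?_, ?_⟩
    · rw [inter_comm]; exact hcross _ m₁ _ h
    · rw [inter_comm]; exact hcross _ m₂ _ h
  have hle := card_le_card hsub
  refine ⟨by omega, fun _ => ⟨fun h => ?_, hback⟩⟩
  exact ⟨F₁, hF m₁, F₂, hF m₂, hone, hFeq, eq_of_subset_of_card_le hsub (by omega)⟩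
end
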